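/- The block-diagonal approximation is close to the adjacency matrix. Under assumptions (A1) and (A2), for every ν > 0 there exists C_ν > 0 such that with ν-high probability ‖Â − A^p‖ ≤ C_ν √(log N / log log N) and ‖Â − A‖ ≤ C_ν √(log N / log log N). -/

import Mathlib

open MeasureTheory Real

namespace GRG

variable {N : ℕ}

/-! ### Generic graph-theoretic definitions over an adjacency relation on `Fin N` -/

/-- The degree of a vertex with respect to an adjacency relation. -/
noncomputable def degA (A : Fin N → Fin N → Prop) (x : Fin N) : ℕ :=
  {y | A x y}.ncard

/-- The strict total order `≺`: `x ≺ y` iff `D_x < D_y`, or `D_x = D_y` and `x > y`. -/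
def precA (A : Fin N → Fin N → Prop) (x y : Fin N) : Prop :=
  degA A x < degA A y ∨ (degA A x = degA A y ∧ y < x)

/-- `γ 0, γ 1, …, γ l` is a path for the adjacency relation `A`. -/
def IsPathOn (A : Fin N → Fin N → Prop) (l : ℕ) (γ : ℕ → Fin N) : Prop :=
  ∀ i < l, A (γ i) (γ (i + 1))

/-- A path of length `l` is simple: all vertices distinct except possibly endpoints. -/
def IsSimplePath (l : ℕ) (γ : ℕ → Fin N) : Prop :=
  ∀ i j, i < j → j ≤ l → ¬(i = 0 ∧ j = l) → γ i ≠ γ j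

/-- Two paths are edge-disjoint. -/
def EdgeDisjoint (l l' : ℕ) (γ γ' : ℕ → Fin N) : Prop :=
  ∀ i < l, ∀ j < l',
    ¬((γ i = γ' j ∧ γ (i + 1) = γ' (j + 1)) ∨ (γ i = γ' (j + 1) ∧ γ (i + 1) = γ' j))

/-- `S_1^cyc(x)`: neighbours of `x` that start a simple cycle through `x`
of length at most `2r+1`. -/
def S1cycA (A : Fin N → Fin N → Prop) (r : ℕ) (x : Fin N) : Set (Fin N) :=
  {y | A x y ∧ ∃ l γ, 3 ≤ l ∧ l ≤ 2 * r + 1 ∧ γ 0 = x ∧ γ 1 = y ∧ γ l = x ∧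
    IsPathOn A l γ ∧ IsSimplePath l γ}

/-- `S_1^du(x)`: neighbours `y ∉ S_1^cyc(x)` of `x` that have a neighbour
`z ∉ S_1^cyc(y)` with `y ≺ x ≺ z`. -/
def S1duA (A : Fin N → Fin N → Prop) (r : ℕ) (x : Fin N) : Set (Fin N) :=
  {y | A x y ∧ y ∉ S1cycA A r x ∧ precA A y x ∧
    ∃ z, A y z ∧ z ∉ S1cycA A r y ∧ precA A x z}

/-- Adjacency in the graph `G^nc` (after removing the cycle-creating edges). -/
def AdjNCA (A : Fin N → Fin N → Prop) (r : ℕ) (x y : Fin N) : Prop :=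
  A x y ∧ y ∉ S1cycA A r x ∧ x ∉ S1cycA A r y

/-- Adjacency in the pruned graph `G^p` (after further removing the down-up edges). -/
def AdjPA (A : Fin N → Fin N → Prop) (r : ℕ) (x y : Fin N) : Prop :=
  AdjNCA A r x y ∧ y ∉ S1duA A r x ∧ x ∉ S1duA A r y

/-- Degree in the pruned graph. -/
noncomputable def degPA (A : Fin N → Fin N → Prop) (r : ℕ) (x : Fin N) : ℕ :=
  {y | AdjPA A r x y}.ncard

/-- `S_1^{p−}(x)`: pruned-graph neighbours of `x` that are smaller than `x` for `≺`. -/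
def S1pmA (A : Fin N → Fin N → Prop) (r : ℕ) (x : Fin N) : Set (Fin N) :=
  {y | AdjPA A r x y ∧ precA A y x}

/-- `D_x^{p−}`. -/
noncomputable def degPmA (A : Fin N → Fin N → Prop) (r : ℕ) (x : Fin N) : ℕ :=
  (S1pmA A r x).ncard

/-- `Sib^−(x)`: the smaller siblings of `x` (children of the parent of `x`
that are smaller than `x`). -/
def SibmA (A : Fin N → Fin N → Prop) (r : ℕ) (x : Fin N) : Set (Fin N) :=
  {y | ∃ p, AdjPA A r x p ∧ precA A x p ∧ AdjPA A r p y ∧ precA A y p ∧ precA A y x}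

/-- The normalization constant `Z_x` (note `2/0 = 0` in Lean, so this agrees with the
convention `Z_x = 2` when `Sib^−(x) = ∅`). -/
noncomputable def ZxA (A : Fin N → Fin N → Prop) (r : ℕ) (x : Fin N) : ℝ :=
  2 + 2 / (SibmA A r x).ncard

/-- The indicator vector of a set of vertices. -/
noncomputable def indVec (S : Set (Fin N)) : Fin N → ℝ :=
  S.indicator 1

/-- The approximate eigenvector `u_σ(x)`. -/
noncomputable def uVecA (A : Fin N → Fin N → Prop) (r : ℕ) (σ : ℝ) (x : Fin N) :
    Fin N → ℝ := fun y =>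
  (Real.sqrt (ZxA A r x))⁻¹ *
    (indVec {x} y + σ * (Real.sqrt (degPmA A r x))⁻¹ * indVec (S1pmA A r x) y -
      indVec (SibmA A r x) y / (SibmA A r x).ncard)

/-- The star vector `v_σ(x)`. -/
noncomputable def vVecA (A : Fin N → Fin N → Prop) (r : ℕ) (σ : ℝ) (x : Fin N) :
    Fin N → ℝ := fun y =>
  (Real.sqrt 2)⁻¹ *
    (indVec {x} y + σ * (Real.sqrt (degPmA A r x))⁻¹ * indVec (S1pmA A r x) y)

/-- Euclidean scalar product on `ℝ^N`. -/
noncomputable def dotR (f g : Fin N → ℝ) : ℝ := ∑ y, f y * g y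

/-- The Euclidean (`ℓ² → ℓ²`) operator norm of an `N × N` real matrix. -/
noncomputable def opNorm (M : Matrix (Fin N) (Fin N) ℝ) : ℝ :=
  ‖Matrix.toEuclideanCLM (𝕜 := ℝ) M‖

open Classical in
/-- The adjacency matrix of the pruned graph. -/
noncomputable def adjMatrixPA (A : Fin N → Fin N → Prop) (r : ℕ) :
    Matrix (Fin N) (Fin N) ℝ := fun x y => if AdjPA A r x y then 1 else 0

/-- The threshold `ξ_ν`. -/
noncomputable def xi (ν δ : ℝ) (N : ℕ) : ℝ :=
  3 * (ν + 1) * (2 - 3 * δ) / ((1 - δ) * (1 - 2 * δ)) *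
    (Real.log N / Real.log (Real.log N))

/-- The set `V_ν^{(h)}` of high-degree vertices. -/
def VhA (A : Fin N → Fin N → Prop) (ν δ : ℝ) : Set (Fin N) :=
  {x | xi ν δ N ≤ (degA A x : ℝ)}

/-- The projection `Π^p` onto the span of the vectors `u_σ(x)`, `x ∈ V_ν^{(h)}`. -/
noncomputable def PiPA (A : Fin N → Fin N → Prop) (r : ℕ) (ν δ : ℝ) :
    Matrix (Fin N) (Fin N) ℝ :=
  ∑ x : Fin N, Set.indicator (VhA A ν δ) (fun _ => (1 : ℝ)) x •
    (Matrix.vecMulVec (uVecA A r 1 x) (uVecA A r 1 x) +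
      Matrix.vecMulVec (uVecA A r (-1) x) (uVecA A r (-1) x))

/-- The block-diagonal approximation `Â`. -/
noncomputable def AhatA (A : Fin N → Fin N → Prop) (r : ℕ) (ν δ : ℝ) :
    Matrix (Fin N) (Fin N) ℝ :=
  (∑ x : Fin N, Set.indicator (VhA A ν δ) (fun _ => (1 : ℝ)) x •
    (Real.sqrt (degPmA A r x) •
      (Matrix.vecMulVec (uVecA A r 1 x) (uVecA A r 1 x) -
        Matrix.vecMulVec (uVecA A r (-1) x) (uVecA A r (-1) x)))) +
  (1 - PiPA A r ν δ) * adjMatrixPA A r * (1 - PiPA A r ν δ)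

/-! ### The generalized random graph (GRG) model -/

/-- Index set of potential edges. -/
abbrev EdgeIdx (N : ℕ) := {p : Fin N × Fin N // p.1 < p.2}

/-- The edge probabilities `p_{xy} = w_x w_y / (Σ_z w_z + w_x w_y)`. -/
noncomputable def pGRG (w : Fin N → ℝ) (x y : Fin N) : ℝ :=
  w x * w y / ((∑ z, w z) + w x * w y)

/-- Bernoulli measure with parameter `p` on `Bool`. -/
noncomputable def bern (p : ℝ) : Measure Bool :=
  ENNReal.ofReal p • Measure.dirac true + ENNReal.ofReal (1 - p) • Measure.dirac false

instance (p : ℝ) : IsFiniteMeasure (bern p) := by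
  constructor
  simp only [bern, Measure.coe_add, Measure.coe_smul, Pi.add_apply, Pi.smul_apply,
    smul_eq_mul, measure_univ, mul_one]
  exact ENNReal.add_lt_top.mpr ⟨ENNReal.ofReal_lt_top, ENNReal.ofReal_lt_top⟩

/-- The law of the GRG: independent Bernoulli edge indicators. -/
noncomputable def grgMeasure (w : Fin N → ℝ) : Measure (EdgeIdx N → Bool) :=
  Measure.pi fun e => bern (pGRG w e.val.1 e.val.2)

/-- The (random) adjacency matrix. -/
noncomputable def adjMatrix (ω : EdgeIdx N → Bool) : Matrix (Fin N) (Fin N) ℝ :=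
  fun x y =>
    if h : x < y then (if ω ⟨(x, y), h⟩ then 1 else 0)
    else if h' : y < x then (if ω ⟨(y, x), h'⟩ then 1 else 0)
    else 0

/-- The (random) adjacency relation. -/
def Adj (ω : EdgeIdx N → Bool) (x y : Fin N) : Prop := adjMatrix ω x y = 1

/-- The (random) degree `D_x`. -/
noncomputable def deg (ω : EdgeIdx N → Bool) (x : Fin N) : ℕ := degA (Adj ω) x

/-- The first empirical moment `m_1`. -/
noncomputable def m1 (w : Fin N → ℝ) : ℝ := (∑ x, w x) / N

/-- The second empirical moment `m_2`. -/
noncomputable def m2 (w : Fin N → ℝ) : ℝ := (∑ x, w x ^ 2) / N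

/-- The expected degree `d_x = E[D_x]`. -/
noncomputable def dExp (w : Fin N → ℝ) (x : Fin N) : ℝ :=
  ∫ ω, (deg ω x : ℝ) ∂(grgMeasure w)

/-- The set `W_{λ,η}` of resonant vertices. -/
def resonant (ω : EdgeIdx N → Bool) (lam η : ℝ) : Set (Fin N) :=
  {x | |Real.sqrt (deg ω x) - lam| ≤ η}

/-- The set `V*_{ν,η}` of isolated vertices. -/
noncomputable def Vstar (w : Fin N → ℝ) (ν η : ℝ) : Set (Fin N) :=
  {x | (4 * ν / 9) * Real.log N ≤ dExp w x ∧
    ∀ y, y ≠ x →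
      max (4 * Real.sqrt (ν * Real.log N * dExp w x) +
            4 * Real.sqrt (ν * Real.log N * dExp w y))
          (16 * η ^ 2) ≤ |dExp w x - dExp w y|}

end GRG

section
open MeasureTheory Real

namespace GRGProof
open GRG Matrix

variable {N : ℕ}

lemma clm_apply (M : Matrix (Fin N) (Fin N) ℝ) (v : EuclideanSpace ℝ (Fin N)) (x : Fin N) :
    (Matrix.toEuclideanCLM (𝕜 := ℝ) M v) x = ∑ y, M x y * v y := by
  simp [Matrix.ofLp_toEuclideanCLM, Matrix.mulVec, dotProduct]

lemma opNorm_nonneg (M : Matrix (Fin N) (Fin N) ℝ) : 0 ≤ opNorm M := norm_nonneg _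

lemma opNorm_le_sqrt {M : Matrix (Fin N) (Fin N) ℝ} {c : ℝ} (hc : 0 ≤ c)
    (h : ∀ v : Fin N → ℝ, ∑ x, (∑ y, M x y * v y) ^ 2 ≤ c * ∑ y, v y ^ 2) :
    opNorm M ≤ Real.sqrt c := by
  apply ContinuousLinearMap.opNorm_le_bound _ (Real.sqrt_nonneg _)
  intro v
  rw [EuclideanSpace.norm_eq, EuclideanSpace.norm_eq, ← Real.sqrt_mul hc]
  apply Real.sqrt_le_sqrt
  have := h v
  simpa [clm_apply] using this

lemma opNorm_add (M M' : Matrix (Fin N) (Fin N) ℝ) : opNorm (M + M') ≤ opNorm M + opNorm M' := by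
  unfold opNorm; rw [map_add]; exact norm_add_le _ _

lemma opNorm_sub (M M' : Matrix (Fin N) (Fin N) ℝ) : opNorm (M - M') ≤ opNorm M + opNorm M' := by
  unfold opNorm; rw [map_sub]; exact norm_sub_le _ _

lemma opNorm_mul (M M' : Matrix (Fin N) (Fin N) ℝ) : opNorm (M * M') ≤ opNorm M * opNorm M' := by
  unfold opNorm; rw [map_mul]; exact norm_mul_le _ _

lemma opNorm_transpose (M : Matrix (Fin N) (Fin N) ℝ) : opNorm Mᵀ = opNorm M := by
  unfold opNorm
  have : Mᵀ = star M := by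
    ext i j; simp
  rw [this, map_star, ContinuousLinearMap.star_eq_adjoint, LinearIsometryEquiv.norm_map]

lemma opNorm_one_le : opNorm (1 : Matrix (Fin N) (Fin N) ℝ) ≤ 1 := by
  have := opNorm_le_sqrt (M := (1 : Matrix (Fin N) (Fin N) ℝ)) (c := 1) zero_le_one (by
    intro v; simp [Matrix.one_apply])
  simpa using this

lemma opNorm_diag_le (d : Fin N → ℝ) {c : ℝ} (hc : 0 ≤ c) (h : ∀ x, |d x| ≤ c) :
    opNorm (Matrix.diagonal d) ≤ c := by
  have := opNorm_le_sqrt (M := Matrix.diagonal d) (c := c^2) (by positivity) (by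
    intro v
    simp only [Matrix.diagonal_apply, ite_mul, zero_mul, Finset.sum_ite_eq, Finset.mem_univ, if_true]
    rw [Finset.mul_sum]
    apply Finset.sum_le_sum
    intro x _
    rw [mul_pow]
    apply mul_le_mul_of_nonneg_right _ (sq_nonneg _)
    rw [← sq_abs]; gcongr; exact h x)
  rwa [Real.sqrt_sq hc] at this

/-- Weighted Schur test. -/
lemma schur {B : Matrix (Fin N) (Fin N) ℝ} (hB : ∀ y x, 0 ≤ B y x) (f : Fin N → ℝ)
    (hf : ∀ x, 0 < f x) {R : ℝ} (hR : 0 ≤ R)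
    (h : ∀ x, ∑ y, B y x * ∑ x', B y x' * f x' ≤ R * f x) : opNorm B ≤ Real.sqrt R := by
  apply opNorm_le_sqrt hR
  intro v
  have h1 : ∀ y, (∑ x, B y x * v x) ^ 2 ≤ (∑ x, B y x * f x) * (∑ x, B y x * (v x ^ 2 / f x)) := by
    intro y
    apply Finset.sum_sq_le_sum_mul_sum_of_sq_le_mul
    · intro i _; exact mul_nonneg (hB _ _) (hf _).le
    · intro i _; exact mul_nonneg (hB _ _) (div_nonneg (sq_nonneg _) (hf _).le)
    · intro i _
      have := (hf i).ne'
      apply le_of_eq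
      field_simp
  calc ∑ y, (∑ x, B y x * v x) ^ 2
      ≤ ∑ y, (∑ x, B y x * f x) * (∑ x, B y x * (v x ^ 2 / f x)) :=
        Finset.sum_le_sum fun y _ => h1 y
    _ = ∑ x, (v x ^ 2 / f x) * ∑ y, B y x * ∑ x', B y x' * f x' := by
        have e1 : ∀ y, (∑ x, B y x * f x) * (∑ x, B y x * (v x ^ 2 / f x)) =
            ∑ x, (∑ x', B y x' * f x') * (B y x * (v x ^ 2 / f x)) := by
          intro y; rw [Finset.mul_sum]
        rw [Finset.sum_congr rfl fun y _ => e1 y, Finset.sum_comm]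
        apply Finset.sum_congr rfl; intro x _
        rw [Finset.mul_sum]
        apply Finset.sum_congr rfl; intro y _
        ring
    _ ≤ ∑ x, (v x ^ 2 / f x) * (R * f x) := by
        apply Finset.sum_le_sum; intro x _
        exact mul_le_mul_of_nonneg_left (h x) (div_nonneg (sq_nonneg _) (hf _).le)
    _ = R * ∑ y, v y ^ 2 := by
        rw [Finset.mul_sum]
        apply Finset.sum_congr rfl; intro x _
        have := (hf x).ne'
        field_simp

/-- Unweighted Schur test, columns version. -/
lemma schur_col {B : Matrix (Fin N) (Fin N) ℝ} (hB : ∀ y x, 0 ≤ B y x) {R : ℝ} (hR : 0 ≤ R)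
    (h : ∀ x, ∑ y, B y x * ∑ x', B y x' ≤ R) : opNorm B ≤ Real.sqrt R :=
  schur hB (fun _ => 1) (fun _ => one_pos) hR (by simpa using h)

/-- Unweighted Schur test, rows version. -/
lemma schur_row {B : Matrix (Fin N) (Fin N) ℝ} (hB : ∀ y x, 0 ≤ B y x) {R : ℝ} (hR : 0 ≤ R)
    (h : ∀ x, ∑ y, B x y * ∑ x', B x' y ≤ R) : opNorm B ≤ Real.sqrt R := by
  rw [← opNorm_transpose]
  exact schur_col (fun y x => hB x y) hR h

/-- Orthogonal columns. -/
lemma opNorm_of_gram {B : Matrix (Fin N) (Fin N) ℝ} {c : ℝ} (hc : 0 ≤ c) (d : Fin N → ℝ)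
    (hd : ∀ x, d x ≤ c)
    (h : ∀ x x', ∑ y, B y x * B y x' = if x = x' then d x else 0) : opNorm B ≤ Real.sqrt c := by
  apply opNorm_le_sqrt hc
  intro v
  have : ∑ y, (∑ x, B y x * v x) ^ 2 = ∑ x, ∑ x', v x * v x' * ∑ y, B y x * B y x' := by
    simp_rw [sq, Finset.sum_mul_sum, Finset.mul_sum]
    rw [Finset.sum_comm]
    apply Finset.sum_congr rfl; intro x _
    rw [Finset.sum_comm]
    apply Finset.sum_congr rfl; intro x' _
    apply Finset.sum_congr rfl; intro y _
    ring
  rw [this]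
  simp_rw [h]
  simp only [mul_ite, mul_zero, Finset.sum_ite_eq, Finset.mem_univ, if_true]
  rw [Finset.mul_sum]
  apply Finset.sum_le_sum; intro x _
  nlinarith [hd x, sq_nonneg (v x)]

end GRGProof
end

section
open MeasureTheory Real

namespace GRGProof
open GRG Matrix

variable {N : ℕ}

section det1
variable {A : Fin N → Fin N → Prop} {r : ℕ}

lemma prec_irrefl (x : Fin N) : ¬ precA A x x := by
  unfold precA; simp

lemma prec_trans {x y z : Fin N} (h : precA A x y) (h' : precA A y z) : precA A x z := by
  unfold precA at *; omega

lemma prec_total {x y : Fin N} (h : x ≠ y) : precA A x y ∨ precA A y x := by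
  unfold precA; omega

lemma prec_le {x y : Fin N} (h : precA A x y) : degA A x ≤ degA A y := by
  unfold precA at *; omega

lemma adjP_symm (hs : ∀ x y, A x y → A y x) {x y : Fin N} (h : AdjPA A r x y) : AdjPA A r y x := by
  obtain ⟨⟨h1, h2, h3⟩, h4, h5⟩ := h
  exact ⟨⟨hs _ _ h1, h3, h2⟩, h5, h4⟩

/-- parents are unique -/
lemma parent_unique (hs : ∀ x y, A x y → A y x) {p q y : Fin N} (hp : y ∈ S1pmA A r p)
    (hq : y ∈ S1pmA A r q) : p = q := by
  have key : ∀ {p q : Fin N}, y ∈ S1pmA A r p → y ∈ S1pmA A r q → precA A p q → False := by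
    intro p q hp hq hpq
    obtain ⟨⟨⟨h1, h2, h3⟩, h4, h5⟩, h6⟩ := hp
    obtain ⟨⟨⟨k1, k2, k3⟩, k4, k5⟩, k6⟩ := hq
    exact h4 ⟨h1, h2, h6, q, hs _ _ k1, k3, hpq⟩
  by_contra hne
  rcases prec_total (A := A) hne with h | h
  · exact key hp hq h
  · exact key hq hp h

lemma sib_iff (hs : ∀ x y, A x y → A y x) {x y : Fin N} :
    y ∈ SibmA A r x ↔ ∃ p, x ∈ S1pmA A r p ∧ y ∈ S1pmA A r p ∧ precA A y x := by
  constructor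
  · rintro ⟨p, h1, h2, h3, h4, h5⟩
    exact ⟨p, ⟨adjP_symm hs h1, h2⟩, ⟨h3, h4⟩, h5⟩
  · rintro ⟨p, ⟨h1, h2⟩, ⟨h3, h4⟩, h5⟩
    exact ⟨p, adjP_symm hs h1, h2, h3, h4, h5⟩

lemma sib_iff' (hs : ∀ x y, A x y → A y x) {x y p : Fin N} (hx : x ∈ S1pmA A r p) :
    y ∈ SibmA A r x ↔ y ∈ S1pmA A r p ∧ precA A y x := by
  rw [sib_iff hs]
  constructor
  · rintro ⟨q, h1, h2, h3⟩
    rw [parent_unique hs h1 hx] at h2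
    exact ⟨h2, h3⟩
  · rintro ⟨h2, h3⟩
    exact ⟨p, hx, h2, h3⟩

lemma self_not_sib (hs : ∀ x y, A x y → A y x) {x : Fin N} : x ∉ SibmA A r x := by
  rw [sib_iff hs]
  rintro ⟨p, _, _, h⟩
  exact prec_irrefl _ h

lemma indVec_eq (S : Set (Fin N)) [DecidablePred (· ∈ S)] (y : Fin N) :
    indVec S y = if y ∈ S then 1 else 0 := by
  unfold indVec
  by_cases h : y ∈ S <;> simp [h]

open Classical in
lemma sum_indVec (S : Set (Fin N)) : ∑ y, indVec S y = (S.ncard : ℝ) := by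
  simp_rw [indVec_eq]
  rw [Finset.sum_boole, Set.ncard_eq_toFinset_card']
  congr 2
  ext; simp

lemma indVec_mul_self (S : Set (Fin N)) (y : Fin N) : indVec S y * indVec S y = indVec S y := by
  classical
  rw [indVec_eq]; split_ifs <;> simp

lemma indVec_nonneg (S : Set (Fin N)) (y : Fin N) : 0 ≤ indVec S y := by
  classical
  rw [indVec_eq]; split_ifs <;> simp

variable (A r) in
noncomputable def eM : Matrix (Fin N) (Fin N) ℝ := fun y x =>
  indVec (SibmA A r x) y / (SibmA A r x).ncard

variable (A r) in
noncomputable def aM : Matrix (Fin N) (Fin N) ℝ := 1 - eM A r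

variable (A r) in
noncomputable def bM : Matrix (Fin N) (Fin N) ℝ := fun y x =>
  (Real.sqrt (degPmA A r x))⁻¹ * indVec (S1pmA A r x) y

variable (A r) in
noncomputable def th (x : Fin N) : ℝ := 2 / ZxA A r x

lemma Z_pos (x : Fin N) : 0 < ZxA A r x := by unfold ZxA; positivity

lemma eM_apply (y x : Fin N) : eM A r y x = indVec (SibmA A r x) y / (SibmA A r x).ncard := rfl

lemma bM_apply (y x : Fin N) : bM A r y x =
    (Real.sqrt (degPmA A r x))⁻¹ * indVec (S1pmA A r x) y := rfl

lemma aM_apply (y x : Fin N) : aM A r y x = (1 : Matrix (Fin N) (Fin N) ℝ) y x - eM A r y x := rfl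

lemma u_eq (σ : ℝ) (x y : Fin N) : uVecA A r σ x y =
    (Real.sqrt (ZxA A r x))⁻¹ * (aM A r y x + σ * bM A r y x) := by
  unfold uVecA
  rw [aM_apply, eM_apply, bM_apply]
  have : indVec {x} y = (1 : Matrix (Fin N) (Fin N) ℝ) y x := by
    classical
    rw [indVec_eq, Matrix.one_apply]; simp
  rw [this]; ring

lemma sqrtZ (x : Fin N) : (Real.sqrt (ZxA A r x))⁻¹ * (Real.sqrt (ZxA A r x))⁻¹ = th A r x / 2 := by
  rw [← mul_inv, Real.mul_self_sqrt (Z_pos x).le, th]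
  field_simp

open Classical in
lemma PiP_eq (ν δ : ℝ) : PiPA A r ν δ =
    aM A r * diagonal (fun x => if x ∈ VhA A ν δ then th A r x else 0) * (aM A r)ᵀ +
    bM A r * diagonal (fun x => if x ∈ VhA A ν δ then th A r x else 0) * (bM A r)ᵀ := by
  ext y z
  unfold PiPA
  simp only [Matrix.sum_apply, Matrix.add_apply, Matrix.smul_apply, vecMulVec_apply, smul_eq_mul,
    Matrix.mul_apply (M := _ * _), mul_diagonal, transpose_apply]
  rw [← Finset.sum_add_distrib]
  apply Finset.sum_congr rfl; intro x _
  rw [u_eq, u_eq, u_eq, u_eq]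
  have := sqrtZ (A := A) (r := r) x
  set s := (Real.sqrt (ZxA A r x))⁻¹
  by_cases h : x ∈ VhA A ν δ
  · simp only [h, Set.indicator_of_mem, if_true]
    linear_combination (2 * (aM A r y x * aM A r z x + bM A r y x * bM A r z x)) * this
  · simp [h]

open Classical in
lemma J_eq (ν δ : ℝ) : (∑ x : Fin N, Set.indicator (VhA A ν δ) (fun _ => (1 : ℝ)) x •
    (Real.sqrt (degPmA A r x) •
      (Matrix.vecMulVec (uVecA A r 1 x) (uVecA A r 1 x) -
        Matrix.vecMulVec (uVecA A r (-1) x) (uVecA A r (-1) x)))) =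
    aM A r * diagonal (fun x => if x ∈ VhA A ν δ then th A r x * Real.sqrt (degPmA A r x) else 0) *
      (bM A r)ᵀ +
    (aM A r * diagonal (fun x => if x ∈ VhA A ν δ then th A r x * Real.sqrt (degPmA A r x) else 0) *
      (bM A r)ᵀ)ᵀ := by
  ext y z
  simp only [Matrix.sum_apply, Matrix.add_apply, Matrix.smul_apply, vecMulVec_apply, smul_eq_mul,
    Matrix.mul_apply (M := _ * _), mul_diagonal, transpose_apply, Matrix.sub_apply]
  rw [← Finset.sum_add_distrib]
  apply Finset.sum_congr rfl; intro x _
  rw [u_eq, u_eq, u_eq, u_eq]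
  have := sqrtZ (A := A) (r := r) x
  set s := (Real.sqrt (ZxA A r x))⁻¹
  by_cases h : x ∈ VhA A ν δ
  · simp only [h, Set.indicator_of_mem, if_true]
    linear_combination (2 * Real.sqrt (degPmA A r x) *
      (aM A r y x * bM A r z x + bM A r y x * aM A r z x)) * this
  · simp [h]

lemma degPm_pos {x y : Fin N} (h : y ∈ S1pmA A r x) : 0 < degPmA A r x :=
  Set.ncard_pos (Set.toFinite _) |>.2 ⟨y, h⟩

lemma sqrt_b (x y : Fin N) : Real.sqrt (degPmA A r x) * bM A r y x = indVec (S1pmA A r x) y := by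
  classical
  unfold bM
  rw [indVec_eq]
  split_ifs with h
  · have : 0 < Real.sqrt (degPmA A r x) := Real.sqrt_pos.2 (by exact_mod_cast degPm_pos h)
    field_simp
  · simp

lemma adjP_eq (hs : ∀ x y, A x y → A y x) (hi : ∀ x, ¬ A x x) :
    adjMatrixPA A r = diagonal (fun x => Real.sqrt (degPmA A r x)) * (bM A r)ᵀ +
      (diagonal (fun x => Real.sqrt (degPmA A r x)) * (bM A r)ᵀ)ᵀ := by
  classical
  ext x y
  simp only [Matrix.add_apply, diagonal_mul, transpose_apply, sqrt_b, indVec_eq]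
  unfold adjMatrixPA
  by_cases h : AdjPA A r x y
  · by_cases hxy : x = y
    · subst hxy
      exact absurd h.1.1 (hi x)
    · rcases prec_total (A := A) hxy with h' | h'
      · have h1 : x ∈ S1pmA A r y := ⟨adjP_symm hs h, h'⟩
        have h2 : y ∉ S1pmA A r x := fun hh => prec_irrefl _ (prec_trans h' hh.2)
        simp [h, h1, h2]
      · have h1 : y ∈ S1pmA A r x := ⟨h, h'⟩
        have h2 : x ∉ S1pmA A r y := fun hh => prec_irrefl _ (prec_trans h' hh.2)
        simp [h, h1, h2]
  · have h1 : y ∉ S1pmA A r x := fun hh => h hh.1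
    have h2 : x ∉ S1pmA A r y := fun hh => h (adjP_symm hs hh.1)
    simp [h, h1, h2]

lemma gram_b (hs : ∀ x y, A x y → A y x) (x x' : Fin N) :
    ∑ y, bM A r y x * bM A r y x' = if x = x' then (if degPmA A r x = 0 then 0 else 1) else 0 := by
  classical
  split_ifs with h h0
  · subst h
    simp [bM_apply, h0]
  · subst h
    have h1 : (0 : ℝ) < degPmA A r x := by exact_mod_cast Nat.pos_of_ne_zero h0
    calc ∑ y, bM A r y x * bM A r y x = ∑ y, (degPmA A r x : ℝ)⁻¹ * indVec (S1pmA A r x) y := by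
          apply Finset.sum_congr rfl; intro y _
          rw [bM_apply, mul_mul_mul_comm, ← mul_inv, Real.mul_self_sqrt h1.le, indVec_mul_self]
      _ = 1 := by
          rw [← Finset.mul_sum, sum_indVec]
          exact inv_mul_cancel₀ h1.ne'
  · apply Finset.sum_eq_zero
    intro y _
    rw [bM_apply, bM_apply, indVec_eq, indVec_eq]
    by_cases h1 : y ∈ S1pmA A r x
    · have : y ∉ S1pmA A r x' := fun h2 => h (parent_unique hs h1 h2)
      simp [this]
    · simp [h1]

lemma opNorm_b (hs : ∀ x y, A x y → A y x) : opNorm (bM A r) ≤ 1 := by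
  have := opNorm_of_gram (B := bM A r) (c := 1) zero_le_one
    (fun x => if degPmA A r x = 0 then 0 else 1) (by intro x; split_ifs <;> norm_num)
    (gram_b hs)
  simpa using this

variable (A r) in
/-- A vertex is nice if it has no parent or it has a smaller sibling. -/
def Nice (x : Fin N) : Prop := (∀ p, x ∉ S1pmA A r p) ∨ (SibmA A r x).Nonempty

lemma sum_e (x : Fin N) (h : (SibmA A r x).Nonempty) : ∑ y, eM A r y x = 1 := by
  simp_rw [eM_apply]
  rw [← Finset.sum_div, sum_indVec, div_self]
  exact_mod_cast ((Set.ncard_pos (Set.toFinite _)).2 h).ne'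

lemma e_zero (x y : Fin N) (h : y ∉ SibmA A r x) : eM A r y x = 0 := by
  classical
  rw [eM_apply, indVec_eq]; simp [h]

lemma e_val (x y : Fin N) (h : y ∈ SibmA A r x) : eM A r y x = (1 : ℝ) / (SibmA A r x).ncard := by
  classical
  rw [eM_apply, indVec_eq]; simp [h]

lemma noparent_sib (hs : ∀ x y, A x y → A y x) {x : Fin N} (h : ∀ p, x ∉ S1pmA A r p) (y : Fin N) :
    y ∉ SibmA A r x := by
  rw [sib_iff hs]; rintro ⟨p, h1, _⟩; exact h p h1

lemma gram_a_expand (x z : Fin N) : ∑ y, aM A r y z * aM A r y x =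
    (1 : Matrix (Fin N) (Fin N) ℝ) z x - eM A r x z - eM A r z x +
      ∑ y, eM A r y z * eM A r y x := by
  classical
  simp_rw [aM_apply, sub_mul, mul_sub, Finset.sum_sub_distrib]
  simp [Matrix.one_apply, eq_comm]
  ring

lemma gram_a_diag (hs : ∀ x y, A x y → A y x) (x : Fin N) :
    ∑ y, aM A r y x * aM A r y x = 1 + 1 / (SibmA A r x).ncard := by
  classical
  rw [gram_a_expand, e_zero x x (self_not_sib hs)]
  have : ∀ y, eM A r y x * eM A r y x = indVec (SibmA A r x) y *
      (1 / (SibmA A r x).ncard * (1 / (SibmA A r x).ncard)) := by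
    intro y
    rw [eM_apply]
    have := indVec_mul_self (SibmA A r x) y
    rw [div_mul_div_comm, this]; ring
  simp_rw [this]
  rw [← Finset.sum_mul, sum_indVec]
  by_cases h : ((SibmA A r x).ncard : ℝ) = 0
  · simp [h]
  · simp; field_simp

/-- orthogonality for siblings -/
lemma gram_a_lt (hs : ∀ x y, A x y → A y x) {x z p : Fin N} (hx : x ∈ S1pmA A r p)
    (hz : z ∈ S1pmA A r p) (hzx : precA A z x) (hn : (SibmA A r z).Nonempty) :
    ∑ y, aM A r y z * aM A r y x = 0 := by
  classical
  rw [gram_a_expand]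
  have hne : z ≠ x := by rintro rfl; exact prec_irrefl _ hzx
  have h1 : x ∉ SibmA A r z := by
    rw [sib_iff' hs hz]; rintro ⟨_, h⟩; exact prec_irrefl _ (prec_trans h hzx)
  have h2 : z ∈ SibmA A r x := by rw [sib_iff' hs hx]; exact ⟨hz, hzx⟩
  rw [e_zero _ _ h1, e_val _ _ h2, Matrix.one_apply_ne hne]
  have : ∀ y, eM A r y z * eM A r y x = eM A r y z * (1 / (SibmA A r x).ncard) := by
    intro y
    by_cases hy : y ∈ SibmA A r z
    · have : y ∈ SibmA A r x := by
        rw [sib_iff' hs hx]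
        rw [sib_iff' hs hz] at hy
        exact ⟨hy.1, prec_trans hy.2 hzx⟩
      rw [e_val x y this]
    · rw [e_zero z y hy]; simp
  simp_rw [this]
  rw [← Finset.sum_mul, sum_e z hn]; ring

lemma gram_a_diff (hs : ∀ x y, A x y → A y x) {x z : Fin N} (hne : z ≠ x)
    (h : ∀ p, x ∈ S1pmA A r p → z ∉ S1pmA A r p) :
    ∑ y, aM A r y z * aM A r y x = 0 := by
  rw [gram_a_expand]
  have h1 : x ∉ SibmA A r z := by
    rw [sib_iff hs]; rintro ⟨p, h1, h2, _⟩; exact h p h2 h1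
  have h2 : z ∉ SibmA A r x := by
    rw [sib_iff hs]; rintro ⟨p, h1, h2, _⟩; exact h p h1 h2
  rw [e_zero _ _ h1, e_zero _ _ h2, Matrix.one_apply_ne hne]
  have : ∀ y, eM A r y z * eM A r y x = 0 := by
    intro y
    by_cases hy : y ∈ SibmA A r z
    · have : y ∉ SibmA A r x := by
        intro hy2
        rw [sib_iff hs] at hy hy2
        obtain ⟨p, h1, h2, _⟩ := hy
        obtain ⟨q, h1', h2', _⟩ := hy2
        rw [parent_unique hs h2 h2'] at h1
        exact h q h1' h1
      rw [e_zero x y this]; simp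
    · rw [e_zero z y hy]; simp
  simp [this]

lemma gram_a_nice (hs : ∀ x y, A x y → A y x) {x z : Fin N} (hne : z ≠ x) (hx : Nice A r x)
    (hz : Nice A r z) : ∑ y, aM A r y z * aM A r y x = 0 := by
  by_cases h : ∀ p, x ∈ S1pmA A r p → z ∉ S1pmA A r p
  · exact gram_a_diff hs hne h
  · push Not at h
    obtain ⟨p, hp, hzp⟩ := h
    have hx' : (SibmA A r x).Nonempty := hx.resolve_left (fun h => h p hp)
    have hz' : (SibmA A r z).Nonempty := hz.resolve_left (fun h => h p hzp)
    rcases prec_total (A := A) hne with h | h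
    · exact gram_a_lt hs hp hzp h hz'
    · simp_rw [mul_comm (aM A r _ z)]
      exact gram_a_lt hs hzp hp h hx'

lemma gram_ba (hs : ∀ x y, A x y → A y x) {x z : Fin N} (hx : Nice A r x) :
    ∑ y, bM A r y z * aM A r y x = 0 := by
  classical
  simp_rw [aM_apply, mul_sub, Finset.sum_sub_distrib]
  simp only [Matrix.one_apply, mul_ite, mul_one, mul_zero, Finset.sum_ite_eq', Finset.mem_univ, if_true]
  rw [sub_eq_zero]
  by_cases h : x ∈ S1pmA A r z
  · have hx' : (SibmA A r x).Nonempty := hx.resolve_left (fun hh => hh z h)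
    have : ∀ y, bM A r y z * eM A r y x = bM A r x z * eM A r y x := by
      intro y
      by_cases hy : y ∈ SibmA A r x
      · have h2 := ((sib_iff' hs h).1 hy).1
        rw [bM_apply, bM_apply, indVec_eq, indVec_eq]
        simp [h, h2]
      · rw [e_zero x y hy]; simp
    simp_rw [this]
    rw [← Finset.mul_sum, sum_e x hx', mul_one]
  · rw [bM_apply, indVec_eq]
    simp only [h, if_false, mul_zero]
    symm
    apply Finset.sum_eq_zero
    intro y _
    by_cases hy : y ∈ SibmA A r x
    · have : y ∉ S1pmA A r z := by
        intro hyz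
        obtain ⟨p, h1, h2, _⟩ := (sib_iff hs).1 hy
        rw [parent_unique hs h2 hyz] at h1
        exact h h1
      rw [bM_apply, indVec_eq]; simp [this]
    · rw [e_zero x y hy]; simp

lemma opNorm_a (hs : ∀ x y, A x y → A y x) : opNorm (aM A r) ≤ 3 := by
  classical
  have split : aM A r = aM A r * diagonal (fun x => if Nice A r x then 1 else 0) +
      diagonal (fun x => if Nice A r x then 0 else 1) := by
    ext y x
    rw [Matrix.add_apply, mul_diagonal, Matrix.diagonal_apply]
    by_cases h : Nice A r x
    · simp only [h, if_true, mul_one]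
      by_cases hyx : y = x
      · subst hyx; simp [h]
      · simp [hyx]
    · simp only [h, if_false, mul_zero, zero_add]
      have : y ∉ SibmA A r x := fun hh => h (Or.inr ⟨y, hh⟩)
      rw [aM_apply, e_zero _ _ this, Matrix.one_apply, sub_zero]
      by_cases hyx : y = x
      · subst hyx; simp [h]
      · simp [hyx]
  have h1 : opNorm (aM A r * diagonal (fun x => if Nice A r x then 1 else 0)) ≤ 2 := by
    have := opNorm_of_gram (B := aM A r * diagonal (fun x => if Nice A r x then 1 else 0)) (c := 4)
      (by norm_num) (fun x => if Nice A r x then 1 + 1 / (SibmA A r x).ncard else 0) (by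
        intro x
        split_ifs
        · by_cases h0 : (SibmA A r x).ncard = 0
          · simp [h0]
          · have : (1 : ℝ) ≤ (SibmA A r x).ncard := by exact_mod_cast Nat.one_le_iff_ne_zero.2 h0
            have : (1 : ℝ) / (SibmA A r x).ncard ≤ 1 := by
              rw [div_le_one (by linarith)]; exact this
            linarith
        · norm_num) (by
        intro x x'
        simp only [mul_diagonal]
        by_cases hx : Nice A r x
        · by_cases hx' : Nice A r x'
          · simp only [hx, hx', if_true, mul_one]
            split_ifs with h
            · subst h; exact gram_a_diag hs x
            · exact gram_a_nice hs h hx' hx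
          · simp only [hx', if_false, mul_zero, Finset.sum_const_zero]
            split_ifs with h
            · subst h; exact absurd hx hx'
            · rfl
        · simp [hx])
    rwa [show (4 : ℝ) = 2 ^ 2 by norm_num, Real.sqrt_sq (by norm_num)] at this
  have h2 : opNorm (diagonal (fun x => if Nice A r x then (0 : ℝ) else 1)) ≤ 1 :=
    opNorm_diag_le _ zero_le_one (by intro x; split_ifs <;> simp)
  have h3 := opNorm_add (aM A r * diagonal (fun x => if Nice A r x then 1 else 0))
    (diagonal (fun x => if Nice A r x then (0 : ℝ) else 1))
  rw [← split] at h3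
  linarith

lemma th_nonneg (x : Fin N) : 0 ≤ th A r x := by
  unfold th; exact div_nonneg (by norm_num) (Z_pos x).le

lemma th_eq (x : Fin N) : th A r x = 1 / (1 + 1 / (SibmA A r x).ncard) := by
  unfold th ZxA
  rw [show (2 : ℝ) + 2 / (SibmA A r x).ncard = 2 * (1 + 1 / (SibmA A r x).ncard) by ring]
  have : (0 : ℝ) < 1 + 1 / (SibmA A r x).ncard := by positivity
  field_simp

lemma th_le_one (x : Fin N) : th A r x ≤ 1 := by
  rw [th_eq, div_le_one (by positivity)]
  have : (0 : ℝ) ≤ 1 / (SibmA A r x).ncard := by positivity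
  linarith

lemma child_card_le (x : Fin N) : degPmA A r x ≤ degA A x :=
  Set.ncard_le_ncard (fun _ hy => hy.1.1.1) (Set.toFinite _)

open Classical in
theorem det1 (hs : ∀ x y, A x y → A y x) (hi : ∀ x, ¬ A x x) (ν δ R : ℝ) (hR : 1 ≤ R)
    (hbig : ∀ x, R ≤ degA A x → x ∈ VhA A ν δ)
    (hsib : ∀ p, R ≤ degA A p → ∀ x ∈ VhA A ν δ, x ∈ S1pmA A r p →
      (degA A p : ℝ) ≤ 2 * (SibmA A r x).ncard)
    (hsum : ∀ p, R ≤ degA A p →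
      ∑ x, (if x ∈ S1pmA A r p ∧ R ≤ degA A x then (degA A x : ℝ) else 0) ≤ R * degA A p) :
    opNorm (AhatA A r ν δ - adjMatrixPA A r) ≤ 1000 * Real.sqrt R := by
  have hR0 : 0 ≤ R := by linarith
  have hsR : 1 ≤ Real.sqrt R := by rw [Real.one_le_sqrt]; exact hR
  set P := PiPA A r ν δ with hP
  set c : Fin N → ℝ := fun x => Real.sqrt (degPmA A r x) with hc
  have hc0 : ∀ x, 0 ≤ c x := fun x => Real.sqrt_nonneg _
  -- big vertices are nice
  have hpb : ∀ x p, R ≤ degA A x → x ∈ S1pmA A r p → R ≤ degA A p := by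
    intro x p hx hp
    have : (degA A x : ℝ) ≤ degA A p := by exact_mod_cast prec_le hp.2
    linarith
  have hsibpos : ∀ p, R ≤ degA A p → ∀ x ∈ VhA A ν δ, x ∈ S1pmA A r p →
      (SibmA A r x).Nonempty := by
    intro p hp x hx hxp
    have h1 := hsib p hp x hx hxp
    rw [← Set.ncard_pos (Set.toFinite _)]
    have : (0 : ℝ) < (SibmA A r x).ncard := by linarith
    exact_mod_cast this
  have hnice : ∀ x, R ≤ degA A x → Nice A r x := by
    intro x hx
    by_cases h : ∀ p, x ∉ S1pmA A r p
    · exact Or.inl h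
    · push Not at h
      obtain ⟨p, hp⟩ := h
      exact Or.inr (hsibpos p (hpb x p hx hp) x (hbig x hx) hp)
  -- matrices
  set dB : Fin N → ℝ := fun x => if R ≤ degA A x then c x else 0 with hdB
  set dS : Fin N → ℝ := fun x => if R ≤ degA A x then 0 else c x with hdS
  set Q := aM A r * diagonal dB * (bM A r)ᵀ with hQ
  have hPQ : (1 - P) * Q = 0 := by
    have key : (1 - P) * (aM A r * diagonal dB) = 0 := by
      rw [sub_mul, one_mul, sub_eq_zero, hP, PiP_eq]
      rw [add_mul]
      set Th := fun x => if x ∈ VhA A ν δ then th A r x else 0 with hTh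
      have e2 : (bM A r)ᵀ * (aM A r * diagonal dB) = 0 := by
        rw [← Matrix.mul_assoc]
        ext z x
        rw [mul_diagonal, Matrix.mul_apply]
        simp only [transpose_apply]
        by_cases hx : R ≤ degA A x
        · rw [gram_ba hs (hnice x hx)]; simp
        · simp [hdB, hx]
      have e1 : diagonal Th * (aM A r)ᵀ * (aM A r * diagonal dB) = diagonal dB := by
        rw [Matrix.mul_assoc, ← Matrix.mul_assoc (aM A r)ᵀ]
        ext z x
        rw [diagonal_mul, mul_diagonal, Matrix.mul_apply]
        simp only [transpose_apply]
        by_cases hx : R ≤ degA A x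
        · by_cases hzx : z = x
          · subst hzx
            rw [gram_a_diag hs, Matrix.diagonal_apply_eq]
            simp only [hTh, hbig z hx, if_true]
            rw [th_eq]
            have : (0 : ℝ) < 1 + 1 / (SibmA A r z).ncard := by positivity
            field_simp
          · rw [Matrix.diagonal_apply_ne _ hzx]
            by_cases hz : z ∈ VhA A ν δ
            · have : ∑ y, aM A r y z * aM A r y x = 0 := by
                by_cases hpar : ∀ p, x ∈ S1pmA A r p → z ∉ S1pmA A r p
                · exact gram_a_diff hs hzx hpar
                · push Not at hpar
                  obtain ⟨p, hp, hzp⟩ := hpar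
                  exact gram_a_nice hs hzx (hnice x hx)
                    (Or.inr (hsibpos p (hpb x p hx hp) z hz hzp))
              rw [this]; simp
            · simp [hTh, hz]
        · have : dB x = 0 := by simp [hdB, hx]
          rw [this]
          by_cases hzx : z = x
          · subst hzx; simp [this]
          · simp [hzx]
      rw [Matrix.mul_assoc (bM A r * diagonal Th), e2, Matrix.mul_zero, add_zero,
        Matrix.mul_assoc (aM A r) (diagonal Th), Matrix.mul_assoc (aM A r), e1]
    rw [hQ, ← Matrix.mul_assoc, key, Matrix.zero_mul]
  -- error matrix
  set E1 := eM A r * diagonal dB * (bM A r)ᵀ with hE1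
  set E2 := diagonal dS * (bM A r)ᵀ with hE2
  have hcsplit : diagonal c = diagonal dB + diagonal dS := by
    rw [Matrix.diagonal_add]
    congr 1; ext x; simp only [hdB, hdS]; split_ifs <;> simp
  have hMQ : diagonal c * (bM A r)ᵀ = Q + E1 + E2 := by
    rw [hcsplit, Matrix.add_mul, hE2, hQ, hE1, aM]
    simp only [Matrix.sub_mul, Matrix.one_mul, sub_add_cancel]
  set Er := (E1 + E2) + (E1 + E2)ᵀ with hEr
  have hAp : adjMatrixPA A r = Q + Qᵀ + Er := by
    rw [adjP_eq hs hi, hMQ, hEr]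
    simp only [Matrix.transpose_add]
    abel
  have hnb := opNorm_b (r := r) hs
  have hna := opNorm_a (r := r) hs
  have hE2n : opNorm E2 ≤ Real.sqrt R := by
    have h1 : opNorm (diagonal dS) ≤ Real.sqrt R := by
      apply opNorm_diag_le _ (Real.sqrt_nonneg _)
      intro x
      simp only [hdS]
      split_ifs with h
      · simp
      · rw [abs_of_nonneg (hc0 x)]
        apply Real.sqrt_le_sqrt
        have : (degPmA A r x : ℝ) ≤ degA A x := by exact_mod_cast child_card_le x
        linarith
    calc opNorm E2 ≤ opNorm (diagonal dS) * opNorm (bM A r)ᵀ := opNorm_mul _ _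
      _ ≤ Real.sqrt R * 1 := by
        rw [opNorm_transpose]
        exact mul_le_mul h1 hnb (opNorm_nonneg _) (Real.sqrt_nonneg _)
      _ = _ := mul_one _
  have hE1n : opNorm E1 ≤ 2 * Real.sqrt R := by
    have h1 : opNorm (eM A r * diagonal dB) ≤ Real.sqrt (4 * R) := by
      set f : Fin N → ℝ := fun x => if 0 < c x then c x else 1 with hf
      have hfpos : ∀ x, 0 < f x := by
        intro x; simp only [hf]; split_ifs with h
        · exact h
        · exact one_pos
      have hdB0 : ∀ x, 0 ≤ dB x := by
        intro x; simp only [hdB]; split_ifs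
        · exact hc0 x
        · exact le_rfl
      have he0 : ∀ y x, 0 ≤ eM A r y x := fun y x => by
        rw [eM_apply]; exact div_nonneg (indVec_nonneg _ _) (by positivity)
      have hdf : ∀ x, dB x * f x = dB x ^ 2 := by
        intro x
        simp only [hdB, hf]
        split_ifs with h1 h2
        · ring
        · have : c x = 0 := le_antisymm (not_lt.mp h2) (hc0 x)
          rw [this]; simp
        · simp
        · simp
      have hdlf : ∀ x, dB x ≤ f x := by
        intro x
        simp only [hdB, hf]
        split_ifs with h1 h2
        · exact le_rfl
        · exact (not_lt.mp h2).trans zero_le_one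
        · exact hc0 x
        · exact zero_le_one
      refine schur ?_ f hfpos (R := 4 * R) (by linarith) ?_
      swap
      · intro x
        simp only [mul_diagonal, mul_assoc, hdf]
        by_cases hx : R ≤ degA A x
        swap
        · have : dB x = 0 := by simp [hdB, hx]
          simp only [this, zero_mul, mul_zero, Finset.sum_const_zero]
          have := hfpos x; positivity
        by_cases hpar : ∀ p, x ∉ S1pmA A r p
        · have : ∀ y, eM A r y x = 0 := fun y => e_zero x y (noparent_sib hs hpar y)
          simp only [this, zero_mul, Finset.sum_const_zero]
          have := hfpos x; positivity
        push Not at hpar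
        obtain ⟨p, hp⟩ := hpar
        have hpR := hpb x p hx hp
        have hDp : (0 : ℝ) < degA A p := by linarith
        have inner : ∀ y ∈ SibmA A r x, ∑ x', eM A r y x' * dB x' ^ 2 ≤ 2 * R := by
          intro y hy
          have hyp := ((sib_iff' hs hp).1 hy).1
          have : ∀ x', eM A r y x' * dB x' ^ 2 ≤ 2 / degA A p *
              (if x' ∈ S1pmA A r p ∧ R ≤ degA A x' then (degA A x' : ℝ) else 0) := by
            intro x'
            by_cases h1 : x' ∈ S1pmA A r p ∧ R ≤ degA A x'
            · rw [if_pos h1]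
              have h4 : (degPmA A r x' : ℝ) ≤ degA A x' := by exact_mod_cast child_card_le x'
              have h5 : c x' ^ 2 = degPmA A r x' := Real.sq_sqrt (by positivity)
              have h6 : dB x' = c x' := by simp [hdB, h1.2]
              rw [h6, h5]
              apply mul_le_mul _ h4 (by positivity) (by positivity)
              by_cases hys : y ∈ SibmA A r x'
              · rw [e_val _ _ hys]
                have h7 := hsib p hpR x' (hbig x' h1.2) h1.1
                rw [div_le_div_iff₀ (by linarith) hDp]
                linarith
              · rw [e_zero _ _ hys]; positivity
            · rw [if_neg h1, mul_zero]
              by_cases hb : R ≤ degA A x'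
              · have hys : y ∉ SibmA A r x' := by
                  intro hys
                  obtain ⟨q, h8, h9, _⟩ := (sib_iff hs).1 hys
                  rw [parent_unique hs h9 hyp] at h8
                  exact h1 ⟨h8, hb⟩
                rw [e_zero _ _ hys, zero_mul]
              · have : dB x' = 0 := by simp [hdB, hb]
                rw [this]; simp
          refine (Finset.sum_le_sum fun x' _ => this x').trans ?_
          rw [← Finset.mul_sum]
          calc _ ≤ 2 / (degA A p : ℝ) * (R * degA A p) := by
                apply mul_le_mul_of_nonneg_left (hsum p hpR) (by positivity)
            _ = 2 * R := by field_simp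
        have outer : ∀ y, eM A r y x * (dB x * ∑ x', eM A r y x' * dB x' ^ 2) ≤
            eM A r y x * (dB x * (2 * R)) := by
          intro y
          by_cases hy : y ∈ SibmA A r x
          · exact mul_le_mul_of_nonneg_left
              (mul_le_mul_of_nonneg_left (inner y hy) (hdB0 x)) (he0 y x)
          · rw [e_zero _ _ hy]; simp
        refine (Finset.sum_le_sum fun y _ => outer y).trans ?_
        rw [← Finset.sum_mul, sum_e x (hsibpos p hpR x (hbig x hx) hp), one_mul]
        have := hdlf x
        have := hfpos x
        nlinarith
      · intro y x
        rw [mul_diagonal]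
        exact mul_nonneg (he0 y x) (hdB0 x)
    rw [show (4 : ℝ) * R = 2 ^ 2 * R by norm_num, Real.sqrt_mul (by norm_num),
      Real.sqrt_sq (by norm_num)] at h1
    calc opNorm E1 ≤ opNorm (eM A r * diagonal dB) * opNorm (bM A r)ᵀ := opNorm_mul _ _
      _ ≤ (2 * Real.sqrt R) * 1 := by
        rw [opNorm_transpose]
        exact mul_le_mul h1 hnb (opNorm_nonneg _) (by positivity)
      _ = _ := mul_one _
  have hErn : opNorm Er ≤ 6 * Real.sqrt R := by
    have h1 := opNorm_add E1 E2
    have h2 := opNorm_add (E1 + E2) (E1 + E2)ᵀ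
    rw [opNorm_transpose] at h2
    rw [hEr]; linarith
  have hPn : opNorm P ≤ 10 := by
    rw [hP, PiP_eq]
    have hd : opNorm (diagonal (fun x => if x ∈ VhA A ν δ then th A r x else 0)) ≤ 1 := by
      apply opNorm_diag_le _ zero_le_one
      intro x
      split_ifs
      · rw [abs_of_nonneg (th_nonneg x)]; exact th_le_one x
      · simp
    have tri : ∀ (X D : Matrix (Fin N) (Fin N) ℝ) (k : ℝ), opNorm X ≤ k → opNorm D ≤ 1 →
        opNorm (X * D * Xᵀ) ≤ k * k := by
      intro X D k hX hD
      have h0 := opNorm_nonneg X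
      have h0' := opNorm_nonneg D
      have h1 := opNorm_mul X D
      have h2 := opNorm_mul (X * D) Xᵀ
      rw [opNorm_transpose] at h2
      have h3 : opNorm (X * D) ≤ k := by nlinarith
      nlinarith
    have h1 := tri _ _ _ hna hd
    have h2 := tri _ _ _ hnb hd
    refine (opNorm_add _ _).trans ?_
    linarith
  have hPn' : opNorm (1 - P) ≤ 11 := by
    have := opNorm_sub 1 P
    have := opNorm_one_le (N := N)
    linarith
  have hPt : Pᵀ = P := by
    rw [hP, PiP_eq]
    simp only [Matrix.transpose_add, Matrix.transpose_mul, Matrix.transpose_transpose,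
      Matrix.diagonal_transpose, Matrix.mul_assoc]
  have hcomp : (1 - P) * adjMatrixPA A r * (1 - P) = (1 - P) * Er * (1 - P) := by
    have h1 : Qᵀ * (1 - P) = 0 := by
      have := congrArg Matrix.transpose hPQ
      rwa [Matrix.transpose_mul, Matrix.transpose_sub, hPt, Matrix.transpose_one,
        Matrix.transpose_zero] at this
    rw [hAp, Matrix.mul_add, Matrix.mul_add, hPQ, zero_add, Matrix.add_mul,
      Matrix.mul_assoc (1 - P) Qᵀ, h1, Matrix.mul_zero, zero_add]
  -- the J part
  set dK : Fin N → ℝ := fun x => (if x ∈ VhA A ν δ then th A r x * c x else 0) - dB x with hdK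
  set X := aM A r * diagonal dK * (bM A r)ᵀ with hX
  have hJ : AhatA A r ν δ = X + Q + (X + Q)ᵀ + (1 - P) * Er * (1 - P) := by
    unfold AhatA
    rw [J_eq, ← hP, hcomp]
    have : aM A r * diagonal (fun x => if x ∈ VhA A ν δ then th A r x * Real.sqrt (degPmA A r x)
        else 0) * (bM A r)ᵀ = X + Q := by
      rw [hX, hQ, ← Matrix.add_mul, ← Matrix.mul_add, Matrix.diagonal_add]
      congr 3; ext x; simp [hdK, hc]
    rw [this]
  have hXn : opNorm X ≤ 3 * Real.sqrt R := by
    have h1 : opNorm (diagonal dK) ≤ Real.sqrt R := by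
      apply opNorm_diag_le _ (Real.sqrt_nonneg _)
      intro x
      have hth := th_le_one (A := A) (r := r) x
      have hth0 := th_nonneg (A := A) (r := r) x
      by_cases hx : R ≤ degA A x
      · have e : dK x = - ((1 - th A r x) * c x) := by
          simp only [hdK, hdB, hbig x hx, hx, if_true]; ring
        rw [e, abs_neg, abs_of_nonneg (mul_nonneg (by linarith) (hc0 x))]
        refine le_trans ?_ hsR
        by_cases hpar : ∀ p, x ∉ S1pmA A r p
        · have : (SibmA A r x) = ∅ := Set.eq_empty_of_forall_notMem (noparent_sib hs hpar)
          rw [th_eq, this]; simp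
        · push Not at hpar
          obtain ⟨p, hp⟩ := hpar
          have h2 := hsib p (hpb x p hx hp) x (hbig x hx) hp
          have h3 : (degA A x : ℝ) ≤ degA A p := by exact_mod_cast prec_le hp.2
          have h4 : (degPmA A r x : ℝ) ≤ degA A x := by exact_mod_cast child_card_le x
          have h5 : c x ^ 2 = degPmA A r x := Real.sq_sqrt (by positivity)
          set s : ℝ := ((SibmA A r x).ncard : ℝ)
          have hs0 : 0 < s := by linarith
          have : 1 - th A r x = 1 / (s + 1) := by
            rw [th_eq]
            change 1 - 1 / (1 + 1 / s) = 1 / (s + 1)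
            field_simp
            ring
          rw [this, one_div_mul_eq_div, div_le_one (by linarith)]
          nlinarith [hc0 x]
      · have e : |dK x| ≤ c x := by
          simp only [hdK, hdB, hx, if_false, sub_zero]
          split_ifs
          · rw [abs_of_nonneg (mul_nonneg hth0 (hc0 x))]
            nlinarith [hc0 x]
          · simp [hc0 x]
        refine e.trans (Real.sqrt_le_sqrt ?_)
        have : (degPmA A r x : ℝ) ≤ degA A x := by exact_mod_cast child_card_le x
        linarith
    have h2 := opNorm_mul (aM A r) (diagonal dK)
    have h3 := opNorm_mul (aM A r * diagonal dK) (bM A r)ᵀ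
    rw [opNorm_transpose] at h3
    have h4 : opNorm (aM A r * diagonal dK) ≤ 3 * Real.sqrt R :=
      h2.trans (mul_le_mul hna h1 (opNorm_nonneg _) (by norm_num))
    refine h3.trans ((mul_le_mul h4 hnb (opNorm_nonneg _) (by positivity)).trans ?_)
    linarith
  have hfin : AhatA A r ν δ - adjMatrixPA A r = (X + Xᵀ) - Er + (1 - P) * Er * (1 - P) := by
    rw [hJ, hAp, Matrix.transpose_add]; abel
  rw [hfin]
  have g1 := opNorm_add ((X + Xᵀ) - Er) ((1 - P) * Er * (1 - P))
  have g2 := opNorm_sub (X + Xᵀ) Er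
  have g3 := opNorm_add X Xᵀ
  rw [opNorm_transpose] at g3
  have g4 := opNorm_mul ((1 - P) * Er) (1 - P)
  have g5 := opNorm_mul (1 - P) Er
  have g6 : opNorm ((1 - P) * Er) ≤ 11 * (6 * Real.sqrt R) :=
    g5.trans (mul_le_mul hPn' hErn (opNorm_nonneg _) (by norm_num))
  have g7 : opNorm ((1 - P) * Er * (1 - P)) ≤ 11 * (6 * Real.sqrt R) * 11 :=
    g4.trans (mul_le_mul g6 hPn' (opNorm_nonneg _) (by positivity))
  linarith

end det1
end GRGProof
end

section
open MeasureTheory Real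

namespace GRGProof
open GRG Matrix

variable {N : ℕ}

section det2
open Classical

/-- real indicator of a proposition -/
noncomputable def iv (p : Prop) : ℝ := if p then 1 else 0

lemma iv_pos {p : Prop} (h : p) : iv p = 1 := by simp [iv, h]
lemma iv_neg {p : Prop} (h : ¬ p) : iv p = 0 := by simp [iv, h]
lemma iv_nonneg (p : Prop) : 0 ≤ iv p := by unfold iv; split_ifs <;> simp
lemma iv_le_one (p : Prop) : iv p ≤ 1 := by unfold iv; split_ifs <;> simp
lemma iv_mono {p q : Prop} (h : p → q) : iv p ≤ iv q := by
  by_cases hp : p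
  · rw [iv_pos hp, iv_pos (h hp)]
  · rw [iv_neg hp]; exact iv_nonneg _
lemma iv_mul_mono {p q : Prop} {a b : ℝ} (h : p → q) (hab : p → a ≤ b) (hb : 0 ≤ b) :
    iv p * a ≤ iv q * b := by
  by_cases hp : p
  · simp [iv_pos hp, iv_pos (h hp), hab hp]
  · simp only [iv_neg hp, zero_mul]; exact mul_nonneg (iv_nonneg _) hb
lemma iv_congr {p q : Prop} (h : p ↔ q) : iv p = iv q := by simp [iv, h]
lemma iv_and (p q : Prop) : iv (p ∧ q) = iv p * iv q := by
  by_cases hp : p <;> by_cases hq : q <;> simp [iv, hp, hq]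
lemma sum_iv_ncard (S : Set (Fin N)) : ∑ y, iv (y ∈ S) = (S.ncard : ℝ) := by
  rw [← sum_indVec]
  refine Finset.sum_congr rfl fun y _ => ?_
  rw [indVec_eq]; rfl

/-- weight order -/
def up (w : Fin N → ℝ) (y x : Fin N) : Prop := w y < w x ∨ (w y = w x ∧ y < x)

lemma up_total (w : Fin N → ℝ) {x y : Fin N} (h : x ≠ y) : up w x y ∨ up w y x := by
  unfold up
  rcases lt_trichotomy (w x) (w y) with h1 | h1 | h1
  · left; left; exact h1
  · rcases lt_or_gt_of_ne h with h2 | h2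
    · left; right; exact ⟨h1, h2⟩
    · right; right; exact ⟨h1.symm, h2⟩
  · right; left; exact h1

lemma up_asymm {w : Fin N → ℝ} {x y : Fin N} (h : up w x y) : ¬ up w y x := by
  unfold up at *
  rcases h with h | h <;> rintro (h' | h')
  · linarith
  · linarith [h'.1]
  · linarith [h.1]
  · exact absurd h.2 (not_lt.mpr h'.2.le)

lemma up_le {w : Fin N → ℝ} {x y : Fin N} (h : up w x y) : w x ≤ w y := by
  rcases h with h | h
  · exact h.le
  · exact h.1.le

lemma up_ne {w : Fin N → ℝ} {x y : Fin N} (h : up w x y) : x ≠ y := by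
  rintro rfl
  exact up_asymm h h

/-- `y →_κ x`. -/
def kar (A : Fin N → Fin N → Prop) (w : Fin N → ℝ) (κ : ℝ) (y x : Fin N) : Prop :=
  A y x ∧ up w y x ∧ ∃ z, z ≠ x ∧ A y z ∧ up w y z ∧ κ * w x ≤ w z

noncomputable def outN (A : Fin N → Fin N → Prop) (w : Fin N → ℝ) (y : Fin N) : ℝ :=
  ∑ x, iv (A y x ∧ up w y x)

noncomputable def inN (A : Fin N → Fin N → Prop) (w : Fin N → ℝ) (κ : ℝ) (x : Fin N) : ℝ :=
  ∑ y, iv (kar A w κ y x)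

/-- indicator matrix -/
noncomputable def chi (Q : Fin N → Fin N → Prop) : Matrix (Fin N) (Fin N) ℝ :=
  fun x y => iv (Q x y)

lemma chi_nonneg (Q : Fin N → Fin N → Prop) (x y : Fin N) : 0 ≤ chi Q x y := by
  exact iv_nonneg _

lemma chi_add (Q P P' : Fin N → Fin N → Prop) (h : ∀ x y, Q x y ↔ (P x y ∨ P' x y))
    (h' : ∀ x y, P x y → ¬ P' x y) : chi Q = chi P + chi P' := by
  ext x y
  simp only [chi, Matrix.add_apply, iv]
  have h1 := h x y
  have h2 := h' x y
  by_cases a : P x y <;> by_cases b : P' x y <;> simp_all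

lemma chi_row {Q : Fin N → Fin N → Prop} {R : ℝ} (hR : 0 ≤ R) (g : Fin N → ℝ)
    (hg : ∀ y, (∃ x, Q x y) → ∑ x, chi Q x y ≤ g y)
    (h : ∀ x, ∑ y, iv (Q x y) * g y ≤ R) : opNorm (chi Q) ≤ Real.sqrt R := by
  apply schur_row (chi_nonneg Q) hR
  intro x
  refine le_trans (Finset.sum_le_sum fun y _ => ?_) (h x)
  by_cases hq : Q x y
  · exact mul_le_mul_of_nonneg_left (hg y ⟨x, hq⟩) (iv_nonneg _)
  · simp [chi, iv_neg hq]

lemma chi_tr (Q : Fin N → Fin N → Prop) : (chi Q)ᵀ = chi (fun x y => Q y x) := by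
  ext x y; rfl

lemma chi_col {Q : Fin N → Fin N → Prop} {R : ℝ} (hR : 0 ≤ R) (g : Fin N → ℝ)
    (hg : ∀ x, (∃ y, Q x y) → ∑ y, chi Q x y ≤ g x)
    (h : ∀ y, ∑ x, iv (Q x y) * g x ≤ R) : opNorm (chi Q) ≤ Real.sqrt R := by
  rw [← opNorm_transpose, chi_tr]
  exact chi_row hR g hg h

variable {A : Fin N → Fin N → Prop} {r : ℕ}

lemma outN_nonneg (w : Fin N → ℝ) (y : Fin N) : 0 ≤ outN A w y :=
  Finset.sum_nonneg fun x _ => iv_nonneg _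
lemma inN_nonneg (w : Fin N → ℝ) (κ : ℝ) (y : Fin N) : 0 ≤ inN A w κ y :=
  Finset.sum_nonneg fun x _ => iv_nonneg _

theorem det2 (hs : ∀ x y, A x y → A y x) (hi : ∀ x, ¬ A x x) (w : Fin N → ℝ)
    (hw : ∀ x, 0 < w x) (κ R α β : ℝ) (hκ : κ ≤ 1) (hR : 0 ≤ R) (hα : 0 ≤ α)
    (hrem : ∀ x, ∑ y, iv (A x y ∧ ¬ AdjPA A r x y) ≤ R)
    (hab : α * β ≤ R)
    (h8 : ∀ x, ∑ y, iv (kar A w κ y x ∧ α < outN A w y) * outN A w y ≤ R)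
    (h9 : ∀ y, outN A w y ≤ α →
      ∑ x, iv (A y x ∧ up w y x ∧ β < inN A w κ x) * inN A w κ x ≤ R) :
    opNorm (chi A - adjMatrixPA A r) ≤ 8 * Real.sqrt R := by
  set RM : Fin N → Fin N → Prop := fun x y => A x y ∧ ¬ AdjPA A r x y with hRM
  have hRMs : ∀ x y, RM x y → RM y x := fun x y h =>
    ⟨hs _ _ h.1, fun h' => h.2 (adjP_symm hs h')⟩
  have e0 : chi A - adjMatrixPA A r = chi RM := by
    have : chi A = chi RM + adjMatrixPA A r := by
      have e : adjMatrixPA A r = chi (AdjPA A r) := by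
        ext x y; simp only [adjMatrixPA, chi, iv]
      rw [e]
      apply chi_add
      · intro x y
        simp only [hRM]
        have : AdjPA A r x y → A x y := fun h => h.1.1
        tauto
      · intro x y h; exact h.2
    rw [this, add_sub_cancel_right]
  set UP : Fin N → Fin N → Prop := fun x y => RM x y ∧ up w y x with hUP
  have e1 : chi RM = chi UP + (chi UP)ᵀ := by
    rw [chi_tr]
    apply chi_add
    · intro x y
      constructor
      · intro h
        have hne : x ≠ y := by rintro rfl; exact hi _ h.1
        rcases up_total w hne with h1 | h1
        · right; exact ⟨hRMs _ _ h, h1⟩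
        · left; exact ⟨h, h1⟩
      · rintro (h | h)
        · exact h.1
        · exact hRMs _ _ h.1
    · intro x y h h'; exact up_asymm h.2 h'.2
  set F : Fin N → Fin N → Prop := fun x y => UP x y ∧ ¬ kar A w κ y x with hF
  set H : Fin N → Fin N → Prop := fun x y => UP x y ∧ kar A w κ y x with hH
  have e2 : chi UP = chi F + chi H := by
    apply chi_add
    · intro x y; simp only [hF, hH]; tauto
    · intro x y h h'; exact h.2 h'.2
  set B2 : Fin N → Fin N → Prop := fun x y => H x y ∧ α < outN A w y with hB2
  set H' : Fin N → Fin N → Prop := fun x y => H x y ∧ ¬ α < outN A w y with hH'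
  have e3 : chi H = chi B2 + chi H' := by
    apply chi_add
    · intro x y; simp only [hB2, hH']; tauto
    · intro x y h h'; exact h'.2 h.2
  set B3 : Fin N → Fin N → Prop := fun x y => H' x y ∧ β < inN A w κ x with hB3
  set B1 : Fin N → Fin N → Prop := fun x y => H' x y ∧ ¬ β < inN A w κ x with hB1
  have e4 : chi H' = chi B3 + chi B1 := by
    apply chi_add
    · intro x y; simp only [hB3, hB1]; tauto
    · intro x y h h'; exact h'.2 h.2
  have nF : opNorm (chi F) ≤ Real.sqrt R := by
    apply chi_row hR (fun _ => 1)
    · rintro y ⟨x, hx⟩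
      rw [Finset.sum_eq_single x]
      · exact iv_le_one _
      · intro x' _ hne
        have : ¬ F x' y := by
          rintro hx'
          have k1 : w x' < κ * w x := by
            by_contra hcon
            exact hx.2 ⟨hs _ _ hx.1.1.1, hx.1.2, x', hne, hs _ _ hx'.1.1.1, hx'.1.2, not_lt.mp hcon⟩
          have k2 : w x < κ * w x' := by
            by_contra hcon
            exact hx'.2 ⟨hs _ _ hx'.1.1.1, hx'.1.2, x, hne.symm, hs _ _ hx.1.1.1, hx.1.2, not_lt.mp hcon⟩
          nlinarith [hw x, hw x']
        simp [chi, iv_neg this]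
      · simp
    · intro x
      refine le_trans (Finset.sum_le_sum fun y _ => ?_) (hrem x)
      rw [mul_one]; exact iv_mono fun h => h.1.1
  have colout : ∀ (Q : Fin N → Fin N → Prop), (∀ x y, Q x y → H x y) → ∀ y,
      ∑ x, chi Q x y ≤ outN A w y := by
    intro Q hQ y
    refine Finset.sum_le_sum fun x _ => ?_
    exact iv_mono (fun h => ⟨hs _ _ (hQ _ _ h).1.1.1, (hQ _ _ h).1.2⟩)
  have rowin : ∀ (Q : Fin N → Fin N → Prop), (∀ x y, Q x y → H x y) → ∀ x,
      ∑ y, chi Q x y ≤ inN A w κ x := by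
    intro Q hQ y
    refine Finset.sum_le_sum fun x _ => ?_
    exact iv_mono (fun h => (hQ _ _ h).2)
  have nB2 : opNorm (chi B2) ≤ Real.sqrt R := by
    apply chi_row hR (outN A w)
    · rintro y -
      exact colout _ (fun x y h => h.1) y
    · intro x
      refine le_trans (Finset.sum_le_sum fun y _ => ?_) (h8 x)
      exact iv_mul_mono (fun h => ⟨h.1.2, h.2⟩) (fun _ => le_rfl) (outN_nonneg _ _)
  have nB3 : opNorm (chi B3) ≤ Real.sqrt R := by
    apply chi_col hR (inN A w κ)
    · rintro y -
      exact rowin _ (fun x y h => h.1.1) y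
    · intro y
      by_cases hy : outN A w y ≤ α
      · refine le_trans (Finset.sum_le_sum fun x _ => ?_) (h9 y hy)
        exact iv_mul_mono (fun h => ⟨h.1.1.2.1, h.1.1.2.2.1, h.2⟩) (fun _ => le_rfl) (inN_nonneg _ _ _)
      · refine le_trans (Finset.sum_le_sum (g := fun _ => 0) fun x _ => ?_) (by simpa using hR)
        rw [iv_neg, zero_mul]
        intro h; exact hy (not_lt.mp h.1.2)
  have nB1 : opNorm (chi B1) ≤ Real.sqrt R := by
    apply chi_row hR (fun _ => α)
    · rintro y ⟨x, hx⟩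
      exact (colout _ (fun x y h => h.1.1) y).trans (not_lt.mp hx.1.2)
    · intro x
      by_cases hx : ∃ y, B1 x y
      · obtain ⟨y, hy⟩ := hx
        have h1 : inN A w κ x ≤ β := not_lt.mp hy.2
        have h2 : ∑ y, iv (B1 x y) * α = α * ∑ y, chi B1 x y := by
          rw [Finset.mul_sum]
          refine Finset.sum_congr rfl fun y _ => ?_
          simp [chi, mul_comm]
        rw [h2]
        refine le_trans (mul_le_mul_of_nonneg_left ?_ hα) hab
        exact (rowin _ (fun x y h => h.1.1) x).trans h1
      · push Not at hx
        simp [iv, hx, hR]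
  have nU : opNorm (chi UP) ≤ 4 * Real.sqrt R := by
    rw [e2, e3, e4]
    have := opNorm_add (chi F) (chi B2 + (chi B3 + chi B1))
    have := opNorm_add (chi B2) (chi B3 + chi B1)
    have := opNorm_add (chi B3) (chi B1)
    linarith
  rw [e0, e1]
  have := opNorm_add (chi UP) (chi UP)ᵀ
  rw [opNorm_transpose] at this
  linarith

end det2
end GRGProof
end

section
open MeasureTheory Real

namespace GRGProof
open GRG Matrix

variable {N : ℕ}

section det3
variable {A : Fin N → Fin N → Prop} {r : ℕ}

lemma cyc_symm (hs : ∀ x y, A x y → A y x) {x y : Fin N} (h : y ∈ S1cycA A r x) :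
    x ∈ S1cycA A r y := by
  obtain ⟨hA, l, γ, h3, hl, h0, h1, hll, hp, hsim⟩ := h
  refine ⟨hs _ _ hA, l, fun i => if i = 0 then γ 1 else γ (l + 1 - i), h3, hl, ?_, ?_, ?_, ?_, ?_⟩
  · simp [h1]
  · simp [hll]
  · have : l ≠ 0 := by omega
    simp [this, h1]
  · intro i hi
    by_cases h : i = 0
    · subst h
      simp only [if_true, zero_add, one_ne_zero, if_false]
      rw [show l + 1 - 1 = l by omega, hll, h1]
      exact hs _ _ hA
    · simp only [h, if_false, Nat.add_eq_zero_iff, one_ne_zero, and_false]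
      rw [show l + 1 - i = (l - i) + 1 by omega, show l + 1 - (i + 1) = l - i by omega]
      exact hs _ _ (hp (l - i) (by omega))
  · intro i j hij hj hne
    have hj0 : j ≠ 0 := by omega
    by_cases h : i = 0
    · subst h
      simp only [if_true, hj0, if_false]
      have : j ≠ l := fun h => hne ⟨rfl, h⟩
      by_cases h2 : l + 1 - j = l
      · rw [h2, hll, ← h0]
        exact (hsim 0 1 (by omega) (by omega) (by omega)).symm
      · exact hsim 1 _ (by omega) (by omega) (by omega)
    · simp only [h, hj0, if_false]
      exact (hsim _ _ (by omega) (by omega) (by omega)).symm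

/-- weighted count of heavy neighbours -/
noncomputable def TT (A : Fin N → Fin N → Prop) (w : Fin N → ℝ) (κ : ℝ) (p : Fin N) : ℝ :=
  ∑ y, iv (A p y) * min 1 (w y / (κ * w p))

lemma deg_sum (x : Fin N) : (degA A x : ℝ) = ∑ y, iv (A x y) := by
  unfold degA
  rw [← sum_iv_ncard]; rfl

theorem det3 (hs : ∀ x y, A x y → A y x) (hi : ∀ x, ¬ A x x) (w : Fin N → ℝ)
    (hw : ∀ x, 0 < w x) (ν δ h K0 L1 W K R α β : ℝ) (hh : 8 ≤ h) (hK : 1 ≤ K)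
    (hRK : 14 * K ≤ R) (hRK0 : K0 ≤ R) (hRxi : xi ν δ N ≤ R) (hL : 8 * R + L1 ≤ h * R)
    (hα : 0 ≤ α) (hab : α * β ≤ R)
    (H1 : ∀ z, w z ≤ 8 * degA A z + L1)
    (H2 : ∀ z, (degA A z : ℝ) ≤ max K0 (h * w z))
    (H3 : ∀ z, xi ν δ N ≤ degA A z → W ≤ w z)
    (H4 : ∀ p, TT A w ((h ^ 2)⁻¹) p ≤ K)
    (H5 : ∀ p, ∑ y, iv (A p y ∧ W ≤ w y) ≤ max K (w p / h ^ 2))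
    (H6 : ∀ x, inN A w ((h ^ 2)⁻¹) x ≤ K)
    (H7 : ∀ x, ((S1cycA A r x).ncard : ℝ) ≤ K)
    (H8 : ∀ x, ∑ y, iv (kar A w ((h ^ 2)⁻¹) y x ∧ α < outN A w y) * outN A w y ≤ K)
    (H9 : ∀ y, outN A w y ≤ α →
      ∑ x, iv (A y x ∧ up w y x ∧ β < inN A w ((h ^ 2)⁻¹) x) * inN A w ((h ^ 2)⁻¹) x ≤ K) :
    opNorm (AhatA A r ν δ - adjMatrixPA A r) ≤ 2008 * Real.sqrt R ∧
    opNorm (AhatA A r ν δ - chi A) ≤ 2008 * Real.sqrt R := by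
  set κ : ℝ := (h ^ 2)⁻¹ with hκ
  have hh0 : 0 < h := by linarith
  have hκ0 : 0 < κ := by positivity
  have hκ1 : κ ≤ 1 := by
    rw [hκ]; apply inv_le_one_of_one_le₀; nlinarith
  have hκh : κ * h ^ 2 = 1 := by rw [hκ]; field_simp
  -- weight / degree comparison
  have lo : ∀ z, R < degA A z → (degA A z : ℝ) ≤ h * w z := by
    intro z hz
    rcases le_max_iff.1 (H2 z) with h1 | h1
    · linarith
    · exact h1
  have hi' : ∀ z, R ≤ degA A z → w z ≤ h * degA A z := by
    intro z hz
    have := H1 z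
    nlinarith
  have cmp : ∀ x z, R < degA A x → (degA A x ≤ degA A z) → κ * w x ≤ w z := by
    intro x z hx hxz
    have hxz' : (degA A x : ℝ) ≤ degA A z := by exact_mod_cast hxz
    have h1 := lo z (by linarith)
    have h2 := hi' x hx.le
    have h3 : w x ≤ h ^ 2 * w z := by nlinarith
    calc κ * w x ≤ κ * (h ^ 2 * w z) := mul_le_mul_of_nonneg_left h3 hκ0.le
      _ = w z := by rw [← mul_assoc, hκh, one_mul]
  have tt1 : ∀ x y, κ * w x ≤ w y → min 1 (w y / (κ * w x)) = 1 := by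
    intro x y hxy
    apply min_eq_left
    rw [one_le_div (mul_pos hκ0 (hw x))]; exact hxy
  have tt0 : ∀ x y, 0 ≤ min 1 (w y / (κ * w x)) := fun x y =>
    le_min zero_le_one (div_nonneg (hw y).le (mul_pos hκ0 (hw x)).le)
  -- removed edges
  have rem : ∀ x, R < degA A x → ∑ y, iv (A x y ∧ ¬ AdjPA A r x y) ≤ 3 * K := by
    intro x hx
    have : ∀ y, iv (A x y ∧ ¬ AdjPA A r x y) ≤ iv (y ∈ S1cycA A r x) +
        iv (A x y) * min 1 (w y / (κ * w x)) + iv (kar A w κ y x) := by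
      intro y
      have p1 := iv_nonneg (y ∈ S1cycA A r x)
      have p2 := mul_nonneg (iv_nonneg (A x y)) (tt0 x y)
      have p3 := iv_nonneg (kar A w κ y x)
      by_cases hr : A x y ∧ ¬ AdjPA A r x y
      swap
      · rw [iv_neg hr]; linarith
      rw [iv_pos hr]
      by_cases hc : y ∈ S1cycA A r x
      · rw [iv_pos hc]; linarith
      by_cases hk : κ * w x ≤ w y
      · rw [tt1 _ _ hk, iv_pos hr.1]; linarith
      have hc' : x ∉ S1cycA A r y := fun h => hc (cyc_symm hs h)
      have : kar A w κ y x := by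
        have hdu : y ∈ S1duA A r x ∨ x ∈ S1duA A r y := by
          by_contra hcon
          push Not at hcon
          exact hr.2 ⟨⟨hr.1, hc, hc'⟩, hcon.1, hcon.2⟩
        rcases hdu with hd | hd
        · obtain ⟨_, _, hyx, z, hyz, _, hxz⟩ := hd
          have hz := cmp x z hx (prec_le hxz)
          have hwx := hw x
          push Not at hk
          refine ⟨hs _ _ hr.1, Or.inl (by nlinarith), z, ?_, hyz, Or.inl (by linarith), hz⟩
          rintro rfl
          exact prec_irrefl _ hxz
        · obtain ⟨_, _, hyx, _⟩ := hd
          exact absurd (cmp x y hx (prec_le hyx)) hk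
      rw [iv_pos this]; linarith
    refine (Finset.sum_le_sum fun y _ => this y).trans ?_
    rw [Finset.sum_add_distrib, Finset.sum_add_distrib, sum_iv_ncard]
    have a1 := H7 x
    have a2 := H4 x
    have a3 := H6 x
    unfold TT at a2
    unfold inN at a3
    linarith
  have sibs : ∀ p, R < degA A p → ∀ x ∈ VhA A ν δ, x ∈ S1pmA A r p →
      (degA A p : ℝ) ≤ 2 * (SibmA A r x).ncard := by
    intro p hp x hx hxp
    have : ∀ y, iv (A p y) ≤ iv (y ∈ SibmA A r x) + iv (A p y ∧ ¬ AdjPA A r p y) +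
        iv (A p y) * min 1 (w y / (κ * w p)) + iv (A p y ∧ W ≤ w y) := by
      intro y
      have p1 := iv_nonneg (y ∈ SibmA A r x)
      have p2 := mul_nonneg (iv_nonneg (A p y)) (tt0 p y)
      have p3 := iv_nonneg (A p y ∧ ¬ AdjPA A r p y)
      have p4 := iv_nonneg (A p y ∧ W ≤ w y)
      by_cases hA : A p y
      swap
      · rw [iv_neg hA] at *; linarith
      by_cases hP : AdjPA A r p y
      swap
      · rw [iv_pos (And.intro hA hP), iv_pos hA] at *; linarith
      have hne : y ≠ p := by rintro rfl; exact hi _ hA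
      rcases prec_total (A := A) hne with hlt | hgt
      · by_cases hyx : precA A y x
        · have : y ∈ SibmA A r x := (sib_iff' hs hxp).2 ⟨⟨hP, hlt⟩, hyx⟩
          rw [iv_pos this, iv_pos hA] at *; linarith
        · have hd : degA A x ≤ degA A y := by
            by_cases hxy : x = y
            · rw [hxy]
            · rcases prec_total (A := A) hxy with h1 | h1
              · exact prec_le h1
              · exact absurd h1 hyx
          have hd' : (degA A x : ℝ) ≤ degA A y := by exact_mod_cast hd
          have hx' : xi ν δ N ≤ degA A x := hx
          have := H3 y (by linarith)
          rw [iv_pos (And.intro hA this), iv_pos hA] at *; linarith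
      · rw [tt1 _ _ (cmp p y hp (prec_le hgt)), iv_pos hA] at *; linarith
    have hsum := Finset.sum_le_sum fun y (_ : y ∈ Finset.univ) => this y
    rw [← deg_sum, Finset.sum_add_distrib, Finset.sum_add_distrib, Finset.sum_add_distrib,
      sum_iv_ncard] at hsum
    have a1 := rem p hp
    have a2 := H4 p
    unfold TT at a2
    have a3 := H5 p
    have a4 : w p / h ^ 2 ≤ degA A p / 8 := by
      rw [div_le_div_iff₀ (by positivity) (by norm_num)]
      have := hi' p hp.le
      have hd : (0 : ℝ) ≤ degA A p := by positivity
      nlinarith [mul_nonneg (mul_nonneg hd hh0.le) (sub_nonneg.2 hh)]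
    have a5 : max K (w p / h ^ 2) ≤ K + degA A p / 8 := by
      apply max_le
      · have : (0 : ℝ) ≤ degA A p := by positivity
        linarith
      · linarith
    linarith
  have hsums : ∀ p, R < degA A p → ∀ S : Finset (Fin N), (∀ x ∈ S, x ∈ S1pmA A r p ∧ R < degA A x) →
      ∑ x ∈ S, (degA A x : ℝ) ≤ R * degA A p := by
    intro p hp S hS
    have hDp : (0 : ℝ) ≤ degA A p := by positivity
    have : ∀ x ∈ S, (degA A x : ℝ) ≤ degA A p * (iv (A p x) * min 1 (w x / (κ * w p))) := by
      intro x hx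
      obtain ⟨hxp, hxR⟩ := hS x hx
      rw [iv_pos hxp.1.1.1, one_mul]
      rw [mul_min_of_nonneg _ _ hDp]
      apply le_min
      · rw [mul_one]; exact_mod_cast prec_le hxp.2
      · have h1 := lo x hxR
        have h2 := hi' p hp.le
        rw [mul_div_assoc', le_div_iff₀ (mul_pos hκ0 (hw p))]
        have h3 : κ * (w p) * degA A x ≤ κ * (h * degA A p) * (h * w x) := by
          apply mul_le_mul _ h1 (by positivity) (by positivity)
          exact mul_le_mul_of_nonneg_left h2 hκ0.le
        calc _ = κ * (w p) * degA A x := by ring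
          _ ≤ _ := h3
          _ = κ * h ^ 2 * (degA A p * w x) := by ring
          _ = _ := by rw [hκh, one_mul]
    refine (Finset.sum_le_sum this).trans ?_
    rw [← Finset.mul_sum]
    have : ∑ x ∈ S, iv (A p x) * min 1 (w x / (κ * w p)) ≤ TT A w κ p :=
      Finset.sum_le_univ_sum_of_nonneg (fun x => mul_nonneg (iv_nonneg _) (tt0 _ _))
    have h4 := H4 p
    nlinarith
  have hR0 : 0 ≤ R := by linarith
  -- apply with R + 1 so as to have strict inequalities
  have D1 := det1 (r := r) hs hi ν δ (R + 1) (by linarith)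
    (fun x hx => by change xi ν δ N ≤ _; linarith)
    (fun p hp x hx hxp => sibs p (by linarith) x hx hxp)
    (fun p hp => by
      classical
      rw [← Finset.sum_filter]
      refine (hsums p (by linarith) _ ?_).trans ?_
      · intro x hx
        rw [Finset.mem_filter] at hx
        exact ⟨hx.2.1, by linarith [hx.2.2]⟩
      · exact mul_le_mul_of_nonneg_right (by linarith) (by positivity))
  have D2 := det2 (r := r) hs hi w hw κ R α β hκ1 hR0 hα
    (fun x => by
      by_cases hx : R < degA A x
      · linarith [rem x hx]
      · refine le_trans ?_ (not_lt.mp hx)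
        rw [deg_sum]
        exact Finset.sum_le_sum fun y _ => iv_mono fun h => h.1) hab
    (fun x => (H8 x).trans (by linarith)) (fun y hy => (H9 y hy).trans (by linarith))
  have hsq : Real.sqrt (R + 1) ≤ 2 * Real.sqrt R := by
    rw [show (2 : ℝ) * Real.sqrt R = Real.sqrt (2 ^ 2 * R) by
      rw [Real.sqrt_mul (by norm_num), Real.sqrt_sq (by norm_num)]]
    apply Real.sqrt_le_sqrt; linarith
  have hs0 := Real.sqrt_nonneg R
  have D3 := opNorm_sub (AhatA A r ν δ - adjMatrixPA A r) (chi A - adjMatrixPA A r)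
  rw [sub_sub_sub_cancel_right] at D3
  constructor <;> linarith

end det3
end GRGProof
end

section
open MeasureTheory Real

namespace GRGProof
open GRG Matrix

variable {N : ℕ}

section prob
open ProbabilityTheory

lemma pGRG_pos {w : Fin N → ℝ} (hw : ∀ x, 0 < w x) (x y : Fin N) : 0 < pGRG w x y := by
  have := Finset.sum_nonneg (fun z (_ : z ∈ Finset.univ) => (hw z).le)
  have := mul_pos (hw x) (hw y)
  unfold pGRG; positivity

lemma pGRG_le_one {w : Fin N → ℝ} (hw : ∀ x, 0 < w x) (x y : Fin N) : pGRG w x y ≤ 1 := by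
  have := Finset.sum_nonneg (fun z (_ : z ∈ Finset.univ) => (hw z).le)
  have := mul_pos (hw x) (hw y)
  unfold pGRG
  rw [div_le_one (by linarith)]; linarith

lemma pGRG_symm (w : Fin N → ℝ) (x y : Fin N) : pGRG w x y = pGRG w y x := by
  unfold pGRG; rw [mul_comm (w x)]

lemma bern_prob {p : ℝ} (h0 : 0 ≤ p) (h1 : p ≤ 1) : IsProbabilityMeasure (bern p) := by
  constructor
  simp only [bern, Measure.coe_add, Measure.coe_smul, Pi.add_apply, Pi.smul_apply,
    smul_eq_mul, measure_univ, mul_one]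
  rw [← ENNReal.ofReal_add h0 (by linarith)]
  simp

variable {w : Fin N → ℝ}

lemma bern_prob' (hw : ∀ x, 0 < w x) (e : EdgeIdx N) :
    IsProbabilityMeasure (bern (pGRG w e.val.1 e.val.2)) :=
  bern_prob (pGRG_pos hw _ _).le (pGRG_le_one hw _ _)

lemma grg_prob (hw : ∀ x, 0 < w x) : IsProbabilityMeasure (grgMeasure w) := by
  have := bern_prob' hw
  unfold grgMeasure; infer_instance

instance : IsFiniteMeasure (grgMeasure w) := by
  unfold grgMeasure; infer_instance

/-- Expectation -/
noncomputable def Ex (w : Fin N → ℝ) (f : (EdgeIdx N → Bool) → ℝ) : ℝ := ∫ ω, f ω ∂(grgMeasure w)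

lemma intg (f : (EdgeIdx N → Bool) → ℝ) : Integrable f (grgMeasure w) := Integrable.of_finite

lemma Ex_mono {f g : (EdgeIdx N → Bool) → ℝ} (h : ∀ ω, f ω ≤ g ω) : Ex w f ≤ Ex w g :=
  integral_mono (intg _) (intg _) h

lemma Ex_nonneg {f : (EdgeIdx N → Bool) → ℝ} (h : ∀ ω, 0 ≤ f ω) : 0 ≤ Ex w f :=
  integral_nonneg h

lemma Ex_const (hw : ∀ x, 0 < w x) (c : ℝ) : Ex w (fun _ => c) = c := by
  have := grg_prob hw
  simp [Ex]

lemma Ex_add (f g : (EdgeIdx N → Bool) → ℝ) : Ex w (fun ω => f ω + g ω) = Ex w f + Ex w g :=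
  integral_add (intg _) (intg _)

lemma Ex_mul_const (c : ℝ) (f : (EdgeIdx N → Bool) → ℝ) : Ex w (fun ω => c * f ω) = c * Ex w f :=
  integral_const_mul _ _

lemma Ex_sum {ι : Type*} (s : Finset ι) (f : ι → (EdgeIdx N → Bool) → ℝ) :
    Ex w (fun ω => ∑ i ∈ s, f i ω) = ∑ i ∈ s, Ex w (f i) :=
  integral_finsetSum _ (fun _ _ => intg _)

lemma markov {S : Set (EdgeIdx N → Bool)} {F : (EdgeIdx N → Bool) → ℝ} (h0 : ∀ ω, 0 ≤ F ω)
    (h : ∀ ω ∈ S, 1 ≤ F ω) : (grgMeasure w).real S ≤ Ex w F := by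
  have h1 : (grgMeasure w).real S = Ex w (S.indicator 1) := by
    unfold Ex
    rw [integral_indicator_one (Set.toFinite S).measurableSet]
  rw [h1]
  apply Ex_mono
  intro ω
  by_cases hω : ω ∈ S
  · simpa [hω] using h ω hω
  · simpa [hω] using h0 ω

/-- `f` only depends on the coordinates in `S`. -/
def DepOn (S : EdgeIdx N → Prop) (f : (EdgeIdx N → Bool) → ℝ) : Prop :=
  ∀ ω ω', (∀ e, S e → ω e = ω' e) → f ω = f ω'

lemma indep2 (hw : ∀ x, 0 < w x) {S T : EdgeIdx N → Prop} (hST : ∀ e, S e → ¬ T e)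
    {f g : (EdgeIdx N → Bool) → ℝ} (hf : DepOn S f) (hg : DepOn T g) :
    Ex w (fun ω => f ω * g ω) = Ex w f * Ex w g := by
  classical
  have := bern_prob' hw
  have ind : iIndepFun (fun (e : EdgeIdx N) (ω : EdgeIdx N → Bool) => ω e) (grgMeasure w) :=
    iIndepFun_pi (X := fun (_ : EdgeIdx N) (b : Bool) => b) (fun _ => aemeasurable_id)
  have key := ind.indepFun_finset (Finset.univ.filter S) (Finset.univ.filter T)
    (by
      rw [Finset.disjoint_left]
      intro e he he'
      simp at he he'
      exact hST e he he') (fun e => measurable_pi_apply e)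
  have rest : ∀ (S : EdgeIdx N → Prop) (f : (EdgeIdx N → Bool) → ℝ), DepOn S f →
      ∃ φ : ((i : (Finset.univ.filter S : Finset (EdgeIdx N))) → Bool) → ℝ,
        ∀ ω, f ω = φ (fun i => ω i) := by
    intro S f hf
    refine ⟨fun u => f (fun e => if h : e ∈ (Finset.univ.filter S) then u ⟨e, h⟩ else false), ?_⟩
    intro ω
    apply hf
    intro e he
    simp [he]
  obtain ⟨φ, hφ⟩ := rest S f hf
  obtain ⟨ψ, hψ⟩ := rest T g hg
  have key2 := key.comp (φ := φ) (ψ := ψ) (measurable_of_finite _) (measurable_of_finite _)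
  have e1 : f = φ ∘ (fun a (i : (Finset.univ.filter S : Finset (EdgeIdx N))) => a i) := by
    ext ω; exact hφ ω
  have e2 : g = ψ ∘ (fun a (i : (Finset.univ.filter T : Finset (EdgeIdx N))) => a i) := by
    ext ω; exact hψ ω
  rw [← e1, ← e2] at key2
  exact key2.integral_fun_mul_eq_mul_integral (measurable_of_finite _).aestronglyMeasurable
    (measurable_of_finite _).aestronglyMeasurable

lemma indep_prod (hw : ∀ x, 0 < w x) {ι : Type*} [DecidableEq ι] (L : EdgeIdx N → ι)
    (f : ι → (EdgeIdx N → Bool) → ℝ) (hf : ∀ i, DepOn (fun e => L e = i) (f i)) (s : Finset ι) :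
    Ex w (fun ω => ∏ i ∈ s, f i ω) = ∏ i ∈ s, Ex w (f i) := by
  induction s using Finset.induction_on with
  | empty => simp [Ex_const hw]
  | insert i s hi ih =>
    simp only [Finset.prod_insert hi]
    rw [← ih]
    refine indep2 hw (S := fun e => L e = i) (T := fun e => L e ∈ s) ?_ (hf i) ?_
    · intro e he he'; rw [he] at he'; exact hi he'
    · intro ω ω' h
      refine Finset.prod_congr rfl fun j hj => ?_
      exact hf j ω ω' (fun e he => h e (by change L e ∈ s; rw [show L e = j from he]; exact hj))

/-- the edge -/
def edge (x y : Fin N) (h : x ≠ y) : EdgeIdx N :=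
  if h' : x < y then ⟨(x, y), h'⟩ else ⟨(y, x), lt_of_le_of_ne (not_lt.mp h') h.symm⟩

lemma adj_iff (ω : EdgeIdx N → Bool) {x y : Fin N} (h : x ≠ y) :
    Adj ω x y ↔ ω (edge x y h) = true := by
  unfold Adj adjMatrix edge
  by_cases h1 : x < y
  · simp [h1]
  · have h2 : y < x := lt_of_le_of_ne (not_lt.mp h1) h.symm
    simp [h1, h2]

lemma adj_irr (ω : EdgeIdx N → Bool) (x : Fin N) : ¬ Adj ω x x := by
  unfold Adj adjMatrix; simp

lemma edge_symm {x y : Fin N} (h : x ≠ y) : edge x y h = edge y x h.symm := by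
  unfold edge
  rcases lt_or_gt_of_ne h with h1 | h1
  · have h2 : ¬ y < x := not_lt.mpr h1.le
    simp [h1, h2]
  · have h2 : ¬ x < y := not_lt.mpr h1.le
    simp [h1, h2]

lemma adj_symm (ω : EdgeIdx N → Bool) (x y : Fin N) (h : Adj ω x y) : Adj ω y x := by
  have hne : x ≠ y := by rintro rfl; exact adj_irr ω _ h
  rw [adj_iff ω hne.symm, ← edge_symm hne, ← adj_iff ω hne]; exact h

lemma edge_inj {x y x' y' : Fin N} {h : x ≠ y} {h' : x' ≠ y'} (he : edge x y h = edge x' y' h') :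
    (x = x' ∧ y = y') ∨ (x = y' ∧ y = x') := by
  unfold edge at he
  split_ifs at he <;> simp at he <;> tauto

lemma adjMatrix_eq_chi (ω : EdgeIdx N → Bool) : adjMatrix ω = chi (Adj ω) := by
  ext x y
  unfold chi iv Adj
  split_ifs with h
  · exact h
  · unfold adjMatrix at h ⊢
    split_ifs at h ⊢ <;> simp_all

lemma Ex_edge (hw : ∀ x, 0 < w x) (e : EdgeIdx N) :
    Ex w (fun ω => iv (ω e = true)) = pGRG w e.val.1 e.val.2 := by
  have := bern_prob' hw
  have h1 := integral_fintype_prod_eq_prod (𝕜 := ℝ) (μ := fun e : EdgeIdx N => bern (pGRG w e.val.1 e.val.2))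
    (fun e' b => if e' = e then iv (b = true) else 1)
  have h2 : ∀ ω : EdgeIdx N → Bool, (∏ e', if e' = e then iv (ω e' = true) else 1) = iv (ω e = true) := by
    intro ω; simp
  simp only [h2] at h1
  unfold Ex grgMeasure
  rw [h1, Finset.prod_eq_single e]
  · simp only [if_true]
    unfold bern
    have f1 : IsFiniteMeasure (ENNReal.ofReal (pGRG w e.val.1 e.val.2) • (Measure.dirac true : Measure Bool)) :=
      Measure.smul_finite _ ENNReal.ofReal_ne_top
    have f2 : IsFiniteMeasure (ENNReal.ofReal (1 - pGRG w e.val.1 e.val.2) • (Measure.dirac false : Measure Bool)) :=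
      Measure.smul_finite _ ENNReal.ofReal_ne_top
    rw [integral_add_measure (Integrable.of_finite) (Integrable.of_finite), integral_smul_measure,
      integral_smul_measure]
    simp [iv, ENNReal.toReal_ofReal (pGRG_pos hw _ _).le]
  · intro e' _ hne
    simp only [hne, if_false, integral_const, probReal_univ, smul_eq_mul, mul_one]
  · simp

lemma Ex_adj (hw : ∀ x, 0 < w x) {x y : Fin N} (h : x ≠ y) :
    Ex w (fun ω => iv (Adj ω x y)) = pGRG w x y := by
  have : (fun ω : EdgeIdx N → Bool => iv (Adj ω x y)) = fun ω => iv (ω (edge x y h) = true) := by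
    ext ω; exact iv_congr (adj_iff ω h)
  rw [this, Ex_edge hw]
  unfold edge
  split_ifs
  · rfl
  · exact pGRG_symm _ _ _

/-- the star at `x` : independent edges -/
lemma indep_star (hw : ∀ x, 0 < w x) (x : Fin N) (g : Fin N → Prop → ℝ) (s : Finset (Fin N)) :
    Ex w (fun ω => ∏ y ∈ s, g y (Adj ω x y)) = ∏ y ∈ s, Ex w (fun ω => g y (Adj ω x y)) := by
  refine indep_prod hw (fun e => if e.val.1 = x then e.val.2 else if e.val.2 = x then e.val.1 else x)
    (fun y ω => g y (Adj ω x y)) ?_ s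
  intro y ω ω' h
  by_cases hxy : x = y
  · subst hxy
    have h1 := adj_irr ω x
    have h2 := adj_irr ω' x
    simp only [h1, h2]
  · have h1 := h (edge x y hxy) (by
      unfold edge
      split_ifs with h2 <;> simp_all)
    have : Adj ω x y ↔ Adj ω' x y := by rw [adj_iff ω hxy, adj_iff ω' hxy, h1]
    simp only [this]

/-- lower end of an edge -/
lemma indep_low (hw : ∀ x, 0 < w x) (f : Fin N → (EdgeIdx N → Bool) → ℝ)
    (hf : ∀ y ω ω', (∀ x, up w y x → (Adj ω y x ↔ Adj ω' y x)) → f y ω = f y ω')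
    (s : Finset (Fin N)) :
    Ex w (fun ω => ∏ y ∈ s, f y ω) = ∏ y ∈ s, Ex w (f y) := by
  classical
  refine indep_prod hw (fun e => if up w e.val.1 e.val.2 then e.val.1 else e.val.2) f ?_ s
  intro y ω ω' h
  apply hf
  intro x hx
  have hne := up_ne hx
  rw [adj_iff ω hne, adj_iff ω' hne]
  rw [h]
  unfold edge
  have := up_asymm hx
  split_ifs <;> simp_all

lemma Ex_affine (hw : ∀ x, 0 < w x) {x y : Fin N} (h : x ≠ y) (g : Prop → ℝ) :
    Ex w (fun ω => g (Adj ω x y)) = g False + (g True - g False) * pGRG w x y := by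
  have : (fun ω : EdgeIdx N → Bool => g (Adj ω x y)) =
      fun ω => g False + (g True - g False) * iv (Adj ω x y) := by
    ext ω
    by_cases ha : Adj ω x y
    · simp only [ha, iv_pos trivial]; ring
    · simp only [ha, iv_neg not_false]; ring
  rw [this, Ex_add, Ex_const hw, Ex_mul_const, Ex_adj hw h]

/-- Chernoff bound for the star -/
lemma star_mgf (hw : ∀ x, 0 < w x) (x : Fin N) (c : Fin N → ℝ) (hc0 : ∀ y, 0 ≤ c y)
    (hc1 : ∀ y, c y ≤ 1) (lam : ℝ) :
    Ex w (fun ω => Real.exp (lam * ∑ y, iv (Adj ω x y) * c y)) ≤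
      Real.exp ((Real.exp lam - 1) * ∑ y, (if x = y then 0 else pGRG w x y * c y)) := by
  have h1 : ∀ ω : EdgeIdx N → Bool, Real.exp (lam * ∑ y, iv (Adj ω x y) * c y) =
      ∏ y, Real.exp (lam * (iv (Adj ω x y) * c y)) := by
    intro ω; rw [Finset.mul_sum, Real.exp_sum]
  simp only [h1]
  rw [indep_star hw x (fun y p => Real.exp (lam * (iv p * c y))), Finset.mul_sum, Real.exp_sum]
  apply Finset.prod_le_prod
  · intro y _; exact Ex_nonneg fun ω => (Real.exp_pos _).le
  intro y _
  by_cases hxy : x = y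
  · subst hxy
    have : ∀ ω : EdgeIdx N → Bool, iv (Adj ω x x) = 0 := fun ω => iv_neg (adj_irr ω x)
    simp [this, Ex_const hw]
  · rw [Ex_affine hw hxy (fun p => Real.exp (lam * (iv p * c y)))]
    simp only [iv_neg not_false, iv_pos trivial, if_neg hxy]
    simp only [zero_mul, mul_zero, Real.exp_zero, one_mul]
    have hconv : Real.exp (lam * c y) - 1 ≤ (Real.exp lam - 1) * c y := by
      have := convexOn_exp.2 (Set.mem_univ 0) (Set.mem_univ lam) (sub_nonneg.2 (hc1 y)) (hc0 y) (by ring)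
      simp only [smul_eq_mul, mul_zero, zero_add, Real.exp_zero, mul_one] at this
      rw [mul_comm lam]; linarith
    have := Real.add_one_le_exp ((Real.exp lam - 1) * (pGRG w x y * c y))
    have hp := pGRG_pos hw x y
    nlinarith

end prob
end GRGProof
end

section
open MeasureTheory Real

namespace GRGProof
open GRG Matrix

variable {N : ℕ}

section events
variable {w : Fin N → ℝ}

lemma S_pos (hw : ∀ x, 0 < w x) (x : Fin N) : 0 < ∑ z, w z :=
  Finset.sum_pos (fun z _ => hw z) ⟨x, Finset.mem_univ _⟩

lemma pGRG_le (hw : ∀ x, 0 < w x) (x y : Fin N) : pGRG w x y ≤ w x * w y / ∑ z, w z := by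
  have := S_pos hw x
  have := mul_pos (hw x) (hw y)
  unfold pGRG
  apply div_le_div_of_nonneg_left (by positivity) (by positivity) (by linarith)

lemma star_tail (hw : ∀ x, 0 < w x) (x : Fin N) (c : Fin N → ℝ) (hc0 : ∀ y, 0 ≤ c y)
    (hc1 : ∀ y, c y ≤ 1) (lam : ℝ) (hlam : 0 ≤ lam) (t m : ℝ)
    (hm : ∑ y, w x * w y / (∑ z, w z) * c y ≤ m) :
    (grgMeasure w).real {ω | t ≤ ∑ y, iv (Adj ω x y) * c y} ≤
      Real.exp (Real.exp lam * m - lam * t) := by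
  have hS := S_pos hw x
  have h1 : (grgMeasure w).real {ω | t ≤ ∑ y, iv (Adj ω x y) * c y} ≤
      Ex w (fun ω => Real.exp (-(lam * t)) * Real.exp (lam * ∑ y, iv (Adj ω x y) * c y)) := by
    apply markov
    · intro ω; positivity
    · intro ω hω
      rw [← Real.exp_add]
      apply Real.one_le_exp
      have : t ≤ ∑ y, iv (Adj ω x y) * c y := hω
      nlinarith
  refine h1.trans ?_
  rw [Ex_mul_const]
  refine (mul_le_mul_of_nonneg_left (star_mgf hw x c hc0 hc1 lam) (Real.exp_pos _).le).trans ?_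
  rw [← Real.exp_add]
  apply Real.exp_le_exp.2
  have h2 : ∑ y, (if x = y then 0 else pGRG w x y * c y) ≤ m := by
    refine le_trans (Finset.sum_le_sum fun y _ => ?_) hm
    split_ifs
    · have := hc0 y; have := hw x; have := hw y; positivity
    · exact mul_le_mul_of_nonneg_right (pGRG_le hw x y) (hc0 y)
  have h3 : 0 ≤ ∑ y, (if x = y then 0 else pGRG w x y * c y) := by
    apply Finset.sum_nonneg
    intro y _
    split_ifs
    · exact le_rfl
    · exact mul_nonneg (pGRG_pos hw x y).le (hc0 y)
  have h4 : 0 ≤ Real.exp lam - 1 := by linarith [Real.one_le_exp hlam]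
  have := Real.exp_pos lam
  nlinarith

/-- P1 -/
lemma ev1 (hw : ∀ x, 0 < w x) (z : Fin N) (t : ℝ) (h1 : ∀ x y, w x * w y ≤ ∑ u, w u)
    (h2 : ∀ x, 2 * w x ≤ ∑ u, w u) :
    (grgMeasure w).real {ω | 8 * (degA (Adj ω) z : ℝ) + 8 * t ≤ w z} ≤ Real.exp (-t) := by
  have hS := S_pos hw z
  have hb : (grgMeasure w).real {ω | 8 * (degA (Adj ω) z : ℝ) + 8 * t ≤ w z} ≤
      Ex w (fun ω => Real.exp (w z / 8 - t) * Real.exp (-1 * ∑ y, iv (Adj ω z y) * 1)) := by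
    apply markov
    · intro ω; positivity
    · intro ω hω
      rw [← Real.exp_add]
      apply Real.one_le_exp
      have : 8 * (degA (Adj ω) z : ℝ) + 8 * t ≤ w z := hω
      rw [deg_sum] at this
      simp only [mul_one]
      linarith
  refine hb.trans ?_
  rw [Ex_mul_const]
  refine (mul_le_mul_of_nonneg_left (star_mgf hw z (fun _ => 1) (fun _ => zero_le_one)
    (fun _ => le_rfl) (-1)) (Real.exp_pos _).le).trans ?_
  rw [← Real.exp_add]
  apply Real.exp_le_exp.2
  have h3 : Real.exp (-1) - 1 ≤ -(1 / 2) := by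
    have := Real.exp_neg_one_lt_half
    linarith
  have h4 : w z / 4 ≤ ∑ y, (if z = y then 0 else pGRG w z y * 1) := by
    have h5 : ∀ y, w z * w y / (2 * ∑ u, w u) - (if z = y then w z * w z / (2 * ∑ u, w u) else 0) ≤
        (if z = y then 0 else pGRG w z y * 1) := by
      intro y
      split_ifs with h
      · subst h; simp
      · rw [sub_zero, mul_one]
        unfold pGRG
        have := mul_pos (hw z) (hw y)
        apply div_le_div_of_nonneg_left this.le (by positivity)
        linarith [h1 z y]
    refine le_trans ?_ (Finset.sum_le_sum fun y _ => h5 y)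
    rw [Finset.sum_sub_distrib, Finset.sum_ite_eq, ← Finset.sum_div, ← Finset.mul_sum]
    simp only [Finset.mem_univ, if_true]
    rw [← sub_div, div_le_div_iff₀ (by norm_num) (by positivity)]
    have := h2 z
    have := hw z
    nlinarith
  have := hw z
  nlinarith

/-- P4 -/
lemma ev4 (hw : ∀ x, 0 < w x) (p : Fin N) {κ lam ρ t : ℝ} (hκ : 0 < κ) (hlam : 0 ≤ lam)
    (hρ : ∑ z, w z ^ 2 ≤ ρ * ∑ z, w z) :
    (grgMeasure w).real {ω | t ≤ TT (Adj ω) w κ p} ≤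
      Real.exp (Real.exp lam * (ρ / κ) - lam * t) := by
  have hS := S_pos hw p
  have hwp := hw p
  apply star_tail hw p _ (fun y => le_min zero_le_one (by have := hw y; positivity))
    (fun y => min_le_left _ _) lam hlam
  calc ∑ y, w p * w y / (∑ z, w z) * min 1 (w y / (κ * w p))
      ≤ ∑ y, w y ^ 2 * (1 / (κ * ∑ z, w z)) := by
        refine Finset.sum_le_sum fun y _ => ?_
        have := hw y
        calc _ ≤ w p * w y / (∑ z, w z) * (w y / (κ * w p)) :=
              mul_le_mul_of_nonneg_left (min_le_right _ _) (by positivity)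
          _ = _ := by field_simp
    _ = (∑ y, w y ^ 2) * (1 / (κ * ∑ z, w z)) := by rw [Finset.sum_mul]
    _ ≤ (ρ * ∑ z, w z) * (1 / (κ * ∑ z, w z)) := mul_le_mul_of_nonneg_right hρ (by positivity)
    _ = ρ / κ := by field_simp

/-- P5 -/
lemma ev5 (hw : ∀ x, 0 < w x) (p : Fin N) {W lam ρ t : ℝ} (hW : 0 < W) (hlam : 0 ≤ lam)
    (hρ : ∑ z, w z ^ 2 ≤ ρ * ∑ z, w z) :
    (grgMeasure w).real {ω | t ≤ ∑ y, iv (Adj ω p y ∧ W ≤ w y)} ≤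
      Real.exp (Real.exp lam * (w p * ρ / W) - lam * t) := by
  have hS := S_pos hw p
  have hwp := hw p
  simp only [iv_and]
  apply star_tail hw p (fun y => iv (W ≤ w y)) (fun y => iv_nonneg _) (fun y => iv_le_one _) lam hlam
  calc ∑ y, w p * w y / (∑ z, w z) * iv (W ≤ w y)
      ≤ ∑ y, w y ^ 2 * (w p / (W * ∑ z, w z)) := by
        refine Finset.sum_le_sum fun y _ => ?_
        have := hw y
        by_cases h : W ≤ w y
        · rw [iv_pos h, mul_one, ← mul_div_assoc, div_le_div_iff₀ hS (by positivity)]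
          have : w p * w y * (∑ z, w z) * W ≤ w p * w y * (∑ z, w z) * w y :=
            mul_le_mul_of_nonneg_left h (by positivity)
          nlinarith
        · rw [iv_neg h]; simp only [mul_zero, zero_mul]; positivity
    _ = (∑ y, w y ^ 2) * (w p / (W * ∑ z, w z)) := by rw [Finset.sum_mul]
    _ ≤ (ρ * ∑ z, w z) * (w p / (W * ∑ z, w z)) := mul_le_mul_of_nonneg_right hρ (by positivity)
    _ = w p * ρ / W := by field_simp

/-- P2 and P3 -/
lemma ev2 (hw : ∀ x, 0 < w x) (z : Fin N) {lam t : ℝ} (hlam : 0 ≤ lam) :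
    (grgMeasure w).real {ω | t ≤ (degA (Adj ω) z : ℝ)} ≤
      Real.exp (Real.exp lam * w z - lam * t) := by
  have hS := S_pos hw z
  have : ∀ ω : EdgeIdx N → Bool, (degA (Adj ω) z : ℝ) = ∑ y, iv (Adj ω z y) * 1 := by
    intro ω; simp [deg_sum]
  simp only [this]
  apply star_tail hw z (fun _ => 1) (fun _ => zero_le_one) (fun _ => le_rfl) lam hlam
  simp only [mul_one]
  rw [← Finset.sum_div, ← Finset.mul_sum]
  field_simp
  exact le_rfl

/-- restricted out-degree -/
noncomputable def outU (A : Fin N → Fin N → Prop) (w : Fin N → ℝ) (U : Finset (Fin N)) (y : Fin N) : ℝ :=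
  ∑ x ∈ U, iv (A y x ∧ up w y x)

noncomputable def BU (w : Fin N → ℝ) (U : Finset (Fin N)) (y : Fin N) : ℝ :=
  ∑ x ∈ U, iv (up w y x) * (w y * w x / ∑ z, w z)

lemma BU_univ (hw : ∀ x, 0 < w x) {ρ : ℝ} (hρ : ∑ z, w z ^ 2 ≤ ρ * ∑ z, w z) (y : Fin N) :
    BU w Finset.univ y ≤ ρ := by
  have hS := S_pos hw y
  calc BU w Finset.univ y ≤ ∑ x, w x ^ 2 / ∑ z, w z := by
        refine Finset.sum_le_sum fun x _ => ?_
        have := hw x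
        by_cases h : up w y x
        · rw [iv_pos h, one_mul]
          apply div_le_div_of_nonneg_right _ hS.le
          have := up_le h
          nlinarith
        · rw [iv_neg h]; simp only [mul_zero, zero_mul]; positivity
    _ = (∑ x, w x ^ 2) / ∑ z, w z := by rw [Finset.sum_div]
    _ ≤ ρ := by rw [div_le_iff₀ hS]; exact hρ

lemma pair_bound (hw : ∀ x, 0 < w x) (U : Finset (Fin N)) {x y z : Fin N} (hxz : z ≠ x)
    (hyx : up w y x) (hyz : up w y z) {μ : ℝ} (hμ : 0 ≤ μ) :
    Ex w (fun ω => iv (Adj ω y x) * iv (Adj ω y z) * Real.exp (μ * outU (Adj ω) w U y)) ≤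
      Real.exp (2 * μ + Real.exp μ * BU w U y) * (pGRG w y x * pGRG w y z) := by
  classical
  set g : Fin N → Prop → ℝ := fun x' P => (if x' = x ∨ x' = z then iv P else 1) *
    Real.exp (μ * (iv (x' ∈ U ∧ up w y x') * iv P)) with hg
  have e1 : ∀ ω : EdgeIdx N → Bool, iv (Adj ω y x) * iv (Adj ω y z) * Real.exp (μ * outU (Adj ω) w U y)
      = ∏ x', g x' (Adj ω y x') := by
    intro ω
    rw [Finset.prod_mul_distrib, ← Real.exp_sum]
    congr 1
    · rw [← Finset.prod_filter]
      have : (Finset.univ.filter fun a => a = x ∨ a = z) = {x, z} := by ext; simp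
      rw [this, Finset.prod_pair hxz.symm]
    · rw [outU, ← Finset.mul_sum]
      congr 2
      rw [← Finset.sum_filter_add_sum_filter_not Finset.univ (fun x' => x' ∈ U)]
      simp only [Finset.filter_univ_mem]
      rw [Finset.sum_eq_zero (s := Finset.univ.filter _), add_zero]
      · refine Finset.sum_congr rfl fun x' hx' => ?_
        rw [← iv_and]; apply iv_congr; tauto
      · intro x' hx'
        rw [iv_neg, zero_mul]
        simp at hx'; tauto
  simp only [e1]
  rw [indep_star hw]
  have hexpμ := Real.one_le_exp hμ
  have e2 : ∀ x', Ex w (fun ω => g x' (Adj ω y x')) ≤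
      (if x' = x ∨ x' = z then Real.exp μ * pGRG w y x' else 1) *
      Real.exp (Real.exp μ * (iv (x' ∈ U ∧ up w y x') * (w y * w x' / ∑ u, w u))) := by
    intro x'
    have hS := S_pos hw y
    have hwy := hw y
    have hwx := hw x'
    have hB : 0 ≤ Real.exp μ * (iv (x' ∈ U ∧ up w y x') * (w y * w x' / ∑ u, w u)) :=
      mul_nonneg (by positivity) (mul_nonneg (iv_nonneg _) (by positivity))
    by_cases h1 : x' = x ∨ x' = z
    · have hne : y ≠ x' := by
        rcases h1 with rfl | rfl
        · exact up_ne hyx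
        · exact up_ne hyz
      rw [Ex_affine hw hne]
      simp only [hg, h1, if_true, iv_neg not_false, iv_pos trivial, zero_mul, one_mul, mul_one, zero_add,
        sub_zero]
      have hp := pGRG_pos hw y x'
      have h2 : Real.exp (μ * iv (x' ∈ U ∧ up w y x')) ≤ Real.exp μ := by
        apply Real.exp_le_exp.2
        have := iv_le_one (x' ∈ U ∧ up w y x')
        nlinarith
      have h3 := Real.one_le_exp hB
      calc _ ≤ Real.exp μ * pGRG w y x' * 1 := by nlinarith
        _ ≤ _ := mul_le_mul_of_nonneg_left h3 (by positivity)
    · simp only [h1, if_false, one_mul]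
      by_cases h2 : x' ∈ U ∧ up w y x'
      · have hne : y ≠ x' := up_ne h2.2
        rw [Ex_affine hw hne]
        simp only [hg, h1, if_false, iv_neg not_false, iv_pos trivial, iv_pos h2, mul_zero, one_mul, mul_one,
          Real.exp_zero]
        have := Real.add_one_le_exp (Real.exp μ * (w y * w x' / ∑ u, w u))
        have hp := pGRG_pos hw y x'
        have hp2 := pGRG_le hw y x'
        nlinarith
      · simp only [hg, h1, if_false, iv_neg h2]
        simp [Ex_const hw]
  refine (Finset.prod_le_prod (fun x' _ => Ex_nonneg fun ω => ?_) fun x' _ => e2 x').trans ?_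
  · simp only [hg]
    refine mul_nonneg ?_ (Real.exp_pos _).le
    split_ifs
    · exact iv_nonneg _
    · exact zero_le_one
  rw [Finset.prod_mul_distrib, ← Finset.prod_filter]
  have : (Finset.univ.filter fun a => a = x ∨ a = z) = {x, z} := by ext; simp
  rw [this, Finset.prod_pair hxz.symm, ← Real.exp_sum, ← Finset.mul_sum]
  have e3 : ∑ x', iv (x' ∈ U ∧ up w y x') * (w y * w x' / ∑ u, w u) = BU w U y := by
    rw [BU, ← Finset.sum_filter_add_sum_filter_not Finset.univ (fun x' => x' ∈ U)]
    simp only [Finset.filter_univ_mem]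
    rw [Finset.sum_eq_zero (s := Finset.univ.filter _), add_zero]
    · refine Finset.sum_congr rfl fun x' hx' => ?_
      congr 1; apply iv_congr; exact ⟨fun h => h.2, fun h => ⟨hx', h⟩⟩
    · intro x' hx'
      rw [iv_neg, zero_mul]
      simp at hx'; tauto
  rw [e3, Real.exp_add, two_mul, Real.exp_add]
  apply le_of_eq; ring

lemma outU_nonneg (A : Fin N → Fin N → Prop) (w : Fin N → ℝ) (U : Finset (Fin N)) (y : Fin N) :
    0 ≤ outU A w U y := Finset.sum_nonneg fun _ _ => iv_nonneg _

lemma kar_bound (hw : ∀ x, 0 < w x) (U : Finset (Fin N)) (x y : Fin N) {μ κ ρ : ℝ} (hμ : 0 ≤ μ)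
    (hκ : 0 < κ) (hρ : ∑ z, w z ^ 2 ≤ ρ * ∑ z, w z) :
    Ex w (fun ω => iv (kar (Adj ω) w κ y x) * Real.exp (μ * outU (Adj ω) w U y)) ≤
      Real.exp (2 * μ + Real.exp μ * BU w U y) * (w y ^ 2 / (∑ z, w z) * (ρ / κ)) := by
  have hS := S_pos hw y
  set P : Fin N → Prop := fun z => up w y x ∧ up w y z ∧ z ≠ x ∧ κ * w x ≤ w z with hP
  have h1 : Ex w (fun ω => iv (kar (Adj ω) w κ y x) * Real.exp (μ * outU (Adj ω) w U y)) ≤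
      Ex w (fun ω => ∑ z, iv (P z) * (iv (Adj ω y x) * iv (Adj ω y z) *
        Real.exp (μ * outU (Adj ω) w U y))) := by
    apply Ex_mono
    intro ω
    have hnn : ∀ z, 0 ≤ iv (P z) * (iv (Adj ω y x) * iv (Adj ω y z) *
        Real.exp (μ * outU (Adj ω) w U y)) := fun z =>
      mul_nonneg (iv_nonneg _) (mul_nonneg (mul_nonneg (iv_nonneg _) (iv_nonneg _)) (Real.exp_pos _).le)
    by_cases hk : kar (Adj ω) w κ y x
    · obtain ⟨a, b, z, hz, c, d, e⟩ := id hk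
      refine le_trans ?_ (Finset.single_le_sum (fun z _ => hnn z) (Finset.mem_univ z))
      rw [iv_pos hk, iv_pos a, iv_pos c, iv_pos (show P z from ⟨b, d, hz, e⟩)]
      simp
    · rw [iv_neg hk, zero_mul]
      exact Finset.sum_nonneg fun z _ => hnn z
  refine h1.trans ?_
  rw [Ex_sum]
  simp only [Ex_mul_const]
  calc _ ≤ ∑ z, Real.exp (2 * μ + Real.exp μ * BU w U y) * (w z ^ 2 * (w y ^ 2 / (κ * (∑ u, w u) ^ 2))) := by
        refine Finset.sum_le_sum fun z _ => ?_
        have hwy := hw y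
        have hwx := hw x
        have hwz := hw z
        by_cases hz : P z
        · rw [iv_pos hz, one_mul]
          refine (pair_bound hw U hz.2.2.1 hz.1 hz.2.1 hμ).trans ?_
          apply mul_le_mul_of_nonneg_left _ (Real.exp_pos _).le
          refine (mul_le_mul (pGRG_le hw y x) (pGRG_le hw y z) (pGRG_pos hw _ _).le (by positivity)).trans ?_
          have hk := hz.2.2.2
          calc w y * w x / (∑ u, w u) * (w y * w z / ∑ u, w u)
              = (κ * w x) * (w y ^ 2 * w z / (κ * (∑ u, w u) ^ 2)) := by field_simp
            _ ≤ w z * (w y ^ 2 * w z / (κ * (∑ u, w u) ^ 2)) :=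
                mul_le_mul_of_nonneg_right hk (by positivity)
            _ = _ := by ring
        · rw [iv_neg hz]; simp only [mul_zero, zero_mul]; positivity
    _ = Real.exp (2 * μ + Real.exp μ * BU w U y) * ((∑ z, w z ^ 2) * (w y ^ 2 / (κ * (∑ u, w u) ^ 2))) := by
        rw [← Finset.mul_sum, Finset.sum_mul]
    _ ≤ _ := by
        apply mul_le_mul_of_nonneg_left _ (Real.exp_pos _).le
        refine (mul_le_mul_of_nonneg_right hρ (by have := hw y; positivity)).trans (le_of_eq ?_)
        field_simp

lemma sum_wsq (hw : ∀ x, 0 < w x) (c ρ κ : ℝ) (hρ : ∑ z, w z ^ 2 ≤ ρ * ∑ z, w z) (hc : 0 ≤ c)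
    (hκ : 0 < κ) (hρ0 : 0 ≤ ρ) (s : Finset (Fin N)) :
    ∑ y ∈ s, c * (w y ^ 2 / (∑ z, w z) * (ρ / κ)) ≤ c * (ρ ^ 2 / κ) := by
  rcases s.eq_empty_or_nonempty with rfl | ⟨x, -⟩
  · simp; positivity
  have hS := S_pos hw x
  have : ∑ y ∈ s, c * (w y ^ 2 / (∑ z, w z) * (ρ / κ)) ≤ ∑ y, c * (w y ^ 2 / (∑ z, w z) * (ρ / κ)) :=
    Finset.sum_le_univ_sum_of_nonneg (fun y => by positivity)
  refine this.trans ?_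
  rw [← Finset.mul_sum, ← Finset.sum_mul, ← Finset.sum_div]
  apply mul_le_mul_of_nonneg_left _ hc
  calc (∑ z, w z ^ 2) / (∑ z, w z) * (ρ / κ) ≤ ρ * (ρ / κ) := by
        apply mul_le_mul_of_nonneg_right _ (by positivity)
        rw [div_le_iff₀ hS]; exact hρ
    _ = ρ ^ 2 / κ := by ring

lemma kar_congr {ω ω' : EdgeIdx N → Bool} {y : Fin N} {κ : ℝ}
    (h : ∀ x, up w y x → (Adj ω y x ↔ Adj ω' y x)) (x : Fin N) :
    kar (Adj ω) w κ y x ↔ kar (Adj ω') w κ y x := by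
  unfold kar
  constructor
  · rintro ⟨a, b, z, c, d, e, f⟩
    exact ⟨(h x b).1 a, b, z, c, (h z e).1 d, e, f⟩
  · rintro ⟨a, b, z, c, d, e, f⟩
    exact ⟨(h x b).2 a, b, z, c, (h z e).2 d, e, f⟩

lemma outU_congr {ω ω' : EdgeIdx N → Bool} {y : Fin N}
    (h : ∀ x, up w y x → (Adj ω y x ↔ Adj ω' y x)) (U : Finset (Fin N)) :
    outU (Adj ω) w U y = outU (Adj ω') w U y := by
  unfold outU
  refine Finset.sum_congr rfl fun x _ => iv_congr ?_
  constructor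
  · rintro ⟨a, b⟩; exact ⟨(h x b).1 a, b⟩
  · rintro ⟨a, b⟩; exact ⟨(h x b).2 a, b⟩

/-- P8 -/
lemma ev8 (hw : ∀ x, 0 < w x) (x : Fin N) {κ lam ρ α t : ℝ} (hκ : 0 < κ) (hlam : 0 ≤ lam) (hρ0 : 0 ≤ ρ)
    (hρ : ∑ z, w z ^ 2 ≤ ρ * ∑ z, w z) (hα : Real.exp (2 * lam) * ρ ≤ lam * α) :
    (grgMeasure w).real {ω | t ≤ ∑ y, iv (kar (Adj ω) w κ y x ∧ α < outN (Adj ω) w y) * outN (Adj ω) w y} ≤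
      Real.exp (Real.exp (4 * lam) * (ρ ^ 2 / κ) - lam * t) := by
  have hout : ∀ (ω : EdgeIdx N → Bool) y, outN (Adj ω) w y = outU (Adj ω) w Finset.univ y := fun _ _ => rfl
  set f : Fin N → (EdgeIdx N → Bool) → ℝ := fun y ω =>
    Real.exp (lam * (iv (kar (Adj ω) w κ y x ∧ α < outN (Adj ω) w y) * outN (Adj ω) w y)) with hf
  have h1 : (grgMeasure w).real {ω | t ≤ ∑ y, iv (kar (Adj ω) w κ y x ∧ α < outN (Adj ω) w y) * outN (Adj ω) w y} ≤
      Ex w (fun ω => Real.exp (-(lam * t)) * ∏ y, f y ω) := by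
    apply markov
    · intro ω
      exact mul_nonneg (Real.exp_pos _).le (Finset.prod_nonneg fun y _ => (Real.exp_pos _).le)
    · intro ω hω
      simp only [hf]
      rw [← Real.exp_sum, ← Finset.mul_sum, ← Real.exp_add]
      apply Real.one_le_exp
      have := mul_le_mul_of_nonneg_left (show t ≤ _ from hω) hlam
      linarith
  refine h1.trans ?_
  rw [Ex_mul_const, indep_low hw f]
  · have h2 : ∀ y, Ex w (f y) ≤ Real.exp (Real.exp (4 * lam) * (w y ^ 2 / (∑ z, w z) * (ρ / κ))) := by
      intro y
      have h3 : ∀ ω, f y ω ≤ 1 + Real.exp (-(lam * α)) *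
          (iv (kar (Adj ω) w κ y x) * Real.exp ((2 * lam) * outU (Adj ω) w Finset.univ y)) := by
        intro ω
        have hnn : 0 ≤ Real.exp (-(lam * α)) *
          (iv (kar (Adj ω) w κ y x) * Real.exp ((2 * lam) * outU (Adj ω) w Finset.univ y)) :=
          mul_nonneg (Real.exp_pos _).le (mul_nonneg (iv_nonneg _) (Real.exp_pos _).le)
        by_cases hk : kar (Adj ω) w κ y x ∧ α < outN (Adj ω) w y
        · simp only [hf, iv_pos hk, iv_pos hk.1, one_mul]
          rw [← Real.exp_add, ← hout]
          have : Real.exp (lam * outN (Adj ω) w y) ≤ Real.exp (-(lam * α) + 2 * lam * outN (Adj ω) w y) := by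
            apply Real.exp_le_exp.2
            nlinarith [hk.2]
          linarith
        · simp only [hf, iv_neg hk, zero_mul, mul_zero, Real.exp_zero]
          linarith
      refine (Ex_mono h3).trans ?_
      rw [Ex_add, Ex_const hw, Ex_mul_const]
      have h4 := kar_bound hw Finset.univ x y (μ := 2 * lam) (by linarith) hκ hρ
      have h5 := BU_univ hw hρ y
      have hS := S_pos hw y
      have hwy := hw y
      have h6 : Real.exp (-(lam * α)) * Real.exp (2 * (2 * lam) + Real.exp (2 * lam) * BU w Finset.univ y) ≤
          Real.exp (4 * lam) := by
        rw [← Real.exp_add]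
        apply Real.exp_le_exp.2
        have := Real.exp_pos (2 * lam)
        nlinarith
      have h7 : 0 ≤ w y ^ 2 / (∑ z, w z) * (ρ / κ) := by positivity
      have h8 := mul_le_mul_of_nonneg_left h4 (Real.exp_pos (-(lam * α))).le
      have h9 := mul_le_mul_of_nonneg_right h6 h7
      have h10 := Real.add_one_le_exp (Real.exp (4 * lam) * (w y ^ 2 / (∑ z, w z) * (ρ / κ)))
      linarith [mul_assoc (Real.exp (-(lam * α))) (Real.exp (2 * (2 * lam) + Real.exp (2 * lam) * BU w Finset.univ y)) (w y ^ 2 / (∑ z, w z) * (ρ / κ))]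
    have h3 := Finset.prod_le_prod (s := Finset.univ) (fun y _ => Ex_nonneg (w := w) fun ω =>
      (Real.exp_pos (lam * (iv (kar (Adj ω) w κ y x ∧ α < outN (Adj ω) w y) * outN (Adj ω) w y))).le)
      (fun y _ => h2 y)
    refine (mul_le_mul_of_nonneg_left h3 (Real.exp_pos _).le).trans ?_
    rw [← Real.exp_sum, ← Real.exp_add]
    apply Real.exp_le_exp.2
    have := sum_wsq hw (Real.exp (4 * lam)) ρ κ hρ (Real.exp_pos _).le hκ hρ0 Finset.univ
    linarith
  · intro y ω ω' h
    simp only [hf, hout, outU_congr h, kar_congr h]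

/-- single-vertex bound for P6 and P9 -/
lemma single_bound (hw : ∀ x, 0 < w x) (U : Finset (Fin N)) (y : Fin N) {κ lam ρ q : ℝ} (hκ : 0 < κ)
    (hlam : 0 ≤ lam) (hρ0 : 0 ≤ ρ) (hρ : ∑ z, w z ^ 2 ≤ ρ * ∑ z, w z)
    (hq : ∀ x y, w x * w y / (∑ z, w z) ≤ q) (hU : Real.exp lam * (U.card * q) ≤ 1) :
    Ex w (fun ω => Real.exp (lam * ∑ x ∈ U, iv (kar (Adj ω) w κ y x))) ≤
      Real.exp ((3 * U.card * Real.exp (2 * lam)) * (w y ^ 2 / (∑ z, w z) * (ρ / κ))) := by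
  have h3 : ∀ ω : EdgeIdx N → Bool, Real.exp (lam * ∑ x ∈ U, iv (kar (Adj ω) w κ y x)) ≤
      1 + ∑ x ∈ U, iv (kar (Adj ω) w κ y x) * Real.exp (lam * outU (Adj ω) w U y) := by
    intro ω
    rw [← Finset.sum_mul]
    by_cases hk : ∃ x ∈ U, kar (Adj ω) w κ y x
    · obtain ⟨x, hx, hk⟩ := hk
      have h1 : 1 ≤ ∑ x ∈ U, iv (kar (Adj ω) w κ y x) := by
        rw [← iv_pos hk]
        exact Finset.single_le_sum (f := fun x => iv (kar (Adj ω) w κ y x)) (fun _ _ => iv_nonneg _) hx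
      have h2 : ∑ x ∈ U, iv (kar (Adj ω) w κ y x) ≤ outU (Adj ω) w U y :=
        Finset.sum_le_sum fun x _ => iv_mono fun h => ⟨h.1, h.2.1⟩
      have h4 : Real.exp (lam * ∑ x ∈ U, iv (kar (Adj ω) w κ y x)) ≤ Real.exp (lam * outU (Adj ω) w U y) :=
        Real.exp_le_exp.2 (mul_le_mul_of_nonneg_left h2 hlam)
      have h5 := Real.exp_pos (lam * outU (Adj ω) w U y)
      nlinarith
    · push Not at hk
      have : ∑ x ∈ U, iv (kar (Adj ω) w κ y x) = 0 :=
        Finset.sum_eq_zero fun x hx => iv_neg (hk x hx)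
      rw [this]; simp
  refine (Ex_mono h3).trans ?_
  rw [Ex_add, Ex_const hw, Ex_sum]
  have hS := S_pos hw y
  have hwy := hw y
  have h7 : 0 ≤ w y ^ 2 / (∑ z, w z) * (ρ / κ) := by positivity
  have hB : BU w U y ≤ U.card * q := by
    rw [← nsmul_eq_mul]
    apply Finset.sum_le_card_nsmul
    intro x _
    refine le_trans ?_ (hq y x)
    have : 0 ≤ w y * w x / ∑ z, w z := by have := hw x; positivity
    have := iv_le_one (up w y x)
    nlinarith
  have hexp : Real.exp (2 * lam + Real.exp lam * BU w U y) ≤ 3 * Real.exp (2 * lam) := by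
    rw [Real.exp_add, mul_comm]
    apply mul_le_mul_of_nonneg_right _ (Real.exp_pos _).le
    have h1 : Real.exp lam * BU w U y ≤ 1 :=
      (mul_le_mul_of_nonneg_left hB (Real.exp_pos _).le).trans hU
    have h2 := Real.exp_le_exp.2 h1
    have := Real.exp_one_lt_d9
    linarith
  have h4 : ∑ x ∈ U, Ex w (fun ω => iv (kar (Adj ω) w κ y x) * Real.exp (lam * outU (Adj ω) w U y)) ≤
      U.card * (3 * Real.exp (2 * lam) * (w y ^ 2 / (∑ z, w z) * (ρ / κ))) := by
    rw [← nsmul_eq_mul]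
    apply Finset.sum_le_card_nsmul
    intro x _
    exact (kar_bound hw U x y hlam hκ hρ).trans (mul_le_mul_of_nonneg_right hexp h7)
  have h10 := Real.add_one_le_exp ((3 * U.card * Real.exp (2 * lam)) * (w y ^ 2 / (∑ z, w z) * (ρ / κ)))
  linarith

/-- P6 -/
lemma ev6 (hw : ∀ x, 0 < w x) (x : Fin N) {κ lam ρ q t : ℝ} (hκ : 0 < κ) (hlam : 0 ≤ lam) (hρ0 : 0 ≤ ρ)
    (hρ : ∑ z, w z ^ 2 ≤ ρ * ∑ z, w z)
    (hq : ∀ x y, w x * w y / (∑ z, w z) ≤ q) (hU : Real.exp lam * q ≤ 1) :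
    (grgMeasure w).real {ω | t ≤ inN (Adj ω) w κ x} ≤
      Real.exp (3 * Real.exp (2 * lam) * (ρ ^ 2 / κ) - lam * t) := by
  set f : Fin N → (EdgeIdx N → Bool) → ℝ := fun y ω =>
    Real.exp (lam * ∑ x' ∈ {x}, iv (kar (Adj ω) w κ y x')) with hf
  have h1 : (grgMeasure w).real {ω | t ≤ inN (Adj ω) w κ x} ≤
      Ex w (fun ω => Real.exp (-(lam * t)) * ∏ y, f y ω) := by
    apply markov
    · intro ω
      exact mul_nonneg (Real.exp_pos _).le (Finset.prod_nonneg fun y _ => (Real.exp_pos _).le)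
    · intro ω hω
      simp only [hf, Finset.sum_singleton]
      rw [← Real.exp_sum, ← Finset.mul_sum, ← Real.exp_add]
      apply Real.one_le_exp
      have := mul_le_mul_of_nonneg_left (show t ≤ ∑ y, iv (kar (Adj ω) w κ y x) from hω) hlam
      linarith
  refine h1.trans ?_
  rw [Ex_mul_const, indep_low hw f]
  · have h2 := fun y => single_bound hw {x} y hκ hlam hρ0 hρ hq (by simpa using hU)
    have h3 := Finset.prod_le_prod (s := Finset.univ) (fun y _ => Ex_nonneg (w := w) fun ω =>
      (Real.exp_pos (lam * ∑ x' ∈ {x}, iv (kar (Adj ω) w κ y x'))).le)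
      (fun y _ => h2 y)
    refine (mul_le_mul_of_nonneg_left h3 (Real.exp_pos _).le).trans ?_
    rw [← Real.exp_sum, ← Real.exp_add]
    apply Real.exp_le_exp.2
    simp only [Finset.card_singleton, Nat.cast_one, mul_one]
    have := sum_wsq hw (3 * Real.exp (2 * lam)) ρ κ hρ (by positivity) hκ hρ0 Finset.univ
    linarith
  · intro y ω ω' h
    simp only [hf, kar_congr h]

end events
end GRGProof
end

section
open MeasureTheory Real

namespace GRGProof
open GRG Matrix

variable {N : ℕ}
section ev9
variable {w : Fin N → ℝ}
open Classical

/-- factors for P9 -/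
noncomputable def f9 (w : Fin N → ℝ) (κ lam : ℝ) (y : Fin N) (U : Finset (Fin N)) (y' : Fin N)
    (ω : EdgeIdx N → Bool) : ℝ :=
  if y' = y then ∏ x ∈ U, iv (Adj ω y x ∧ up w y x)
  else Real.exp (lam * ∑ x ∈ U, iv (kar (Adj ω) w κ y' x))

lemma f9_nonneg (κ lam : ℝ) (y : Fin N) (U : Finset (Fin N)) (y' : Fin N)
    (ω : EdgeIdx N → Bool) : 0 ≤ f9 w κ lam y U y' ω := by
  unfold f9
  split_ifs
  · exact Finset.prod_nonneg fun _ _ => iv_nonneg _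
  · exact (Real.exp_pos _).le

lemma f9_prod (hw : ∀ x, 0 < w x) (y : Fin N) (U : Finset (Fin N)) {κ lam ρ q α β : ℝ} (hκ : 0 < κ)
    (hlam : 0 ≤ lam) (hρ0 : 0 ≤ ρ) (hρ : ∑ z, w z ^ 2 ≤ ρ * ∑ z, w z)
    (hq : ∀ x y, w x * w y / (∑ z, w z) ≤ q) (hq0 : 0 ≤ q) (hαq : Real.exp lam * (α * q) ≤ 1)
    (hβ : 3 * Real.exp (2 * lam) * (ρ ^ 2 / κ) ≤ lam * β / 4) (hU : (U.card : ℝ) ≤ α) :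
    Real.exp (-(lam * β * U.card / 4)) * Ex w (fun ω => ∏ y', f9 w κ lam y U y' ω) ≤
      ∏ x ∈ U, (iv (up w y x) * (w y * w x / ∑ z, w z)) := by
  have hS := S_pos hw y
  have hnn : 0 ≤ ∏ x ∈ U, (iv (up w y x) * (w y * w x / ∑ z, w z)) :=
    Finset.prod_nonneg fun x _ => mul_nonneg (iv_nonneg _) (by have := hw x; have := hw y; positivity)
  rw [indep_low hw (f9 w κ lam y U)]
  · rw [← Finset.mul_prod_erase Finset.univ _ (Finset.mem_univ y)]
    have h1 : Ex w (f9 w κ lam y U y) ≤ ∏ x ∈ U, (iv (up w y x) * (w y * w x / ∑ z, w z)) := by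
      have : f9 w κ lam y U y = fun ω => ∏ x ∈ U, (fun (x : Fin N) (p : Prop) => iv (p ∧ up w y x)) x (Adj ω y x) := by
        ext ω; simp [f9]
      rw [this, indep_star hw y (fun (x : Fin N) (p : Prop) => iv (p ∧ up w y x)) U]
      refine Finset.prod_le_prod (fun x _ => Ex_nonneg fun _ => iv_nonneg _) fun x _ => ?_
      by_cases hu : up w y x
      · rw [iv_pos hu, one_mul]
        have hne : y ≠ x := by rintro rfl; exact (up_ne hu) rfl
        refine le_trans ?_ (pGRG_le hw y x)
        rw [← Ex_adj hw hne]
        exact Ex_mono fun ω => iv_mono fun h => h.1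
      · rw [iv_neg hu, zero_mul]
        refine (Ex_mono (g := fun _ => 0) fun ω => ?_).trans (Ex_const hw 0).le
        rw [iv_neg (fun h => hu h.2)]
    have h2 : ∏ y' ∈ Finset.univ.erase y, Ex w (f9 w κ lam y U y') ≤ Real.exp (lam * β * U.card / 4) := by
      have h3 : ∀ y' ∈ Finset.univ.erase y, Ex w (f9 w κ lam y U y') ≤
          Real.exp ((3 * U.card * Real.exp (2 * lam)) * (w y' ^ 2 / (∑ z, w z) * (ρ / κ))) := by
        intro y' hy'
        have : f9 w κ lam y U y' = fun ω => Real.exp (lam * ∑ x ∈ U, iv (kar (Adj ω) w κ y' x)) := by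
          ext ω; simp [f9, Finset.ne_of_mem_erase hy']
        rw [this]
        apply single_bound hw U y' hκ hlam hρ0 hρ hq
        refine le_trans ?_ hαq
        gcongr
      refine (Finset.prod_le_prod (fun y' _ => Ex_nonneg fun _ => f9_nonneg _ _ _ _ _ _) h3).trans ?_
      rw [← Real.exp_sum]
      apply Real.exp_le_exp.2
      have h5 := sum_wsq hw (3 * U.card * Real.exp (2 * lam)) ρ κ hρ (by positivity) hκ hρ0 (Finset.univ.erase y)
      refine h5.trans ?_
      have := mul_le_mul_of_nonneg_right hβ (Nat.cast_nonneg (α := ℝ) U.card)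
      linarith
    have h4 := mul_le_mul h1 h2 (Finset.prod_nonneg fun y' _ => Ex_nonneg fun _ => f9_nonneg _ _ _ _ _ _) hnn
    refine (mul_le_mul_of_nonneg_left h4 (Real.exp_pos _).le).trans (le_of_eq ?_)
    rw [mul_left_comm, ← Real.exp_add]; simp
  · intro y' ω ω' h
    unfold f9
    split_ifs with e
    · subst e
      refine Finset.prod_congr rfl fun x _ => iv_congr ?_
      constructor
      · rintro ⟨a, b⟩; exact ⟨(h x b).1 a, b⟩
      · rintro ⟨a, b⟩; exact ⟨(h x b).2 a, b⟩
    · simp only [kar_congr h]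

/-- P9 -/
lemma ev9 (hw : ∀ x, 0 < w x) (y : Fin N) {κ lam ρ q α β t : ℝ} (hκ : 0 < κ)
    (hlam : 0 ≤ lam) (hρ0 : 0 ≤ ρ) (hρ : ∑ z, w z ^ 2 ≤ ρ * ∑ z, w z)
    (hq : ∀ x y, w x * w y / (∑ z, w z) ≤ q) (hq0 : 0 ≤ q) (hαq : Real.exp lam * (α * q) ≤ 1)
    (hβ : 3 * Real.exp (2 * lam) * (ρ ^ 2 / κ) ≤ lam * β / 4) (hβ2 : 2 ≤ β) :
    (grgMeasure w).real {ω | outN (Adj ω) w y ≤ α ∧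
      t ≤ ∑ x, iv (Adj ω y x ∧ up w y x ∧ β < inN (Adj ω) w κ x) * inN (Adj ω) w κ x} ≤
      Real.exp (ρ - lam * t / 4) := by
  have hS := S_pos hw y
  set FU : Finset (Finset (Fin N)) := Finset.univ.filter fun U => (U.card : ℝ) ≤ α with hFU
  have h1 : (grgMeasure w).real {ω | outN (Adj ω) w y ≤ α ∧
      t ≤ ∑ x, iv (Adj ω y x ∧ up w y x ∧ β < inN (Adj ω) w κ x) * inN (Adj ω) w κ x} ≤
      Ex w (fun ω => ∑ U ∈ FU, (Real.exp (-(lam * t / 4)) * Real.exp (-(lam * β * U.card / 4))) *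
        ∏ y', f9 w κ lam y U y' ω) := by
    have hnn : ∀ ω U, 0 ≤ (Real.exp (-(lam * t / 4)) * Real.exp (-(lam * β * (U : Finset (Fin N)).card / 4))) *
        ∏ y', f9 w κ lam y U y' ω := fun ω U =>
      mul_nonneg (by positivity) (Finset.prod_nonneg fun _ _ => f9_nonneg _ _ _ _ _ _)
    apply markov
    · intro ω; exact Finset.sum_nonneg fun U _ => hnn ω U
    · rintro ω ⟨ho, ht⟩
      set U : Finset (Fin N) := Finset.univ.filter fun x => Adj ω y x ∧ up w y x ∧ β < inN (Adj ω) w κ x with hU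
      have hcard : (U.card : ℝ) ≤ α := by
        refine le_trans ?_ ho
        have : (U.card : ℝ) = ∑ x ∈ U, 1 := by simp
        rw [this]
        calc ∑ x ∈ U, (1 : ℝ) ≤ ∑ x ∈ U, iv (Adj ω y x ∧ up w y x) := by
              refine Finset.sum_le_sum fun x hx => ?_
              have hx' := (Finset.mem_filter.1 hx).2
              rw [iv_pos ⟨hx'.1, hx'.2.1⟩]
          _ ≤ _ := Finset.sum_le_sum_of_subset_of_nonneg (Finset.subset_univ _) fun _ _ _ => iv_nonneg _
      have hmem : U ∈ FU := by simp [hFU, hcard]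
      refine le_trans ?_ (Finset.single_le_sum (fun U _ => hnn ω U) hmem)
      rw [← Finset.mul_prod_erase Finset.univ _ (Finset.mem_univ y)]
      have e1 : f9 w κ lam y U y ω = 1 := by
        simp only [f9, if_true]
        apply Finset.prod_eq_one
        intro x hx
        have hx' := (Finset.mem_filter.1 hx).2
        exact iv_pos ⟨hx'.1, hx'.2.1⟩
      have e2 : ∏ y' ∈ Finset.univ.erase y, f9 w κ lam y U y' ω =
          Real.exp (lam * ∑ y' ∈ Finset.univ.erase y, ∑ x ∈ U, iv (kar (Adj ω) w κ y' x)) := by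
        rw [Finset.mul_sum, Real.exp_sum]
        refine Finset.prod_congr rfl fun y' hy' => ?_
        simp [f9, Finset.ne_of_mem_erase hy']
      rw [e1, one_mul, e2, ← Real.exp_add, ← Real.exp_add]
      apply Real.one_le_exp
      rw [Finset.sum_comm]
      have e3 : ∀ x ∈ U, t * 0 + inN (Adj ω) w κ x / 4 + β / 4 ≤ ∑ y' ∈ Finset.univ.erase y, iv (kar (Adj ω) w κ y' x) := by
        intro x hx
        have hx' := (Finset.mem_filter.1 hx).2.2.2
        have : inN (Adj ω) w κ x = iv (kar (Adj ω) w κ y x) + ∑ y' ∈ Finset.univ.erase y, iv (kar (Adj ω) w κ y' x) := by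
          rw [Finset.add_sum_erase Finset.univ (fun y' => iv (kar (Adj ω) w κ y' x)) (Finset.mem_univ y)]; rfl
        have := iv_le_one (kar (Adj ω) w κ y x)
        linarith
      have e4 := Finset.sum_le_sum e3
      have e5 : t ≤ ∑ x ∈ U, inN (Adj ω) w κ x := by
        refine ht.trans (le_of_eq ?_)
        rw [hU, Finset.sum_filter]
        refine Finset.sum_congr rfl fun x _ => ?_
        unfold iv; split_ifs <;> simp
      have e6 : t / 4 + U.card * (β / 4) ≤ ∑ x ∈ U, ∑ y' ∈ Finset.univ.erase y, iv (kar (Adj ω) w κ y' x) := by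
        refine le_trans ?_ e4
        rw [Finset.sum_add_distrib, Finset.sum_add_distrib, Finset.sum_const, Finset.sum_const, ← Finset.sum_div]
        simp only [nsmul_eq_mul]
        linarith
      have := mul_le_mul_of_nonneg_left e6 hlam
      linarith
  refine h1.trans ?_
  rw [Ex_sum]
  simp only [Ex_mul_const]
  calc _ ≤ ∑ U ∈ FU, Real.exp (-(lam * t / 4)) * ∏ x ∈ U, (iv (up w y x) * (w y * w x / ∑ z, w z)) := by
        refine Finset.sum_le_sum fun U hU => ?_
        rw [mul_assoc]
        apply mul_le_mul_of_nonneg_left _ (Real.exp_pos _).le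
        exact f9_prod hw y U hκ hlam hρ0 hρ hq hq0 hαq hβ (Finset.mem_filter.1 hU).2
    _ ≤ ∑ U ∈ Finset.univ.powerset, Real.exp (-(lam * t / 4)) * ∏ x ∈ U, (iv (up w y x) * (w y * w x / ∑ z, w z)) := by
        apply Finset.sum_le_sum_of_subset_of_nonneg
        · intro U _; simp
        · intro U _ _
          exact mul_nonneg (Real.exp_pos _).le (Finset.prod_nonneg fun x _ => mul_nonneg (iv_nonneg _) (by have := hw x; have := hw y; positivity))
    _ = Real.exp (-(lam * t / 4)) * ∏ x, (1 + (iv (up w y x) * (w y * w x / ∑ z, w z))) := by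
        rw [← Finset.mul_sum, Finset.prod_one_add]
    _ ≤ Real.exp (-(lam * t / 4)) * Real.exp ρ := by
        apply mul_le_mul_of_nonneg_left _ (Real.exp_pos _).le
        calc _ ≤ ∏ x, Real.exp (iv (up w y x) * (w y * w x / ∑ z, w z)) := by
              refine Finset.prod_le_prod (fun x _ => ?_) fun x _ => ?_
              · have : 0 ≤ iv (up w y x) * (w y * w x / ∑ z, w z) := mul_nonneg (iv_nonneg _) (by have := hw x; have := hw y; positivity)
                linarith
              · rw [add_comm]; exact Real.add_one_le_exp _
          _ = Real.exp (BU w Finset.univ y) := by rw [← Real.exp_sum]; rfl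
          _ ≤ _ := Real.exp_le_exp.2 (BU_univ hw hρ y)
    _ = _ := by rw [← Real.exp_add]; ring_nf

end ev9
end GRGProof
end

section
open MeasureTheory Real

namespace GRGProof
open GRG Matrix

variable {N : ℕ}
section cycles
variable {w : Fin N → ℝ}
open Classical

/-- Walk along unused edges until an already visited vertex is hit. -/
def Tk (Gn : Finset (Fin N) → Finset (EdgeIdx N) → (EdgeIdx N → Bool) → Prop) (ω : EdgeIdx N → Bool) :
    ℕ → Fin N → Finset (Fin N) → Finset (EdgeIdx N) → Prop
  | 0, _, _, _ => False
  | l + 1, c, V, F => ∃ d, ∃ h : c ≠ d, edge c d h ∉ F ∧ ω (edge c d h) = true ∧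
      ((d ∈ V ∧ Gn V (insert (edge c d h) F) ω) ∨ Tk Gn ω l d (insert d V) (insert (edge c d h) F))

/-- `M` successive ears at `x`. -/
def Gk (x : Fin N) (L : ℕ) : ℕ → Finset (Fin N) → Finset (EdgeIdx N) → (EdgeIdx N → Bool) → Prop
  | 0, _, _, _ => True
  | M + 1, V, F, ω => Tk (Gk x L M) ω L x V F

lemma Tk_dep {Gn : Finset (Fin N) → Finset (EdgeIdx N) → (EdgeIdx N → Bool) → Prop}
    (hG : ∀ V F ω ω', (∀ e, e ∉ F → ω e = ω' e) → (Gn V F ω ↔ Gn V F ω')) :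
    ∀ l c V F ω ω', (∀ e, e ∉ F → ω e = ω' e) → (Tk Gn ω l c V F ↔ Tk Gn ω' l c V F) := by
  intro l
  induction l with
  | zero => intro c V F ω ω' _; simp [Tk]
  | succ l ih =>
    intro c V F ω ω' h
    simp only [Tk]
    refine exists_congr fun d => exists_congr fun hcd => ?_
    refine and_congr_right fun hF => ?_
    rw [h _ hF]
    have h' : ∀ e, e ∉ insert (edge c d hcd) F → ω e = ω' e := fun e he =>
      h e fun he' => he (Finset.mem_insert_of_mem he')
    rw [hG V _ ω ω' h', ih d _ _ ω ω' h']

lemma Gk_dep (x : Fin N) (L M : ℕ) : ∀ V F ω ω', (∀ e, e ∉ F → ω e = ω' e) →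
    (Gk x L M V F ω ↔ Gk x L M V F ω') := by
  induction M with
  | zero => intro V F ω ω' _; simp [Gk]
  | succ M ih =>
    intro V F ω ω' h
    exact Tk_dep ih L x V F ω ω' h

lemma Ex_edge_mul (hw : ∀ x, 0 < w x) {c d : Fin N} (h : c ≠ d) (F : Finset (EdgeIdx N))
    (P : (EdgeIdx N → Bool) → Prop)
    (hP : ∀ ω ω', (∀ e, e ∉ insert (edge c d h) F → ω e = ω' e) → (P ω ↔ P ω')) :
    Ex w (fun ω => iv (ω (edge c d h) = true) * iv (P ω)) ≤ w c * w d / (∑ z, w z) * Ex w (fun ω => iv (P ω)) := by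
  rw [indep2 hw (S := fun e => e = edge c d h) (T := fun e => e ∉ insert (edge c d h) F)
    (f := fun ω => iv (ω (edge c d h) = true)) (g := fun ω => iv (P ω))]
  · apply mul_le_mul_of_nonneg_right _ (Ex_nonneg fun _ => iv_nonneg _)
    refine le_trans (le_of_eq ?_) (pGRG_le hw c d)
    rw [← Ex_adj hw h]
    congr 1; ext ω
    exact (iv_congr (adj_iff ω h)).symm
  · rintro e rfl h'; exact h' (Finset.mem_insert_self _ _)
  · intro ω ω' h'
    show iv _ = iv _
    rw [h' _ rfl]
  · intro ω ω' h'
    exact iv_congr (hP ω ω' h')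

lemma iv_or_le (p q : Prop) : iv (p ∨ q) ≤ iv p + iv q := by
  by_cases hp : p <;> by_cases hq : q <;> simp [iv, hp, hq]

lemma Tk_bound (hw : ∀ x, 0 < w x) {ρ a g : ℝ} (hρ1 : 1 ≤ ρ) (ha0 : 0 ≤ a) (hg0 : 0 ≤ g)
    (hρ : ∑ z, w z ^ 2 ≤ ρ * ∑ z, w z) (ha : ∀ d, w d / (∑ z, w z) ≤ a)
    {Gn : Finset (Fin N) → Finset (EdgeIdx N) → (EdgeIdx N → Bool) → Prop}
    (hG : ∀ V F ω ω', (∀ e, e ∉ F → ω e = ω' e) → (Gn V F ω ↔ Gn V F ω')) (n : ℕ)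
    (hGn : ∀ V F, V.card ≤ n → Ex w (fun ω => iv (Gn V F ω)) ≤ g) :
    ∀ l c V F, V.card + l ≤ n → Ex w (fun ω => iv (Tk Gn ω l c V F)) ≤ w c * (l * ρ ^ l * (n * a * g)) := by
  intro l
  induction l with
  | zero =>
    intro c V F _
    simp only [Tk]
    rw [Ex_const hw, iv_neg (fun h => h)]; simp
  | succ l ih =>
    intro c V F hV
    have hS := S_pos hw c
    have hwc := hw c
    have h1 : ∀ ω : EdgeIdx N → Bool, iv (Tk Gn ω (l + 1) c V F) ≤ ∑ d, (if h : c ≠ d then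
        (iv (d ∈ V) * (iv (ω (edge c d h) = true) * iv (Gn V (insert (edge c d h) F) ω)) +
          iv (ω (edge c d h) = true) * iv (Tk Gn ω l d (insert d V) (insert (edge c d h) F))) else 0) := by
      intro ω
      have hnn : ∀ d, 0 ≤ (if h : c ≠ d then
        (iv (d ∈ V) * (iv (ω (edge c d h) = true) * iv (Gn V (insert (edge c d h) F) ω)) +
          iv (ω (edge c d h) = true) * iv (Tk Gn ω l d (insert d V) (insert (edge c d h) F))) else 0) := by
        intro d
        split_ifs
        · exact add_nonneg (mul_nonneg (iv_nonneg _) (mul_nonneg (iv_nonneg _) (iv_nonneg _)))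
            (mul_nonneg (iv_nonneg _) (iv_nonneg _))
        · exact le_rfl
      by_cases ht : Tk Gn ω (l + 1) c V F
      · rw [iv_pos ht]
        obtain ⟨d, hcd, -, hω, hor⟩ := ht
        refine le_trans ?_ (Finset.single_le_sum (fun d _ => hnn d) (Finset.mem_univ d))
        rw [dif_pos hcd, iv_pos hω, one_mul, one_mul, ← iv_and]
        exact (iv_pos hor).symm.le.trans (iv_or_le _ _)
      · rw [iv_neg ht]; exact Finset.sum_nonneg fun d _ => hnn d
    refine (Ex_mono h1).trans ?_
    rw [Ex_sum]
    set B := (l : ℝ) * ρ ^ l * (n * a * g) with hB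
    have hB0 : 0 ≤ B := by positivity
    have h2 : ∀ d, Ex w (fun ω => (if h : c ≠ d then
        (iv (d ∈ V) * (iv (ω (edge c d h) = true) * iv (Gn V (insert (edge c d h) F) ω)) +
          iv (ω (edge c d h) = true) * iv (Tk Gn ω l d (insert d V) (insert (edge c d h) F))) else 0)) ≤
        iv (d ∈ V) * (w c * (a * g)) + w d ^ 2 * (w c * (B / ∑ z, w z)) := by
      intro d
      have hwd := hw d
      have hivn := iv_nonneg (d ∈ V)
      by_cases h : c ≠ d
      · simp only [dif_pos h]
        rw [Ex_add, Ex_mul_const]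
        have e1 := Ex_edge_mul hw h F (fun ω => Gn V (insert (edge c d h) F) ω) (fun ω ω' => hG _ _ ω ω')
        have e2 := Ex_edge_mul hw h F (fun ω => Tk Gn ω l d (insert d V) (insert (edge c d h) F))
          (fun ω ω' => Tk_dep hG _ _ _ _ ω ω')
        have e3 := hGn V (insert (edge c d h) F) (by omega)
        have e4 := ih d (insert d V) (insert (edge c d h) F) (by
          have := Finset.card_insert_le d V; omega)
        have e5 : w c * w d / (∑ z, w z) * Ex w (fun ω => iv (Gn V (insert (edge c d h) F) ω)) ≤ w c * (a * g) := by
          rw [mul_div_assoc, mul_assoc]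
          apply mul_le_mul_of_nonneg_left _ hwc.le
          exact mul_le_mul (ha d) e3 (Ex_nonneg fun _ => iv_nonneg _) ha0
        have e6 : w c * w d / (∑ z, w z) * Ex w (fun ω => iv (Tk Gn ω l d (insert d V) (insert (edge c d h) F))) ≤
            w d ^ 2 * (w c * (B / ∑ z, w z)) := by
          refine (mul_le_mul_of_nonneg_left e4 (by positivity)).trans (le_of_eq ?_)
          field_simp
        have := mul_le_mul_of_nonneg_left (e1.trans e5) hivn
        linarith
      · simp only [dif_neg h]
        rw [Ex_const hw]
        positivity
    refine (Finset.sum_le_sum fun d _ => h2 d).trans ?_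
    rw [Finset.sum_add_distrib, ← Finset.sum_mul, ← Finset.sum_mul]
    have h3 : ∑ d, iv (d ∈ V) = (V.card : ℝ) := by
      have := sum_iv_ncard (V : Set (Fin N))
      rw [Set.ncard_coe_finset] at this
      exact this
    rw [h3]
    have h4 : (∑ d, w d ^ 2) * (w c * (B / ∑ z, w z)) ≤ w c * (ρ * B) := by
      refine (mul_le_mul_of_nonneg_right hρ (by positivity)).trans (le_of_eq ?_)
      field_simp
    have h5 : (V.card : ℝ) * (w c * (a * g)) ≤ n * (w c * (a * g)) := by
      apply mul_le_mul_of_nonneg_right _ (by positivity)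
      exact_mod_cast (by omega : V.card ≤ n)
    have h6 : n * (a * g) ≤ ρ ^ (l + 1) * (n * a * g) := by
      have : 1 ≤ ρ ^ (l + 1) := one_le_pow₀ hρ1
      have : 0 ≤ n * a * g := by positivity
      nlinarith
    have h7 := mul_le_mul_of_nonneg_left h6 hwc.le
    refine (add_le_add h5 h4).trans ?_
    rw [hB]
    push_cast
    rw [pow_succ] at h7 ⊢
    nlinarith

lemma Gk_bound (hw : ∀ x, 0 < w x) {ρ q : ℝ} (hρ1 : 1 ≤ ρ) (hq0 : 0 ≤ q)
    (hρ : ∑ z, w z ^ 2 ≤ ρ * ∑ z, w z)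
    (hq : ∀ x y, w x * w y / (∑ z, w z) ≤ q) (x : Fin N) (L n : ℕ) :
    ∀ M V F, V.card + L * M ≤ n → Ex w (fun ω => iv (Gk x L M V F ω)) ≤ (q * (L * ρ ^ L * n)) ^ M := by
  intro M
  induction M with
  | zero => intro V F _; simp [Gk, Ex_const hw, iv]
  | succ M ih =>
    intro V F hV
    have hwx := hw x
    rw [Nat.mul_succ] at hV
    have h1 := Tk_bound hw hρ1 (a := q / w x) (g := (q * (L * ρ ^ L * n)) ^ M) (by positivity) (by positivity) hρ
      (by
        intro d
        rw [le_div_iff₀ hwx]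
        refine le_trans (le_of_eq ?_) (hq x d)
        ring) (Gk_dep x L M) (n - L * M) (fun V F h => ih V F (by omega)) L x V F (by omega)
    refine h1.trans ?_
    have h2 : ((n - L * M : ℕ) : ℝ) ≤ n := by exact_mod_cast Nat.sub_le _ _
    calc w x * (L * ρ ^ L * ((n - L * M : ℕ) * (q / w x) * (q * (L * ρ ^ L * n)) ^ M))
        ≤ w x * (L * ρ ^ L * (n * (q / w x) * (q * (L * ρ ^ L * n)) ^ M)) := by gcongr
      _ = _ := by rw [pow_succ]; field_simp

lemma Tk_det {ω : EdgeIdx N → Bool} {Gn : Finset (Fin N) → Finset (EdgeIdx N) → (EdgeIdx N → Bool) → Prop}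
    {x : Fin N} {l : ℕ} {γ : ℕ → Fin N} (hp : ∀ j < l, Adj ω (γ j) (γ (j + 1)))
    (hnb : ∀ j, j + 2 ≤ l → γ j ≠ γ (j + 2)) (hl : γ l = x) (n : ℕ)
    (hGn : ∀ V F, x ∈ V → (∀ a b h, edge a b h ∈ F → a ∈ V ∧ b ∈ V) → F.card ≤ n → Gn V F ω) :
    ∀ f i V F, i < l → l ≤ i + f → x ∈ V → γ i ∈ V → (∀ a b h, edge a b h ∈ F → a ∈ V ∧ b ∈ V) →
      (∀ h, edge (γ i) (γ (i + 1)) h ∉ F) → F.card + f ≤ n → Tk Gn ω f (γ i) V F := by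
  intro f
  induction f with
  | zero => intro i V F h1 h2; omega
  | succ f ih =>
    intro i V F hi hif hx hγ hF hnew hcard
    have hadj := hp i hi
    have hne : γ i ≠ γ (i + 1) := by
      intro h; rw [← h] at hadj; exact adj_irr ω _ hadj
    refine ⟨γ (i + 1), hne, hnew hne, (adj_iff ω hne).1 hadj, ?_⟩
    have hc : (insert (edge (γ i) (γ (i + 1)) hne) F).card ≤ F.card + 1 := Finset.card_insert_le _ _
    have hF' : ∀ V' : Finset (Fin N), V ⊆ V' → γ (i + 1) ∈ V' →
        ∀ a b h, edge a b h ∈ insert (edge (γ i) (γ (i + 1)) hne) F → a ∈ V' ∧ b ∈ V' := by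
      intro V' hV' hd a b h hm
      rcases Finset.mem_insert.1 hm with hm | hm
      · rcases edge_inj hm with ⟨rfl, rfl⟩ | ⟨rfl, rfl⟩
        · exact ⟨hV' hγ, hd⟩
        · exact ⟨hd, hV' hγ⟩
      · exact ⟨hV' (hF a b h hm).1, hV' (hF a b h hm).2⟩
    by_cases hd : γ (i + 1) ∈ V
    · left
      exact ⟨hd, hGn _ _ hx (hF' V (Finset.Subset.refl _) hd) (by omega)⟩
    · right
      have hil : i + 1 < l := by
        rcases Nat.lt_or_ge (i + 1) l with h | h
        · exact h
        · have : i + 1 = l := by omega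
          rw [this, hl] at hd; exact absurd hx hd
      apply ih (i + 1) _ _ hil (by omega) (Finset.mem_insert_of_mem hx) (Finset.mem_insert_self _ _)
        (hF' _ (Finset.subset_insert _ _) (Finset.mem_insert_self _ _)) _ (by omega)
      intro h hm
      rcases Finset.mem_insert.1 hm with hm | hm
      · rcases edge_inj hm with ⟨h1, h2⟩ | ⟨h1, h2⟩
        · exact hne h1.symm
        · exact hnb i (by omega) h2.symm
      · exact hd (hF _ _ h hm).1

lemma Gk_det {ω : EdgeIdx N → Bool} {r : ℕ} {x : Fin N} (n : ℕ) (hn : n < (S1cycA (Adj ω) r x).ncard) :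
    ∀ M V F, x ∈ V → (∀ a b h, edge a b h ∈ F → a ∈ V ∧ b ∈ V) → F.card + (2 * r + 1) * M ≤ n →
      Gk x (2 * r + 1) M V F ω := by
  intro M
  induction M with
  | zero => intro V F _ _ _; trivial
  | succ M ih =>
    intro V F hx hF hcard
    rw [Nat.mul_succ] at hcard
    have hex : ∃ y ∈ S1cycA (Adj ω) r x, ∀ h, edge x y h ∉ F := by
      by_contra hcon
      push Not at hcon
      have hle : (S1cycA (Adj ω) r x).ncard ≤ F.card := by
        have hsub : S1cycA (Adj ω) r x ⊆ (F.image fun e => if e.val.1 = x then e.val.2 else e.val.1 : Finset (Fin N)) := by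
          intro y hy
          obtain ⟨h, he⟩ := hcon y hy
          rw [Finset.mem_coe, Finset.mem_image]
          refine ⟨_, he, ?_⟩
          unfold edge
          split_ifs <;> simp_all
        refine (Set.ncard_le_ncard hsub (Finset.finite_toSet _)).trans ?_
        rw [Set.ncard_coe_finset]
        exact Finset.card_image_le
      have : F.card ≤ n := by omega
      omega
    obtain ⟨y, ⟨hxy, l, γ, hl3, hlr, h0, h1, hl, hpath, hsimp⟩, hnew⟩ := hex
    have := Tk_det (ω := ω) (Gn := Gk x (2 * r + 1) M) hpath (fun j hj => hsimp j (j + 2) (by omega) hj (by omega)) hl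
      (n - (2 * r + 1) * M) (fun V F a b c => ih V F a b (by omega)) (2 * r + 1) 0 V F (by omega) (by omega) hx (h0 ▸ hx) hF
      (by rw [zero_add, h0, h1]; exact hnew) (by omega)
    rw [h0] at this
    exact this

/-- P7 -/
lemma ev7 (hw : ∀ x, 0 < w x) {ρ q : ℝ} (hρ1 : 1 ≤ ρ) (hq0 : 0 ≤ q)
    (hρ : ∑ z, w z ^ 2 ≤ ρ * ∑ z, w z)
    (hq : ∀ x y, w x * w y / (∑ z, w z) ≤ q) (x : Fin N) (r M : ℕ) {K : ℝ} (hK : ((2 * r + 1) * M : ℕ) ≤ K) :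
    (grgMeasure w).real {ω | K < ((S1cycA (Adj ω) r x).ncard : ℝ)} ≤
      (q * ((2 * r + 1 : ℕ) * ρ ^ (2 * r + 1) * (1 + (2 * r + 1) * M : ℕ))) ^ M := by
  refine le_trans (markov (F := fun ω => iv (Gk x (2 * r + 1) M {x} ∅ ω)) (fun _ => iv_nonneg _) ?_)
    (Gk_bound hw hρ1 hq0 hρ hq x (2 * r + 1) (1 + (2 * r + 1) * M) M {x} ∅ (by simp))
  intro ω hω
  rw [iv_pos]
  have : (2 * r + 1) * M < (S1cycA (Adj ω) r x).ncard := by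
    have : (((2 * r + 1) * M : ℕ) : ℝ) < ((S1cycA (Adj ω) r x).ncard : ℝ) := lt_of_le_of_lt hK hω
    exact_mod_cast this
  exact Gk_det _ this M {x} ∅ (by simp) (by simp) (by simp)

end cycles
end GRGProof
end

section
open MeasureTheory Real

namespace GRGProof
open GRG Matrix

variable {N : ℕ}
section assemble
variable {w : Fin N → ℝ}

lemma meas_union (s : Finset (Fin N)) (B : Fin N → Set (EdgeIdx N → Bool)) {τ : ℝ}
    (h : ∀ x, (grgMeasure w).real (B x) ≤ τ) : (grgMeasure w).real (⋃ x, B x) ≤ N * τ := by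
  refine (measureReal_iUnion_fintype_le B).trans ?_
  refine (Finset.sum_le_sum fun x _ => h x).trans ?_
  simp

lemma meas_cup {A B : Set (EdgeIdx N → Bool)} {a b : ℝ} (hA : (grgMeasure w).real A ≤ a)
    (hB : (grgMeasure w).real B ≤ b) : (grgMeasure w).real (A ∪ B) ≤ a + b :=
  (measureReal_union_le A B).trans (add_le_add hA hB)

lemma assemble (r : ℕ) (hw : ∀ x, 0 < w x)
    (ν δ h K0 L1 W K R α β τ : ℝ) (hh : 8 ≤ h) (hK : 1 ≤ K) (hRK : 14 * K ≤ R) (hRK0 : K0 ≤ R)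
    (hRxi : xi ν δ N ≤ R) (hL : 8 * R + L1 ≤ h * R) (hα : 0 ≤ α) (hab : α * β ≤ R)
    (H1 : ∀ z, (grgMeasure w).real {ω | 8 * (degA (Adj ω) z : ℝ) + L1 ≤ w z} ≤ τ)
    (H2 : ∀ z, (grgMeasure w).real {ω | max K0 (h * w z) ≤ (degA (Adj ω) z : ℝ)} ≤ τ)
    (H3 : ∀ z, w z < W → (grgMeasure w).real {ω | xi ν δ N ≤ (degA (Adj ω) z : ℝ)} ≤ τ)
    (H4 : ∀ p, (grgMeasure w).real {ω | K ≤ TT (Adj ω) w ((h ^ 2)⁻¹) p} ≤ τ)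
    (H5 : ∀ p, (grgMeasure w).real {ω | max K (w p / h ^ 2) ≤ ∑ y, iv (Adj ω p y ∧ W ≤ w y)} ≤ τ)
    (H6 : ∀ x, (grgMeasure w).real {ω | K ≤ inN (Adj ω) w ((h ^ 2)⁻¹) x} ≤ τ)
    (H7 : ∀ x, (grgMeasure w).real {ω | K < ((S1cycA (Adj ω) r x).ncard : ℝ)} ≤ τ)
    (H8 : ∀ x, (grgMeasure w).real {ω | K ≤ ∑ y, iv (kar (Adj ω) w ((h ^ 2)⁻¹) y x ∧ α < outN (Adj ω) w y) *
      outN (Adj ω) w y} ≤ τ)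
    (H9 : ∀ y, (grgMeasure w).real {ω | outN (Adj ω) w y ≤ α ∧ K ≤ ∑ x, iv (Adj ω y x ∧ up w y x ∧
      β < inN (Adj ω) w ((h ^ 2)⁻¹) x) * inN (Adj ω) w ((h ^ 2)⁻¹) x} ≤ τ) (hτ : 0 ≤ τ) :
    (grgMeasure w).real {ω |
          opNorm (AhatA (Adj ω) r ν δ - adjMatrixPA (Adj ω) r) ≤ 2008 * √R ∧
          opNorm (AhatA (Adj ω) r ν δ - adjMatrix ω) ≤ 2008 * √R}ᶜ ≤ 9 * (N * τ) := by
  have H3' : ∀ z, (grgMeasure w).real {ω | w z < W ∧ xi ν δ N ≤ (degA (Adj ω) z : ℝ)} ≤ τ := by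
    intro z
    by_cases hz : w z < W
    · simpa [hz] using H3 z hz
    · simpa [hz] using hτ
  have U := meas_cup (meas_cup (meas_cup (meas_cup (meas_cup (meas_cup (meas_cup (meas_cup
    (meas_union Finset.univ _ H1) (meas_union Finset.univ _ H2)) (meas_union Finset.univ _ H3'))
    (meas_union Finset.univ _ H4)) (meas_union Finset.univ _ H5)) (meas_union Finset.univ _ H6))
    (meas_union Finset.univ _ H7)) (meas_union Finset.univ _ H8)) (meas_union Finset.univ _ H9)
  refine le_trans (measureReal_mono ?_) (U.trans (by linarith))
  intro ω hω
  by_contra hbad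
  apply hω
  simp only [Set.mem_union, not_or, Set.mem_iUnion, not_exists, Set.mem_setOf_eq, not_le, not_and, not_lt] at hbad
  obtain ⟨⟨⟨⟨⟨⟨⟨⟨b1, b2⟩, b3⟩, b4⟩, b5⟩, b6⟩, b7⟩, b8⟩, b9⟩ := hbad
  rw [Set.mem_setOf_eq, adjMatrix_eq_chi]
  exact det3 (adj_symm ω) (adj_irr ω) w hw ν δ h K0 L1 W K R α β hh hK hRK hRK0 hRxi hL hα hab
    (fun z => (b1 z).le) (fun z => (b2 z).le)
    (fun z hz => by
      by_contra hc
      exact absurd hz (not_le.2 (b3 z (not_le.1 hc))))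
    (fun p => (b4 p).le) (fun p => (b5 p).le) (fun x => (b6 x).le) b7 (fun x => (b8 x).le)
    (fun y hy => (b9 y hy).le)

end assemble
end GRGProof
end

section
open MeasureTheory Real

namespace GRGProof
open GRG Matrix

variable {N : ℕ}
section core
variable {w : Fin N → ℝ}

set_option maxHeartbeats 1000000 in
lemma core (r M : ℕ) (hw : ∀ x, 0 < w x)
    (ν δ η C D X W L l q e cx ρ : ℝ) (hν : 0 < ν) (hη : 0 < η) (hC : 1 ≤ C) (hD : 1 ≤ D) (hL1 : 1 ≤ L)
    (hl : 2 ≤ η * l) (hl0 : 0 < l) (hX : Real.exp (η * l) = X) (hXl : 8 + l ≤ X) (hXC : 12 * C ^ 2 ≤ X)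
    (hW0 : 0 < W) (hWL : W ≤ L) (hW : Real.exp (l / 4) * W ≤ L / 2)
    (hxi : xi ν δ N = cx * (L / l)) (hcx : 6 * (ν + 1) ≤ cx)
    (hρd : ρ = C * D) (hρ : ∑ z, w z ^ 2 ≤ ρ * ∑ z, w z)
    (hq0 : 0 ≤ q) (hq : ∀ x y, w x * w y / (∑ z, w z) ≤ q)
    (h1 : ∀ x y, w x * w y ≤ ∑ u, w u) (h2 : ∀ x, 2 * w x ≤ ∑ u, w u)
    (a3 : l * (D ^ 3 * X ^ 8) ≤ L) (a6 : C * D * X ^ 3 ≤ W) (a7 : 3 * C ^ 2 * D ^ 2 * X ^ 6 ≤ L)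
    (a8 : X ^ 4 * D * q ≤ 1)
    (a9 : q * ((2 * r + 1 : ℕ) * ρ ^ (2 * r + 1) * (1 + (2 * r + 1) * M : ℕ)) ≤ Real.exp (-(e * L)))
    (he : ν + 1 ≤ e * M) (hM : ((2 * r + 1) * M : ℕ) ≤ 4 * (ν + 2) / η * (L / l)) (hξ : 1 ≤ 4 * (ν + 2) / η * (L / l)) :
    (grgMeasure w).real {ω |
          opNorm (AhatA (Adj ω) r ν δ - adjMatrixPA (Adj ω) r) ≤
            2008 * √((14 * (4 * (ν + 2) / η) + cx + 8 * (ν + 1) + 1) * (L / l)) ∧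
          opNorm (AhatA (Adj ω) r ν δ - adjMatrix ω) ≤
            2008 * √((14 * (4 * (ν + 2) / η) + cx + 8 * (ν + 1) + 1) * (L / l))}ᶜ ≤
      9 * (N * Real.exp (-((ν + 1) * L))) := by
  have hξ0 : 0 < L / l := by positivity
  obtain ⟨Kc, hKc⟩ : ∃ k, k = 4 * (ν + 2) / η := ⟨_, rfl⟩
  have hKc0 : 0 ≤ Kc := by rw [hKc]; positivity
  rw [← hKc] at hM hξ ⊢
  obtain ⟨ξ, hξd⟩ : ∃ k, k = L / l := ⟨_, rfl⟩
  rw [← hξd] at hM hξ hξ0 hxi ⊢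
  have hξL : l * ξ = L := by rw [hξd]; field_simp
  have hKc2 : η * Kc = 4 * (ν + 2) := by rw [hKc]; field_simp
  obtain ⟨K, hKd⟩ : ∃ k, k = Kc * ξ := ⟨_, rfl⟩
  rw [← hKd] at hM hξ
  obtain ⟨K', hK'd⟩ : ∃ k, k = 14 * Kc + cx + 8 * (ν + 1) + 1 := ⟨_, rfl⟩
  rw [← hK'd]
  have hK'1 : 1 ≤ K' := by rw [hK'd]; linarith
  have hK'8 : 8 * (ν + 1) ≤ K' := by rw [hK'd]; linarith
  have hlamK : η * l * K = 4 * (ν + 2) * L := by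
    rw [hKd, ← hKc2, ← hξL]; ring
  have hlam : 0 ≤ η * l := by linarith
  have hX8 : 8 ≤ X := by linarith
  have hX1 : 1 ≤ X := by linarith
  have hX0 : 0 < X := by linarith
  have hρ0 : 0 ≤ ρ := by rw [hρd]; positivity
  have hρ1 : 1 ≤ ρ := by rw [hρd]; exact one_le_mul_of_one_le_of_one_le hC hD
  have hκ : 0 < (X ^ 2)⁻¹ := by positivity
  have hX2 : Real.exp (2 * (η * l)) = X ^ 2 := by rw [← hX, ← Real.exp_nat_mul]; norm_num
  have hX4 : Real.exp (4 * (η * l)) = X ^ 4 := by rw [← hX, ← Real.exp_nat_mul]; norm_num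
  have hCC : C ≤ C ^ 2 := le_self_pow₀ hC (by norm_num)
  have hCX : C ≤ X := by linarith
  have hνL : (ν + 1) * L ≤ 4 * (ν + 2) * L / 4 := by
    have : 4 * (ν + 2) * L / 4 = (ν + 1) * L + L := by ring
    linarith
  have hνL4 : 4 * (ν + 2) * L = 4 * ((ν + 1) * L) + 4 * L := by ring
  have hνL0 : 0 ≤ (ν + 1) * L := by positivity
  apply assemble r hw ν δ X K (8 * ((ν + 1) * L)) W K (K' * ξ) (D * X ^ 3) (D ^ 2 * X ^ 5)
    (Real.exp (-((ν + 1) * L))) hX8 hξ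
  · rw [hKd, ← mul_assoc]
    exact mul_le_mul_of_nonneg_right (by linarith) hξ0.le
  · rw [hKd]
    exact mul_le_mul_of_nonneg_right (by linarith) hξ0.le
  · rw [hxi]
    exact mul_le_mul_of_nonneg_right (by linarith) hξ0.le
  · have e1 : K' * L ≤ (X - 8) * (K' * ξ) := by
      have : K' * L = l * (K' * ξ) := by rw [← hξL]; ring
      rw [this]
      exact mul_le_mul_of_nonneg_right (by linarith) (by positivity)
    have e2 : 8 * (ν + 1) * L ≤ K' * L := mul_le_mul_of_nonneg_right hK'8 (by linarith)
    linarith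
  · positivity
  · have e1 : D ^ 3 * X ^ 8 ≤ ξ := by rw [hξd, le_div_iff₀ hl0]; linarith
    have e2 : D * X ^ 3 * (D ^ 2 * X ^ 5) = D ^ 3 * X ^ 8 := by ring
    have e3 : 1 * ξ ≤ K' * ξ := mul_le_mul_of_nonneg_right hK'1 hξ0.le
    linarith
  · intro z; exact ev1 hw z ((ν + 1) * L) h1 h2
  · -- P2
    intro z
    refine (ev2 hw z hlam).trans (Real.exp_le_exp.2 ?_)
    rw [hX]
    have m1 := le_max_left K (X * w z)
    have m2 := le_max_right K (X * w z)
    have e1 : (η * l) * K ≤ (η * l) * max K (X * w z) := mul_le_mul_of_nonneg_left m1 hlam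
    have e2 : 2 * max K (X * w z) ≤ (η * l) * max K (X * w z) :=
      mul_le_mul_of_nonneg_right hl (by linarith)
    linarith
  · -- P3
    intro z hz
    refine (ev2 hw z (lam := l / 4) (by positivity)).trans (Real.exp_le_exp.2 ?_)
    have e1 : Real.exp (l / 4) * w z ≤ L / 2 :=
      (mul_le_mul_of_nonneg_left hz.le (Real.exp_pos _).le).trans hW
    have e2 : l / 4 * (xi ν δ N) = cx * L / 4 := by rw [hxi, ← hξL]; ring
    have e3 : 6 * (ν + 1) * L ≤ cx * L := mul_le_mul_of_nonneg_right hcx (by linarith)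
    have e4 : 1 * L ≤ (ν + 1) * L := mul_le_mul_of_nonneg_right (by linarith) (by linarith)
    rw [e2]; linarith
  · -- P4
    intro p
    refine (ev4 hw p hκ hlam hρ).trans (Real.exp_le_exp.2 ?_)
    rw [hX, hlamK, hρd, div_inv_eq_mul]
    have : X * (C * D * X ^ 2) = C * D * X ^ 3 := by ring
    linarith
  · -- P5
    intro p
    refine (ev5 hw p hW0 hlam hρ).trans (Real.exp_le_exp.2 ?_)
    have hwp := hw p
    rw [hX]
    have m1 := le_max_left K (w p / X ^ 2)
    have m2 := le_max_right K (w p / X ^ 2)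
    have e0 : X * (w p * ρ / W) ≤ w p / X ^ 2 := by
      rw [← mul_div_assoc, div_le_div_iff₀ hW0 (by positivity), hρd]
      have := mul_le_mul_of_nonneg_left a6 hwp.le
      linarith
    have e1 : (η * l) * K ≤ (η * l) * max K (w p / X ^ 2) := mul_le_mul_of_nonneg_left m1 hlam
    have e2 : 2 * max K (w p / X ^ 2) ≤ (η * l) * max K (w p / X ^ 2) :=
      mul_le_mul_of_nonneg_right hl (by linarith)
    linarith
  · -- P6
    intro x
    have hqX : Real.exp (η * l) * q ≤ 1 := by
      rw [hX]
      refine le_trans ?_ a8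
      apply mul_le_mul_of_nonneg_right _ hq0
      have e1 : X ≤ X ^ 4 := le_self_pow₀ hX1 (by norm_num)
      have e2 : X ^ 4 * 1 ≤ X ^ 4 * D := mul_le_mul_of_nonneg_left hD (by positivity)
      linarith
    refine (ev6 hw x hκ hlam hρ0 hρ hq hqX).trans (Real.exp_le_exp.2 ?_)
    rw [hlamK, hX2, hρd, div_inv_eq_mul]
    have e1 : 3 * X ^ 2 * ((C * D) ^ 2 * X ^ 2) = 3 * C ^ 2 * D ^ 2 * X ^ 4 := by ring
    have e2 : 3 * C ^ 2 * D ^ 2 * X ^ 4 ≤ 3 * C ^ 2 * D ^ 2 * X ^ 6 := by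
      apply mul_le_mul_of_nonneg_left _ (by positivity)
      exact pow_le_pow_right₀ hX1 (by norm_num)
    rw [e1]; linarith
  · -- P7
    intro x
    refine (ev7 hw hρ1 hq0 hρ hq x r M hM).trans ?_
    refine (pow_le_pow_left₀ (by positivity) a9 M).trans ?_
    rw [← Real.exp_nat_mul]
    apply Real.exp_le_exp.2
    have : (ν + 1) * L ≤ e * M * L := mul_le_mul_of_nonneg_right he (by linarith)
    linarith
  · -- P8
    intro x
    have hα : Real.exp (2 * (η * l)) * ρ ≤ η * l * (D * X ^ 3) := by
      rw [hX2, hρd]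
      have e1 : X ^ 2 * (C * D) ≤ X ^ 2 * (X * D) := by gcongr
      have e2 : 2 * (D * X ^ 3) ≤ η * l * (D * X ^ 3) := mul_le_mul_of_nonneg_right hl (by positivity)
      have e3 : 0 ≤ D * X ^ 3 := by positivity
      linarith
    refine (ev8 hw x hκ hlam hρ0 hρ hα).trans (Real.exp_le_exp.2 ?_)
    rw [hlamK, hX4, hρd, div_inv_eq_mul]
    have e1 : X ^ 4 * ((C * D) ^ 2 * X ^ 2) = C ^ 2 * D ^ 2 * X ^ 6 := by ring
    have e2 : 0 ≤ C ^ 2 * D ^ 2 * X ^ 6 := by positivity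
    rw [e1]; linarith
  · -- P9
    intro y
    have hαq : Real.exp (η * l) * (D * X ^ 3 * q) ≤ 1 := by
      rw [hX]; refine le_trans (le_of_eq ?_) a8; ring
    have hβ : 3 * Real.exp (2 * (η * l)) * (ρ ^ 2 / (X ^ 2)⁻¹) ≤ η * l * (D ^ 2 * X ^ 5) / 4 := by
      rw [hX2, hρd, div_inv_eq_mul]
      have e1 : 12 * C ^ 2 * (D ^ 2 * X ^ 4) ≤ X * (D ^ 2 * X ^ 4) := by gcongr
      have e2 : 2 * (D ^ 2 * X ^ 5) ≤ η * l * (D ^ 2 * X ^ 5) := mul_le_mul_of_nonneg_right hl (by positivity)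
      have e3 : 0 ≤ D ^ 2 * X ^ 5 := by positivity
      linarith
    have hβ2 : 2 ≤ D ^ 2 * X ^ 5 := by
      have e1 : X ≤ X ^ 5 := le_self_pow₀ hX1 (by norm_num)
      have e2 : 1 ≤ D ^ 2 := one_le_pow₀ hD
      have e3 : 1 * X ^ 5 ≤ D ^ 2 * X ^ 5 := mul_le_mul_of_nonneg_right e2 (by positivity)
      linarith
    refine (ev9 hw y hκ hlam hρ0 hρ hq hq0 hαq hβ hβ2).trans (Real.exp_le_exp.2 ?_)
    rw [hlamK]
    have e1 : ρ ≤ L := by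
      rw [hρd]
      have e1 : 1 ≤ X ^ 3 := one_le_pow₀ hX1
      have e2 : C * D * 1 ≤ C * D * X ^ 3 := mul_le_mul_of_nonneg_left e1 (by positivity)
      linarith
    linarith
  · exact (Real.exp_pos _).le

end core
end GRGProof
end

section
open MeasureTheory Real

namespace GRGProof
open GRG Matrix

variable {N : ℕ}
section final
open Filter

lemma ev_rpow (c : ℝ) {a b : ℝ} (h : a < b) : ∀ᶠ L : ℝ in atTop, c * L ^ a ≤ L ^ b := by
  filter_upwards [(tendsto_rpow_atTop (show 0 < b - a by linarith)).eventually_ge_atTop c,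
    eventually_gt_atTop 0] with L hL h0
  have : L ^ b = L ^ (b - a) * L ^ a := by rw [← Real.rpow_add h0]; ring_nf
  rw [this]
  exact mul_le_mul_of_nonneg_right hL (Real.rpow_nonneg h0.le _)

lemma ev_log (c : ℝ) {b : ℝ} (h : 0 < b) : ∀ᶠ L : ℝ in atTop, c * Real.log L ≤ L ^ b := by
  have h1 := (isLittleO_log_rpow_atTop h).bound (show 0 < (|c| + 1)⁻¹ by positivity)
  filter_upwards [h1, eventually_ge_atTop 1] with L hL h0
  have hl := Real.log_nonneg h0
  rw [Real.norm_of_nonneg hl, Real.norm_of_nonneg (Real.rpow_nonneg (by linarith) _)] at hL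
  have h2 : (|c| + 1) * Real.log L ≤ L ^ b := by
    rw [inv_mul_eq_div, le_div_iff₀ (by positivity)] at hL; linarith
  have := le_abs_self c
  nlinarith

lemma ev_exp (c a : ℝ) {b : ℝ} (h : 0 < b) : ∀ᶠ L : ℝ in atTop, c * L ^ a * Real.exp (-(b * L)) ≤ 1 := by
  have h1 := (tendsto_rpow_mul_exp_neg_mul_atTop_nhds_zero a b h).const_mul c
  rw [mul_zero] at h1
  filter_upwards [h1.eventually_lt_const (show (0:ℝ) < 1 by norm_num)] with L hL
  rw [mul_assoc, ← neg_mul]; exact hL.le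

lemma opNorm_zero_dim (M : Matrix (Fin 0) (Fin 0) ℝ) : opNorm M = 0 := by
  have : M = 0 := Subsingleton.elim _ _
  subst this
  simp [opNorm]

set_option maxHeartbeats 2000000 in
lemma main_large (ε δ : ℝ) (hε : 0 < ε) (hδ : 0 < δ) (hδ' : δ < 1 / 3)
    (r : ℕ) (w : (N : ℕ) → Fin N → ℝ)
    (hpos : ∀ N x, 0 < w N x)
    (hA1 : ∀ N x, w N x ≤ (N : ℝ) ^ ((1 : ℝ) / 2 - ε))
    (hA2m1 : ∀ N : ℕ, 1 ≤ N → (N : ℝ) ^ (-ε) ≤ m1 (w N))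
    (hA2m2 : ∃ C > 0, ∀ N : ℕ, 2 ≤ N → m2 (w N) / m1 (w N) ≤ C * Real.log N ^ δ)
    (ν : ℝ) (hν : 0 < ν) :
    ∃ K' > (0 : ℝ), ∀ᶠ N : ℕ in atTop,
      (grgMeasure (w N)).real {ω |
          opNorm (AhatA (Adj ω) r ν δ - adjMatrixPA (Adj ω) r) ≤
            2008 * √(K' * (Real.log N / Real.log (Real.log N))) ∧
          opNorm (AhatA (Adj ω) r ν δ - adjMatrix ω) ≤
            2008 * √(K' * (Real.log N / Real.log (Real.log N)))}ᶜ ≤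
      9 * (N * Real.exp (-((ν + 1) * Real.log N))) := by
  obtain ⟨C0, -, hC0⟩ := hA2m2
  obtain ⟨C, hCd⟩ : ∃ C, C = max C0 1 := ⟨_, rfl⟩
  have hC1 : 1 ≤ C := hCd ▸ le_max_right _ _
  have hC0' : C0 ≤ C := hCd ▸ le_max_left _ _
  obtain ⟨η, hη⟩ : ∃ η, η = (1 - 3 * δ) / 20 := ⟨_, rfl⟩
  have hη0 : 0 < η := by rw [hη]; linarith
  obtain ⟨M, hM⟩ := exists_nat_ge ((ν + 1) / (ε / 2))
  have hM' : ν + 1 ≤ ε / 2 * M := by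
    rw [div_le_iff₀ (by positivity)] at hM; linarith
  set cx := 3 * (ν + 1) * (2 - 3 * δ) / ((1 - δ) * (1 - 2 * δ)) with hcx
  have hcx6 : 6 * (ν + 1) ≤ cx := by
    rw [hcx, le_div_iff₀ (by apply mul_pos <;> linarith)]
    have : 2 * ((1 - δ) * (1 - 2 * δ)) ≤ 2 - 3 * δ := by nlinarith
    nlinarith
  refine ⟨14 * (4 * (ν + 2) / η) + cx + 8 * (ν + 1) + 1, by
    have : 0 < 4 * (ν + 2) / η := by positivity
    linarith, ?_⟩
  have hlogN : Tendsto (fun N : ℕ => Real.log N) atTop atTop :=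
    Real.tendsto_log_atTop.comp tendsto_natCast_atTop_atTop
  set c7 : ℝ := (2 * r + 1 : ℕ) * C ^ (2 * r + 1) * (1 + (2 * r + 1) * M : ℕ) with hc7
  have b1 := hlogN.eventually (ev_log 1 (b := η / 2) (by positivity))
  have b2 := hlogN.eventually (Real.tendsto_log_atTop.eventually_ge_atTop (2 / η))
  have b3 := hlogN.eventually (ev_log 1 (show 0 < 1 - 3 * δ - 8 * η by rw [hη]; linarith))
  have b4 := hlogN.eventually (ev_rpow 2 (show (11 / 12 : ℝ) < 1 by norm_num))
  have b5 := hlogN.eventually (ev_rpow (12 * C ^ 2) hη0)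
  have b6 := hlogN.eventually (ev_rpow C (show δ + 3 * η < 2 / 3 by rw [hη]; linarith))
  have b7 := hlogN.eventually (ev_rpow (3 * C ^ 2) (show 2 * δ + 6 * η < 1 by rw [hη]; linarith))
  have b8 := hlogN.eventually (ev_exp 1 (4 * η + δ) hε)
  have b9 := hlogN.eventually (ev_exp c7 (δ * (2 * r + 1 : ℕ)) (show 0 < ε / 2 by positivity))
  have b10 := hlogN.eventually (ev_log (((2 * r + 1) * M : ℕ) + 1) (show (0 : ℝ) < 1 by norm_num))
  have b11 := hlogN.eventually (eventually_ge_atTop (2 : ℝ))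
  have b12 := hlogN.eventually (ev_rpow 9 (show η / 2 < η by linarith))
  filter_upwards [b1, b2, b3, b4, b5, b6, b7, b8, b9, b10, b11, b12, eventually_ge_atTop 2]
    with N b1 b2 b3 b4 b5 b6 b7 b8 b9 b10 b11 b12 hN2
  have hNpos : (0 : ℝ) < N := by positivity
  obtain ⟨L, hL⟩ : ∃ L, L = Real.log N := ⟨_, rfl⟩
  rw [← hL] at b1 b2 b3 b4 b5 b6 b7 b8 b9 b10 b11 b12 ⊢
  obtain ⟨l, hl⟩ : ∃ l, l = Real.log L := ⟨_, rfl⟩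
  rw [← hl] at b1 b2 b3 b10 ⊢
  have hL0 : 0 < L := by linarith
  have hNe : (N : ℝ) = Real.exp L := by rw [hL, Real.exp_log hNpos]
  have hηl : 2 ≤ η * l := by
    rw [div_le_iff₀ hη0] at b2; linarith
  have hl0 : 0 < l := by
    have : 0 < 2 / η := by positivity
    linarith
  have hXe : Real.exp (η * l) = L ^ η := by rw [Real.rpow_def_of_pos hL0, ← hl, mul_comm]
  have hpw : ∀ a : ℝ, ∀ n : ℕ, (L ^ a) ^ n = L ^ (a * n) := fun a n => by
    rw [Real.rpow_mul hL0.le, Real.rpow_natCast]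
  have hD1 : 1 ≤ L ^ δ := Real.one_le_rpow (by linarith) hδ.le
  have hX2 : 1 ≤ L ^ (η / 2) := Real.one_le_rpow (by linarith) (by positivity)
  have hKc : 1 ≤ 4 * (ν + 2) / η := by
    rw [le_div_iff₀ hη0]; rw [hη]; linarith
  have hξ : (((2 * r + 1) * M : ℕ) : ℝ) + 1 ≤ L / l := by
    rw [le_div_iff₀ hl0]; simpa using b10
  have hξ' : L / l ≤ 4 * (ν + 2) / η * (L / l) := by
    have h0 : 0 < L / l := by positivity
    have := mul_le_mul_of_nonneg_right hKc h0.le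
    linarith
  have hM0 : (0 : ℝ) ≤ (((2 * r + 1) * M : ℕ) : ℝ) := Nat.cast_nonneg _
  -- sums
  have hS1 : Real.exp ((1 - ε) * L) ≤ ∑ z, w N z := by
    have h1 := hA2m1 N (by omega)
    unfold m1 at h1
    rw [le_div_iff₀ hNpos] at h1
    refine le_trans (le_of_eq ?_) h1
    rw [hNe, ← Real.exp_mul, ← Real.exp_add]; ring_nf
  have hS0 : 0 < ∑ z, w N z := lt_of_lt_of_le (Real.exp_pos _) hS1
  have hwb : ∀ x, w N x ≤ Real.exp ((1 / 2 - ε) * L) := by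
    intro x
    refine (hA1 N x).trans (le_of_eq ?_)
    rw [hNe, ← Real.exp_mul]; ring_nf
  have hq : ∀ x y, w N x * w N y / (∑ z, w N z) ≤ Real.exp (-(ε * L)) := by
    intro x y
    rw [div_le_iff₀ hS0]
    calc w N x * w N y ≤ Real.exp ((1 / 2 - ε) * L) * Real.exp ((1 / 2 - ε) * L) :=
          mul_le_mul (hwb x) (hwb y) (hpos N y).le (Real.exp_pos _).le
      _ = Real.exp (-(ε * L)) * Real.exp ((1 - ε) * L) := by
          rw [← Real.exp_add, ← Real.exp_add]; ring_nf
      _ ≤ _ := mul_le_mul_of_nonneg_left hS1 (Real.exp_pos _).le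
  have hρ : ∑ z, w N z ^ 2 ≤ (C * L ^ δ) * ∑ z, w N z := by
    have h1 := hC0 N hN2
    unfold m1 m2 at h1
    rw [div_div_div_cancel_right₀ hNpos.ne', div_le_iff₀ hS0, ← hL] at h1
    refine h1.trans ?_
    gcongr
  have hq1 : Real.exp (-(ε * L)) ≤ 1 := Real.exp_le_one_iff.2 (by
    have : 0 < ε * L := by positivity
    linarith)
  apply core (w := w N) r M (hpos N) ν δ η C (L ^ δ) (L ^ η) (L ^ (2 / 3 : ℝ)) L l (Real.exp (-(ε * L))) (ε / 2) cx
    (C * L ^ δ) hν hη0 hC1 hD1 (by linarith) hηl hl0 hXe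
  · -- 8 + l ≤ L^η
    have e1 : L ^ (η / 2) * 9 ≤ L ^ η := by linarith
    linarith
  · simpa using b5
  · positivity
  · calc L ^ (2 / 3 : ℝ) ≤ L ^ (1 : ℝ) := Real.rpow_le_rpow_of_exponent_le (by linarith) (by norm_num)
      _ = L := Real.rpow_one L
  · have e1 : Real.exp (l / 4) = L ^ (1 / 4 : ℝ) := by
      rw [Real.rpow_def_of_pos hL0, ← hl]; ring_nf
    rw [e1, ← Real.rpow_add hL0]
    norm_num at b4 ⊢
    linarith
  · rw [xi, ← hL, ← hl]
  · exact hcx6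
  · rfl
  · exact hρ
  · exact (Real.exp_pos _).le
  · exact hq
  · intro x y
    have := hq x y
    rw [div_le_iff₀ hS0] at this
    exact this.trans (by have := mul_le_mul_of_nonneg_right hq1 hS0.le; linarith)
  · intro x
    refine le_trans ?_ hS1
    have e1 : (2 : ℝ) ≤ Real.exp (L / 2) := by
      have := Real.add_one_le_exp (L / 2)
      linarith
    have e2 : Real.exp ((1 - ε) * L) = Real.exp (L / 2) * Real.exp ((1 / 2 - ε) * L) := by
      rw [← Real.exp_add]; ring_nf
    rw [e2]
    exact mul_le_mul e1 (hwb x) (hpos N x).le (Real.exp_pos _).le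
  · -- a3
    rw [hpw, hpw, ← Real.rpow_add hL0]
    have e1 : L = L ^ (1 - 3 * δ - 8 * η) * L ^ (δ * (3 : ℕ) + η * (8 : ℕ)) := by
      rw [← Real.rpow_add hL0]
      norm_num
      have : 1 - 3 * δ - 8 * η + (δ * 3 + η * 8) = 1 := by ring
      rw [this, Real.rpow_one]
    conv_rhs => rw [e1]
    rw [one_mul] at b3
    exact mul_le_mul_of_nonneg_right b3 (Real.rpow_nonneg hL0.le _)
  · rw [mul_assoc, hpw, ← Real.rpow_add hL0]
    refine le_trans (le_of_eq ?_) b6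
    push_cast; ring_nf
  · rw [mul_assoc, hpw, hpw, ← Real.rpow_add hL0]
    rw [Real.rpow_one] at b7
    refine le_trans (le_of_eq ?_) b7
    push_cast; ring_nf
  · rw [hpw, ← Real.rpow_add hL0]
    refine le_trans (le_of_eq ?_) b8
    push_cast; ring_nf
  · -- a9
    rw [mul_pow, hpw]
    have e1 : Real.exp (-(ε * L)) = Real.exp (-(ε / 2 * L)) * Real.exp (-(ε / 2 * L)) := by
      rw [← Real.exp_add]; ring_nf
    rw [e1]
    have e2 := mul_le_mul_of_nonneg_left b9 (Real.exp_pos (-(ε / 2 * L))).le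
    rw [mul_one] at e2
    refine le_trans (le_of_eq ?_) e2
    rw [hc7]; ring
  · exact hM'
  · linarith
  · linarith

end final
end GRGProof
end

open GRG in
/-- The block-diagonal approximation is close to the adjacency matrix.
Under (A1) and (A2), for every `ν > 0` there is `C_ν > 0` such that with `ν`-high
probability `‖Â − A^p‖ ≤ C_ν √(log N/log log N)` and `‖Â − A‖ ≤ C_ν √(log N/log log N)`. -/
theorem block_diagonal_approximation
    (ε δ : ℝ) (hε : 0 < ε) (hε' : ε < 1 / 2) (hδ : 0 < δ) (hδ' : δ < 1 / 3)
    (r : ℕ) (hr : 6 ≤ r)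
    (w : (N : ℕ) → Fin N → ℝ)
    (hpos : ∀ N x, 0 < w N x)
    (hA1 : ∀ N x, w N x ≤ (N : ℝ) ^ ((1 : ℝ) / 2 - ε))
    (hA2m1 : ∀ N : ℕ, 1 ≤ N → (N : ℝ) ^ (-ε) ≤ m1 (w N))
    (hA2m2 : ∃ C > 0, ∀ N : ℕ, 2 ≤ N → m2 (w N) / m1 (w N) ≤ C * Real.log N ^ δ)
    (ν : ℝ) (hν : 0 < ν) :
    ∃ Cν > (0 : ℝ), ∃ C > (0 : ℝ), ∀ N : ℕ,
      1 - ENNReal.ofReal (C * (N : ℝ) ^ (-ν)) ≤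
        grgMeasure (w N) {ω |
          opNorm (AhatA (Adj ω) r ν δ - adjMatrixPA (Adj ω) r) ≤
            Cν * Real.sqrt (Real.log N / Real.log (Real.log N)) ∧
          opNorm (AhatA (Adj ω) r ν δ - adjMatrix ω) ≤
            Cν * Real.sqrt (Real.log N / Real.log (Real.log N))} := by
  obtain ⟨K', hK', hev⟩ := GRGProof.main_large ε δ hε hδ hδ' r w hpos hA1 hA2m1 hA2m2 ν hν
  obtain ⟨N0, hN0⟩ := Filter.eventually_atTop.1 hev
  refine ⟨2008 * √K', by positivity, 9 + (N0 : ℝ) ^ ν, by positivity, ?_⟩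
  intro N
  have := GRGProof.grg_prob (hpos N)
  rcases Nat.eq_zero_or_pos N with rfl | hNpos
  · have h1 : ∀ x : ℝ, {ω : EdgeIdx 0 → Bool |
          opNorm (AhatA (Adj ω) r ν δ - adjMatrixPA (Adj ω) r) ≤
            2008 * √K' * Real.sqrt x ∧
          opNorm (AhatA (Adj ω) r ν δ - adjMatrix ω) ≤
            2008 * √K' * Real.sqrt x} = Set.univ := by
      intro x
      apply Set.eq_univ_of_forall
      intro ω
      constructor <;> rw [GRGProof.opNorm_zero_dim] <;> positivity
    rw [h1, measure_univ]
    exact tsub_le_self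
  have hNr : (0 : ℝ) < N := by exact_mod_cast hNpos
  by_cases hN : N0 ≤ N
  · have h1 := hN0 N hN
    have h2 : (N : ℝ) * Real.exp (-((ν + 1) * Real.log N)) = (N : ℝ) ^ (-ν) := by
      rw [Real.rpow_def_of_pos hNr]
      nth_rewrite 1 [← Real.exp_log hNr]
      rw [← Real.exp_add]; ring_nf
    rw [h2] at h1
    simp only [Real.sqrt_mul hK'.le, ← mul_assoc] at h1
    set G := {ω : EdgeIdx N → Bool |
          opNorm (AhatA (Adj ω) r ν δ - adjMatrixPA (Adj ω) r) ≤
            2008 * √K' * Real.sqrt (Real.log N / Real.log (Real.log N)) ∧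
          opNorm (AhatA (Adj ω) r ν δ - adjMatrix ω) ≤
            2008 * √K' * Real.sqrt (Real.log N / Real.log (Real.log N))} with hG
    have h3 : grgMeasure (w N) G = 1 - grgMeasure (w N) Gᶜ := by
      rw [prob_compl_eq_one_sub (Set.toFinite G).measurableSet]
      rw [ENNReal.sub_sub_cancel ENNReal.one_ne_top prob_le_one]
    rw [h3]
    apply tsub_le_tsub_left
    rw [← ofReal_measureReal]
    apply ENNReal.ofReal_le_ofReal
    refine h1.trans ?_
    apply mul_le_mul_of_nonneg_right _ (by positivity)
    have : (0 : ℝ) ≤ (N0 : ℝ) ^ ν := by positivity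
    linarith
  · have h1 : 1 ≤ (9 + (N0 : ℝ) ^ ν) * (N : ℝ) ^ (-ν) := by
      rw [Real.rpow_neg hNr.le, ← div_eq_mul_inv, one_le_div (by positivity)]
      have : (N : ℝ) ^ ν ≤ (N0 : ℝ) ^ ν := by
        apply Real.rpow_le_rpow hNr.le _ hν.le
        exact_mod_cast (not_le.1 hN).le
      linarith
    have h2 : (1 : ENNReal) ≤ ENNReal.ofReal ((9 + (N0 : ℝ) ^ ν) * (N : ℝ) ^ (-ν)) := by
      rw [← ENNReal.ofReal_one]; exact ENNReal.ofReal_le_ofReal h1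
    rw [tsub_eq_zero_of_le h2]
    exact zero_le
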